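/- arXiv:math/0608780 — 3 statements merged into one kernel-verified Lean document; each statement's English description precedes it below -/
import Mathlib

section
/- Continuity of the solution map: Under the assumptions U ∈ C²(ℂ;ℝ), U(ψ) = u(|ψ|²), U(z) ≥ A − B|z|² (A ∈ ℝ, B > 0), for every T > 0 the map 𝒰: φ ↦ ψ, taking the initial data φ ∈ H¹(ℝ) to the solution ψ of the Duhamel equation, is continuous from H¹(ℝ) to L^∞([0,T], H¹(ℝ)). -/
/-!  Common framework for the Schrödinger equation coupled to a nonlinear
oscillator (point nonlinearity), following Komech–Komech.

The Sobolev space `H¹(ℝ)` is described through the Fourier side: an element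
of `H¹(ℝ)` is (identified with) a measurable function `hat : ℝ → ℂ`
(its Fourier transform, nonunitary convention `φ̂(k) = ∫ e^{-ikx} φ(x) dx`)
such that `(1+k²)^{1/2} φ̂ ∈ L²(ℝ)`.  Since `φ̂ ∈ L¹`, the continuous
representative `φ(x) = (2π)⁻¹ ∫ e^{ikx} φ̂(k) dk` is defined pointwise, so
`φ(0)` makes sense.  Plancherel gives `‖φ‖²_{L²} = (2π)⁻¹∫|φ̂|²` and
`‖φ'‖²_{L²} = (2π)⁻¹∫ k²|φ̂|²`. -/

noncomputable section

open MeasureTheory Real Set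

namespace SNLS

/-- The Sobolev space `H¹(ℝ)`, described via the Fourier transform. -/
structure H1 : Type where
  hat : ℝ → ℂ
  meas : AEStronglyMeasurable hat (volume : Measure ℝ)
  finite : Integrable (fun k : ℝ => (1 + k ^ 2) * ‖hat k‖ ^ 2) volume

namespace H1

/-- The continuous (pointwise defined) representative of `φ ∈ H¹(ℝ)`:
the inverse Fourier transform, which converges absolutely. -/
def toFun (φ : H1) : ℝ → ℂ := fun x =>
  (2 * π)⁻¹ * ∫ k : ℝ, Complex.exp (Complex.I * ((k * x : ℝ) : ℂ)) * φ.hat k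

/-- `‖φ‖²_{L²} = ∫_ℝ |φ(x)|² dx`, computed on the Fourier side (Plancherel). -/
def l2NormSq (φ : H1) : ℝ := (2 * π)⁻¹ * ∫ k : ℝ, ‖φ.hat k‖ ^ 2

/-- `‖φ'‖²_{L²} = ∫_ℝ |φ'(x)|² dx`, computed on the Fourier side. -/
def derivL2NormSq (φ : H1) : ℝ := (2 * π)⁻¹ * ∫ k : ℝ, k ^ 2 * ‖φ.hat k‖ ^ 2

/-- `‖φ‖²_{H¹} = ‖φ‖²_{L²} + ‖φ'‖²_{L²}`. -/
def normSq (φ : H1) : ℝ := (2 * π)⁻¹ * ∫ k : ℝ, (1 + k ^ 2) * ‖φ.hat k‖ ^ 2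

/-- The `H¹` norm. -/
def norm (φ : H1) : ℝ := Real.sqrt φ.normSq

/-- The `H¹` distance. -/
def dist (φ ψ : H1) : ℝ :=
  Real.sqrt ((2 * π)⁻¹ * ∫ k : ℝ, (1 + k ^ 2) * ‖φ.hat k - ψ.hat k‖ ^ 2)

/-- The `H¹` inner product `⟨f,g⟩_{H¹} = ⟨f,g⟩_{L²} + ⟨f',g'⟩_{L²}`,
computed on the Fourier side. -/
def inner (φ ψ : H1) : ℂ :=
  (2 * π)⁻¹ * ∫ k : ℝ, ((1 + k ^ 2 : ℝ) : ℂ) * (starRingEnd ℂ (φ.hat k) * ψ.hat k)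

/-- Continuity of a curve in `H¹` on a set of times, w.r.t. the `H¹` distance. -/
def ContOn (Ψ : ℝ → H1) (S : Set ℝ) : Prop :=
  ∀ t₀ ∈ S, ∀ δ > 0, ∃ η > 0, ∀ t ∈ S, |t - t₀| < η → dist (Ψ t) (Ψ t₀) < δ

end H1

/-- The free Schrödinger group `W_t`, defined by `(W_tφ)^(k) = e^{ik²t} φ̂(k)`;
equivalently `(W_tφ)(x) = (2π)⁻¹ ∫ e^{ikx} e^{ik²t} φ̂(k) dk`. -/
def W (t : ℝ) (φ : H1) : ℝ → ℂ := fun x =>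
  (2 * π)⁻¹ * ∫ k : ℝ, Complex.exp (Complex.I * ((k * x + k ^ 2 * t : ℝ) : ℂ)) * φ.hat k

/-- The charge `Q(φ) = ½ ∫_ℝ |φ|² dx`. -/
def charge (φ : H1) : ℝ := (1 / 2) * φ.l2NormSq

/-- The energy `𝓗(φ) = ½ ∫_ℝ |φ'|² dx + U(φ(0))`. -/
def energy (U : ℂ → ℝ) (φ : H1) : ℝ := (1 / 2) * φ.derivL2NormSq + U (φ.toFun 0)

/-- The gradient `∇_ψ U` of `U : ℂ → ℝ` with respect to `(Re ψ, Im ψ)`,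
viewed as a complex number. -/
def grad (U : ℂ → ℝ) (z : ℂ) : ℂ :=
  ((fderiv ℝ U z 1 : ℝ) : ℂ) + ((fderiv ℝ U z Complex.I : ℝ) : ℂ) * Complex.I

/-- The nonlinearity `F(ψ) = -∇_ψ U(ψ)`. -/
def nonlin (U : ℂ → ℝ) (z : ℂ) : ℂ := -grad U z

/-- The kernel `(2πs)^{-1/2} e^{ix²/(2s)}` of the free propagator applied to
`δ(x)` (principal branch of the square root for negative times). -/
def freeKernel (s x : ℝ) : ℂ :=
  ((2 * π * s : ℝ) : ℂ) ^ (-(1 / 2 : ℂ)) *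
    Complex.exp (Complex.I * ((x ^ 2 : ℝ) : ℂ) / ((2 * s : ℝ) : ℂ))

/-- `ψ` solves, for all times in `S`, the Duhamel equation
`ψ(x,t) = W_tφ(x) − ∫_0^t (2πs)^{−1/2} e^{ix²/(2s)} F(ψ(0,t−s)) ds`
for the Schrödinger equation with point nonlinearity `F` and data `φ`. -/
def IsDuhamelSolution (F : ℂ → ℂ) (φ : H1) (ψ : ℝ → ℝ → ℂ) (S : Set ℝ) : Prop :=
  ∀ x : ℝ, ∀ t ∈ S,
    ψ x t = W t φ x - ∫ s in (0 : ℝ)..t, freeKernel s x * F (ψ 0 (t - s))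

/-- `ψ ∈ C_b(ℝ × S; ℂ)`: bounded and continuous on `ℝ × S`. -/
def CbOn (ψ : ℝ → ℝ → ℂ) (S : Set ℝ) : Prop :=
  ContinuousOn (fun p : ℝ × ℝ => ψ p.1 p.2) (Set.univ ×ˢ S) ∧
    ∃ M : ℝ, ∀ x : ℝ, ∀ t ∈ S, ‖ψ x t‖ ≤ M

/-- `t ↦ ψ(·,t)` takes values in `H¹(ℝ)` and is `H¹`-continuous on `S`. -/
def ContH1On (ψ : ℝ → ℝ → ℂ) (S : Set ℝ) : Prop :=
  ∃ Ψ : ℝ → H1, (∀ t ∈ S, ∀ x : ℝ, (Ψ t).toFun x = ψ x t) ∧ H1.ContOn Ψ S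

/-- A mollifying profile: `ρ₁ ∈ C₀^∞`, nonnegative, supported in `[-1,1]`,
of total integral `1`. -/
structure Mollifier : Type where
  ρ : ℝ → ℝ
  smooth : ContDiff ℝ (⊤ : ℕ∞) ρ
  supp : ∀ x : ℝ, x ∉ Set.Icc (-1 : ℝ) 1 → ρ x = 0
  nonneg : ∀ x : ℝ, 0 ≤ ρ x
  total : (∫ x : ℝ, ρ x) = 1

/-- `ρ_ε(x) = ε⁻¹ ρ₁(x/ε)`. -/
def rho (m : Mollifier) (ε : ℝ) : ℝ → ℝ := fun x => ε⁻¹ * m.ρ (x / ε)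

/-- The pairing `⟨g, ψ⟩ = ∫_ℝ g(x) ψ(x) dx`. -/
def pair (g : ℝ → ℝ) (ψ : ℝ → ℂ) : ℂ := ∫ x : ℝ, (g x : ℂ) * ψ x

/-- The `H¹` norm of an ordinary (smooth) function. -/
def h1NormFun (g : ℝ → ℝ) : ℝ :=
  Real.sqrt ((∫ x : ℝ, g x ^ 2) + ∫ x : ℝ, deriv g x ^ 2)

/-- The Fourier transform `ĝ(k) = ∫ e^{-ikx} g(x) dx` of a real function. -/
def fourierHatR (g : ℝ → ℝ) : ℝ → ℂ := fun k =>
  ∫ x : ℝ, Complex.exp (-(Complex.I * ((k * x : ℝ) : ℂ))) * (g x : ℂ)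

/-- The curve `Ψ : ℝ → H¹` solves, for times in `S`, the regularized Duhamel
equation `ψ_ε(t) = W_tφ − ∫_0^t W_s[ρ_ε · F(⟨ρ_ε, ψ_ε(t−s)⟩)] ds`
(with `g = ρ_ε`), written on the Fourier side, where it reads
`ψ̂_ε(t)(k) = e^{ik²t}φ̂(k) − ∫_0^t e^{ik²s} ĝ(k) F(⟨g, ψ_ε(t−s)⟩) ds`. -/
def IsRegularizedSolution (F : ℂ → ℂ) (g : ℝ → ℝ) (φ : H1) (Ψ : ℝ → H1)
    (S : Set ℝ) : Prop :=
  ∀ t ∈ S, ∀ k : ℝ,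
    (Ψ t).hat k =
      Complex.exp (Complex.I * ((k ^ 2 * t : ℝ) : ℂ)) * φ.hat k -
        ∫ s in (0 : ℝ)..t,
          Complex.exp (Complex.I * ((k ^ 2 * s : ℝ) : ℂ)) * fourierHatR g k *
            F (pair g (Ψ (t - s)).toFun)

/-- The regularized energy `𝓗_ε(ψ) = ½‖ψ'‖²_{L²} + U(⟨ρ_ε, ψ⟩)` (with `g = ρ_ε`). -/
def energyReg (U : ℂ → ℝ) (g : ℝ → ℝ) (φ : H1) : ℝ :=
  (1 / 2) * φ.derivL2NormSq + U (pair g φ.toFun)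

end SNLS
namespace SNLS

/-- unit phase -/
def ex (θ : ℝ) : ℂ := Complex.exp (Complex.I * (θ : ℂ))

lemma norm_ex (θ : ℝ) : ‖ex θ‖ = 1 := by
  unfold ex; rw [mul_comm]; exact Complex.norm_exp_ofReal_mul_I θ

lemma ex_add (a b : ℝ) : ex (a + b) = ex a * ex b := by
  unfold ex; rw [← Complex.exp_add]; congr 1; push_cast; ring

lemma ex_zero : ex 0 = 1 := by simp [ex]

lemma ex_conj (a : ℝ) : (starRingEnd ℂ) (ex a) = ex (-a) := by
  unfold ex; rw [← Complex.exp_conj]; simp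

lemma continuous_ex : Continuous ex := by unfold ex; fun_prop

lemma ex_mul_neg (a : ℝ) : ex a * ex (-a) = 1 := by
  rw [← ex_add]; simp [ex_zero]

lemma integrable_ex_mul {d : ℝ → ℂ} {μ : Measure ℝ} (hd : Integrable d μ) {p : ℝ → ℝ} (hp : Continuous p) :
    Integrable (fun τ => ex (p τ) * d τ) μ := by
  refine hd.bdd_mul (c := 1) ((continuous_ex.comp hp).aestronglyMeasurable) ?_
  exact Filter.Eventually.of_forall (fun x => (norm_ex _).le)

lemma gauss_ft {ε : ℝ} (hε : 0 < ε) (x : ℝ) :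
    ∫ l : ℝ, ((rexp (-ε * l ^ 2) : ℝ) : ℂ) * ex (l * x)
      = ((√(π / ε) * rexp (-(1 / (4 * ε)) * x ^ 2) : ℝ) : ℂ) := by
  have h := fourierIntegral_gaussian (b := (ε : ℂ)) (by simpa using hε) (x : ℂ)
  have h2 : ∀ l : ℝ, ((rexp (-ε * l ^ 2) : ℝ) : ℂ) * ex (l * x)
      = Complex.exp (Complex.I * x * l) * Complex.exp (-(ε : ℂ) * l ^ 2) := by
    intro l; unfold ex; push_cast; rw [mul_comm]; congr 2; ring
  simp_rw [h2]; rw [h]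
  push_cast
  congr 1
  · rw [Real.sqrt_eq_rpow, Complex.ofReal_cpow (by positivity)]; push_cast; rfl
  · congr 1; field_simp

lemma planch_eps {d : ℝ → ℂ} (hd : Integrable d) (hd2 : Integrable (fun x => ‖d x‖ ^ 2))
    {ε : ℝ} (hε : 0 < ε) :
    ∫ l : ℝ, rexp (-ε * l ^ 2) * ‖∫ τ : ℝ, ex (l * τ) * d τ‖ ^ 2 ≤ 2 * π * ∫ x, ‖d x‖ ^ 2 := by
  set k : ℝ → ℝ := fun x => √(π / ε) * rexp (-(1 / (4 * ε)) * x ^ 2) with hk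
  have hk0 : ∀ x, 0 ≤ k x := fun x => by positivity
  have hki : Integrable k := (integrable_exp_neg_mul_sq (by positivity)).const_mul _
  have hkint : ∫ x, k x = 2 * π := by
    rw [hk, integral_const_mul, integral_gaussian, ← Real.sqrt_mul (by positivity)]
    rw [show π / ε * (π / (1 / (4 * ε))) = (2 * π) ^ 2 by field_simp; ring]
    exact Real.sqrt_sq (by positivity)
  have hdm := hd.aestronglyMeasurable
  -- complex identity
  have h1 : ((∫ l : ℝ, rexp (-ε * l ^ 2) * ‖∫ τ : ℝ, ex (l * τ) * d τ‖ ^ 2 : ℝ) : ℂ)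
      = ∫ l : ℝ, ∫ p : ℝ × ℝ, (((rexp (-ε * l ^ 2) : ℝ) : ℂ) * ex (l * (p.1 - p.2))) *
          (d p.1 * (starRingEnd ℂ) (d p.2)) := by
    rw [← integral_complex_ofReal]
    congr 1; ext l
    have : ∀ p : ℝ × ℝ, (((rexp (-ε * l ^ 2) : ℝ) : ℂ) * ex (l * (p.1 - p.2))) *
          (d p.1 * (starRingEnd ℂ) (d p.2)) = ((rexp (-ε * l ^ 2) : ℝ) : ℂ) *
          ((ex (l * p.1) * d p.1) * ((starRingEnd ℂ) (ex (l * p.2) * d p.2))) := by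
      intro p
      rw [map_mul, ex_conj, mul_sub, sub_eq_add_neg, ex_add]; ring
    simp_rw [this]
    rw [integral_const_mul]
    have h3 := integral_prod_mul (μ := (volume : Measure ℝ)) (ν := (volume : Measure ℝ))
      (fun τ => ex (l * τ) * d τ) (fun σ => (starRingEnd ℂ) (ex (l * σ) * d σ))
    rw [← Measure.volume_eq_prod] at h3
    rw [h3, integral_conj, Complex.mul_conj, Complex.normSq_eq_norm_sq]
    push_cast; rfl
  have hdd : Integrable (fun p : ℝ × ℝ => d p.1 * (starRingEnd ℂ) (d p.2)) := by
    have := hd.mul_prod (ν := volume) (g := fun σ => (starRingEnd ℂ) (d σ)) (by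
      simpa using (Complex.conjLIE.toContinuousLinearEquiv.toContinuousLinearMap.integrable_comp hd))
    rwa [← Measure.volume_eq_prod] at this
  have hint : Integrable (Function.uncurry fun (l : ℝ) (p : ℝ × ℝ) =>
      (((rexp (-ε * l ^ 2) : ℝ) : ℂ) * ex (l * (p.1 - p.2))) *
          (d p.1 * (starRingEnd ℂ) (d p.2))) (volume.prod volume) := by
    have hg : Integrable (fun l : ℝ => ((rexp (-ε * l ^ 2) : ℝ) : ℂ)) :=
      (integrable_exp_neg_mul_sq hε).ofReal
    have h0 := hg.mul_prod hdd
    have hc : Continuous (fun q : ℝ × (ℝ × ℝ) => ex (q.1 * (q.2.1 - q.2.2))) :=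
      continuous_ex.comp (by fun_prop)
    refine (h0.bdd_mul (c := 1) hc.aestronglyMeasurable
      (Filter.Eventually.of_forall (fun x => (norm_ex _).le))).congr ?_
    refine Filter.Eventually.of_forall (fun q => ?_)
    simp only [Function.uncurry]; ring
  rw [integral_integral_swap hint] at h1
  have h4 : ∀ p : ℝ × ℝ, ∫ l : ℝ, (((rexp (-ε * l ^ 2) : ℝ) : ℂ) * ex (l * (p.1 - p.2))) *
          (d p.1 * (starRingEnd ℂ) (d p.2)) = (k (p.1 - p.2) : ℂ) * (d p.1 * (starRingEnd ℂ) (d p.2)) := by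
    intro p
    rw [integral_mul_const, gauss_ft hε]
  simp_rw [h4] at h1
  have hb : Integrable (fun p : ℝ × ℝ => ‖d p.1‖ ^ 2 * k (p.1 - p.2)) := by
    have := (hd2.convolution_integrand (ContinuousLinearMap.mul ℝ ℝ) hki)
    rw [← Measure.volume_eq_prod] at this
    have h5 := this.swap
    refine h5.congr (Filter.Eventually.of_forall (fun p => ?_))
    have hev : k (p.2 - p.1) = k (p.1 - p.2) := by
      simp only [hk]; congr 2; ring
    change ‖d p.1‖ ^ 2 * k (p.2 - p.1) = _
    rw [hev]
  have hb2 : Integrable (fun p : ℝ × ℝ => ‖d p.2‖ ^ 2 * k (p.1 - p.2)) := by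
    have := (hd2.convolution_integrand (ContinuousLinearMap.mul ℝ ℝ) hki)
    rw [← Measure.volume_eq_prod] at this
    exact this
  have i1 : ∫ p : ℝ × ℝ, ‖d p.1‖ ^ 2 * k (p.1 - p.2) = 2 * π * ∫ x, ‖d x‖ ^ 2 := by
    rw [Measure.volume_eq_prod, integral_prod _ (by rwa [← Measure.volume_eq_prod])]
    simp_rw [integral_const_mul]
    have : ∀ x, ∫ y, k (x - y) = 2 * π := fun x => by
      rw [integral_sub_left_eq_self, hkint]
    simp_rw [this]; rw [integral_mul_const, mul_comm]
  have i2 : ∫ p : ℝ × ℝ, ‖d p.2‖ ^ 2 * k (p.1 - p.2) = 2 * π * ∫ x, ‖d x‖ ^ 2 := by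
    rw [Measure.volume_eq_prod, integral_prod_symm _ (by rwa [← Measure.volume_eq_prod])]
    simp_rw [integral_const_mul]
    have : ∀ x, ∫ y, k (y - x) = 2 * π := fun x => by
      rw [integral_sub_right_eq_self, hkint]
    simp_rw [this]; rw [integral_mul_const, mul_comm]
  calc _ ≤ ‖((∫ l : ℝ, rexp (-ε * l ^ 2) * ‖∫ τ : ℝ, ex (l * τ) * d τ‖ ^ 2 : ℝ) : ℂ)‖ := by
        rw [Complex.norm_real]; exact le_abs_self _
    _ ≤ ∫ p : ℝ × ℝ, (1 / 2) * (‖d p.1‖ ^ 2 * k (p.1 - p.2) + ‖d p.2‖ ^ 2 * k (p.1 - p.2)) := by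
        rw [h1]
        refine norm_integral_le_of_norm_le ((hb.add hb2).const_mul _) (Filter.Eventually.of_forall fun p => ?_)
        rw [norm_mul, norm_mul, Complex.norm_real, Real.norm_of_nonneg (hk0 _), RCLike.norm_conj]
        nlinarith [sq_nonneg (‖d p.1‖ - ‖d p.2‖), hk0 (p.1 - p.2),
          mul_nonneg (hk0 (p.1 - p.2)) (sq_nonneg (‖d p.1‖ - ‖d p.2‖))]
    _ = _ := by
        rw [integral_const_mul, integral_add hb hb2, i1, i2]; ring

lemma continuous_ft {d : ℝ → ℂ} {μ : Measure ℝ} (hd : Integrable d μ) :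
    Continuous (fun l : ℝ => ∫ τ : ℝ, ex (l * τ) * d τ ∂μ) := by
  refine continuous_of_dominated (bound := fun τ => ‖d τ‖) ?_ ?_ hd.norm ?_
  · intro l; exact (integrable_ex_mul hd (by fun_prop)).aestronglyMeasurable
  · intro l; refine Filter.Eventually.of_forall fun τ => ?_
    rw [norm_mul, norm_ex, one_mul]
  · refine Filter.Eventually.of_forall fun τ => ?_
    exact (continuous_ex.comp (by fun_prop)).mul continuous_const

lemma planch {d : ℝ → ℂ} (hd : Integrable d) (hd2 : Integrable (fun x => ‖d x‖ ^ 2)) :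
    ∫⁻ l : ℝ, ENNReal.ofReal (‖∫ τ : ℝ, ex (l * τ) * d τ‖ ^ 2) ≤
      ENNReal.ofReal (2 * π * ∫ x, ‖d x‖ ^ 2) := by
  set D : ℝ → ℂ := fun l => ∫ τ : ℝ, ex (l * τ) * d τ with hD
  have hDc : Continuous D := continuous_ft hd
  have hDb : ∀ l, ‖D l‖ ≤ ∫ τ, ‖d τ‖ := fun l => by
    refine (norm_integral_le_integral_norm _).trans (le_of_eq ?_)
    simp [norm_ex]
  have hlim : ∀ l : ℝ, Filter.Tendsto (fun n : ℕ => ENNReal.ofReal (rexp (-(1 / ((n:ℝ) + 1)) * l ^ 2) * ‖D l‖ ^ 2))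
      Filter.atTop (nhds (ENNReal.ofReal (‖D l‖ ^ 2))) := by
    intro l
    refine ENNReal.tendsto_ofReal ?_
    have h : Filter.Tendsto (fun n : ℕ => rexp (-(1 / ((n:ℝ) + 1)) * l ^ 2) * ‖D l‖ ^ 2) Filter.atTop
       (nhds (rexp (-0 * l ^ 2) * ‖D l‖ ^ 2)) :=
      (((Real.continuous_exp.tendsto _).comp
        ((tendsto_one_div_add_atTop_nhds_zero_nat (𝕜 := ℝ)).neg.mul_const (l ^ 2)))).mul_const _
    simpa using h
  calc _ = ∫⁻ l : ℝ, Filter.liminf (fun n : ℕ => ENNReal.ofReal (rexp (-(1 / ((n:ℝ) + 1)) * l ^ 2) * ‖D l‖ ^ 2)) Filter.atTop := by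
        congr 1; ext l; exact (hlim l).liminf_eq.symm
    _ ≤ Filter.liminf (fun n : ℕ => ∫⁻ l : ℝ, ENNReal.ofReal (rexp (-(1 / ((n:ℝ) + 1)) * l ^ 2) * ‖D l‖ ^ 2)) Filter.atTop := by
        refine lintegral_liminf_le fun n => ?_
        have : Continuous fun l : ℝ => rexp (-(1 / ((n:ℝ) + 1)) * l ^ 2) * ‖D l‖ ^ 2 := by fun_prop
        exact (ENNReal.continuous_ofReal.comp this).measurable
    _ ≤ _ := by
        refine Filter.liminf_le_of_frequently_le' (Filter.Frequently.of_forall fun n => ?_)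
        have hp : (0:ℝ) < 1 / ((n:ℝ) + 1) := by positivity
        rw [← ofReal_integral_eq_lintegral_ofReal]
        · exact ENNReal.ofReal_le_ofReal (planch_eps hd hd2 hp)
        · refine (integrable_exp_neg_mul_sq hp).mul_bdd (c := (∫ τ, ‖d τ‖) ^ 2) (by fun_prop) (Filter.Eventually.of_forall fun l => ?_)
          rw [norm_pow, norm_norm]
          exact pow_le_pow_left₀ (norm_nonneg _) (hDb l) 2
        · exact Filter.Eventually.of_forall fun l => by positivity

lemma planch2 {d : ℝ → ℂ} (hd : Integrable d) (hd2 : Integrable (fun x => ‖d x‖ ^ 2)) {c : ℝ} (hc : 0 < c) :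
    ∫⁻ k : ℝ, ENNReal.ofReal (|k| * ‖∫ τ : ℝ, ex (c * k ^ 2 * τ) * d τ‖ ^ 2) ≤
      ENNReal.ofReal (2 * π / c * ∫ x, ‖d x‖ ^ 2) := by
  have key : ∀ s : Set ℝ, MeasurableSet s → InjOn (fun k : ℝ => c * k ^ 2) s →
      ∫⁻ k in s, ENNReal.ofReal (|k| * ‖∫ τ : ℝ, ex (c * k ^ 2 * τ) * d τ‖ ^ 2) ≤
      ENNReal.ofReal (π / c * ∫ x, ‖d x‖ ^ 2) := by
    intro s hs hinj
    have h := lintegral_image_eq_lintegral_abs_deriv_mul (f := fun k : ℝ => c * k ^ 2) (f' := fun k => c * (2 * k)) hs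
      (fun x _ => by simpa using (((hasDerivAt_pow 2 x).const_mul c).hasDerivWithinAt (s := s))) hinj
      (fun l => ENNReal.ofReal (‖∫ τ : ℝ, ex (l * τ) * d τ‖ ^ 2))
    have h2 := (setLIntegral_le_lintegral ((fun k : ℝ => c * k ^ 2) '' s) _).trans (planch hd hd2)
    rw [h] at h2
    calc _ = ENNReal.ofReal (1 / (2 * c)) * ∫⁻ k in s, ENNReal.ofReal |c * (2 * k)| * ENNReal.ofReal (‖∫ τ : ℝ, ex (c * k ^ 2 * τ) * d τ‖ ^ 2) := by
          rw [← lintegral_const_mul' _ _ ENNReal.ofReal_ne_top]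
          congr 1; ext k
          rw [← ENNReal.ofReal_mul (abs_nonneg _), ← ENNReal.ofReal_mul (by positivity)]
          congr 1
          rw [abs_mul, abs_mul, abs_of_pos hc, abs_two]; field_simp
      _ ≤ ENNReal.ofReal (1 / (2 * c)) * ENNReal.ofReal (2 * π * ∫ x, ‖d x‖ ^ 2) := by gcongr
      _ = _ := by
          rw [← ENNReal.ofReal_mul (by positivity)]; congr 1; field_simp
  have hI : 0 ≤ ∫ x, ‖d x‖ ^ 2 := integral_nonneg fun x => by positivity
  rw [← lintegral_add_compl _ (measurableSet_Ici (a := (0:ℝ)))]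
  refine (add_le_add (key _ measurableSet_Ici ?_) (key _ measurableSet_Ici.compl ?_)).trans (le_of_eq ?_)
  · intro a ha b hb hab
    have : a ^ 2 = b ^ 2 := mul_left_cancel₀ hc.ne' hab
    exact (pow_left_inj₀ ha hb two_ne_zero).1 this
  · intro a ha b hb hab
    have h1 : a ^ 2 = b ^ 2 := mul_left_cancel₀ hc.ne' hab
    simp only [compl_Ici, mem_Iio] at ha hb
    nlinarith [sq_eq_sq_iff_eq_or_eq_neg.1 h1]
  · rw [← ENNReal.ofReal_add (by positivity) (by positivity)]; congr 1; ring

lemma isqrt_eq {s : ℝ} (hs : 0 ≤ s) : (√s)⁻¹ = s ^ (-(1/2) : ℝ) := by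
  rw [Real.sqrt_eq_rpow, Real.rpow_neg hs]

lemma isqrt_ii {a b : ℝ} (ha : 0 ≤ a) (hb : 0 ≤ b) :
    IntervalIntegrable (fun s : ℝ => (√s)⁻¹) volume a b := by
  have h : IntervalIntegrable (fun s : ℝ => s ^ (-(1/2) : ℝ)) volume a b :=
    intervalIntegral.intervalIntegrable_rpow' (by norm_num)
  refine h.congr (fun s hs => ?_)
  have : 0 ≤ s := (le_min ha hb).trans hs.1.le
  exact (isqrt_eq this).symm

lemma isqrt_int {a b : ℝ} (ha : 0 ≤ a) (hb : 0 ≤ b) :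
    ∫ s in a..b, (√s)⁻¹ = 2 * (√b - √a) := by
  have : ∫ s in a..b, (√s)⁻¹ = ∫ s in a..b, s ^ (-(1/2) : ℝ) := by
    refine intervalIntegral.integral_congr (fun s hs => ?_)
    exact isqrt_eq ((le_min ha hb).trans hs.1)
  rw [this, integral_rpow (Or.inl (by norm_num)), Real.sqrt_eq_rpow, Real.sqrt_eq_rpow]
  norm_num; ring

lemma norm_ex_sub_one_sq (θ : ℝ) : ‖ex θ - 1‖ ^ 2 = 2 - 2 * cos θ := by
  have : ex θ = (cos θ : ℂ) + (sin θ : ℂ) * Complex.I := by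
    unfold ex; rw [mul_comm, Complex.exp_mul_I]; push_cast; rfl
  rw [← Complex.normSq_eq_norm_sq, this, Complex.normSq_apply]
  simp [-Complex.ofReal_cos, -Complex.ofReal_sin]
  nlinarith [sin_sq_add_cos_sq θ]

lemma ex_lower {θ : ℝ} (h1 : 1 / 2 ≤ |θ|) (h2 : |θ| ≤ 1) : 1 / 10 ≤ ‖ex θ - 1‖ ^ 2 := by
  rw [norm_ex_sub_one_sq, ← cos_abs]
  have : cos |θ| ≤ cos (1 / 2) := cos_le_cos_of_nonneg_of_le_pi (by norm_num) (by linarith [pi_gt_three]) h1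
  have h3 : cos (1 / 2 : ℝ) ≤ 1 - (1 / 2) ^ 2 / 2 + (1 / 2) ^ 4 * (5 / 96) := by
    have := (abs_le.1 (Real.cos_bound (x := 1 / 2) (by norm_num [abs_of_pos]))).2
    rw [abs_of_pos (by norm_num)] at this; linarith
  norm_num at h3
  linarith

/-- truncated function -/
def trunc (t : ℝ) (g : ℝ → ℂ) : ℝ → ℂ := (Ioc 0 t).indicator g

lemma trunc_int {g : ℝ → ℂ} (hg : Continuous g) (t : ℝ) : Integrable (trunc t g) := by
  unfold trunc
  rw [integrable_indicator_iff measurableSet_Ioc]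
  exact (hg.integrableOn_Icc (a := 0) (b := t)).mono_set Ioc_subset_Icc_self

lemma trunc_ft {g : ℝ → ℂ} {t : ℝ} (ht : 0 ≤ t) (l : ℝ) :
    ∫ τ in (0:ℝ)..t, ex (l * τ) * g τ = ∫ τ, ex (l * τ) * trunc t g τ := by
  rw [intervalIntegral.integral_of_le ht, ← integral_indicator measurableSet_Ioc]
  congr 1; ext τ
  unfold trunc
  by_cases h : τ ∈ Ioc 0 t <;> simp [h]

lemma trunc_diff {g : ℝ → ℂ} (hg : Continuous g) {T t N C h : ℝ} (ht : 0 ≤ t) (htT : t ≤ T)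
    (hN : ∀ τ ∈ Icc 0 T, ‖g τ‖ ≤ N) (hh : 0 < h)
    (hC : ∫ τ in (0:ℝ)..T, ‖g (τ + h) - g τ‖ ^ 2 ≤ C * h) :
    Integrable (fun τ => ‖trunc t g (τ + h) - trunc t g τ‖ ^ 2) ∧
    ∫ τ, ‖trunc t g (τ + h) - trunc t g τ‖ ^ 2 ≤ (2 * N ^ 2 + C) * h := by
  have hN0 : 0 ≤ N := (norm_nonneg _).trans (hN 0 ⟨le_rfl, ht.trans htT⟩)
  set b : ℝ → ℝ := fun τ => (Ioc (-h) 0).indicator (fun _ => N ^ 2) τ +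
    (Ioc (t - h) t).indicator (fun _ => N ^ 2) τ + (Ioc 0 T).indicator (fun τ => ‖g (τ + h) - g τ‖ ^ 2) τ with hb
  have hle : ∀ τ, ‖trunc t g (τ + h) - trunc t g τ‖ ^ 2 ≤ b τ := by
    intro τ
    have a1 : 0 ≤ (Ioc (-h) 0).indicator (fun _ => N ^ 2) τ := indicator_nonneg (fun _ _ => by positivity) _
    have a2 : 0 ≤ (Ioc (t - h) t).indicator (fun _ => N ^ 2) τ := indicator_nonneg (fun _ _ => by positivity) _
    have a3 : 0 ≤ (Ioc 0 T).indicator (fun τ => ‖g (τ + h) - g τ‖ ^ 2) τ := indicator_nonneg (fun _ _ => by positivity) _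
    by_cases h1 : τ + h ∈ Ioc 0 t
    · by_cases h2 : τ ∈ Ioc 0 t
      · have : τ ∈ Ioc 0 T := ⟨h2.1, h2.2.trans htT⟩
        have e3 : (Ioc 0 T).indicator (fun τ => ‖g (τ + h) - g τ‖ ^ 2) τ = ‖g (τ + h) - g τ‖ ^ 2 := indicator_of_mem this _
        simp only [trunc, indicator_of_mem h1, indicator_of_mem h2]; simp only [hb]; linarith
      · have : τ ∈ Ioc (-h) 0 := ⟨by linarith [h1.1], by
          by_contra hc; push Not at hc; exact h2 ⟨hc, by linarith [h1.2]⟩⟩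
        have e3 : (Ioc (-h) 0).indicator (fun _ => N ^ 2) τ = N ^ 2 := indicator_of_mem this _
        have := pow_le_pow_left₀ (norm_nonneg _) (hN (τ + h) ⟨h1.1.le, h1.2.trans htT⟩) 2
        simp only [trunc, indicator_of_mem h1, indicator_of_notMem h2, sub_zero]; simp only [hb]; linarith
    · by_cases h2 : τ ∈ Ioc 0 t
      · have : τ ∈ Ioc (t - h) t := ⟨by
          by_contra hc; push Not at hc; exact h1 ⟨by linarith [h2.1], by linarith⟩, h2.2⟩
        have e3 : (Ioc (t - h) t).indicator (fun _ => N ^ 2) τ = N ^ 2 := indicator_of_mem this _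
        have := pow_le_pow_left₀ (norm_nonneg _) (hN τ ⟨h2.1.le, h2.2.trans htT⟩) 2
        simp only [trunc, indicator_of_notMem h1, indicator_of_mem h2, zero_sub, norm_neg]; simp only [hb]; linarith
      · simp only [trunc, indicator_of_notMem h1, indicator_of_notMem h2]; simp only [hb]
        simp; linarith
  have i1 : Integrable ((Ioc (-h) 0).indicator (fun _ => N ^ 2)) := by
    rw [integrable_indicator_iff measurableSet_Ioc]; exact integrableOn_const (by simp)
  have i2 : Integrable ((Ioc (t-h) t).indicator (fun _ => N ^ 2)) := by
    rw [integrable_indicator_iff measurableSet_Ioc]; exact integrableOn_const (by simp)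
  have i3 : Integrable ((Ioc 0 T).indicator (fun τ => ‖g (τ + h) - g τ‖ ^ 2)) := by
    rw [integrable_indicator_iff measurableSet_Ioc]
    have : Continuous (fun τ => ‖g (τ + h) - g τ‖ ^ 2) := by fun_prop
    exact (this.integrableOn_Icc (a := 0) (b := T)).mono_set Ioc_subset_Icc_self
  have ib : Integrable b := (i1.add i2).add i3
  have hint : Integrable (fun τ => ‖trunc t g (τ + h) - trunc t g τ‖ ^ 2) := by
    refine ib.mono' ?_ (Filter.Eventually.of_forall fun τ => ?_)
    · exact (((trunc_int hg t).comp_add_right h).sub (trunc_int hg t)).aestronglyMeasurable.norm.pow 2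
    · rw [Real.norm_of_nonneg (by positivity)]; exact hle τ
  refine ⟨hint, (integral_mono hint ib hle).trans ?_⟩
  have : ∫ τ, b τ = N ^ 2 * h + N ^ 2 * h + ∫ τ in (0:ℝ)..T, ‖g (τ + h) - g τ‖ ^ 2 := by
    simp only [hb]
    have i12 : Integrable (fun τ => (Ioc (-h) 0).indicator (fun _ => N ^ 2) τ +
      (Ioc (t - h) t).indicator (fun _ => N ^ 2) τ) := i1.add i2
    rw [integral_add i12 i3, integral_add i1 i2, integral_indicator measurableSet_Ioc,
      integral_indicator measurableSet_Ioc, integral_indicator measurableSet_Ioc,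
      ← intervalIntegral.integral_of_le (ht.trans htT)]
    simp [hh.le]; ring
  rw [this]; linarith

lemma trunc_diff_ft {g : ℝ → ℂ} (hg : Continuous g) (t h l : ℝ) :
    ∫ τ, ex (l * τ) * (trunc t g (τ + h) - trunc t g τ) = (ex (-(l * h)) - 1) * ∫ τ, ex (l * τ) * trunc t g τ := by
  have i := trunc_int hg t
  have i1 := integrable_ex_mul i (p := fun τ => l * τ) (by fun_prop)
  have i2 := integrable_ex_mul (i.comp_add_right h) (p := fun τ => l * τ) (by fun_prop)
  simp_rw [mul_sub]
  rw [integral_sub i2 i1, sub_mul, one_mul]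
  congr 1
  rw [← integral_const_mul, ← integral_add_right_eq_self (fun τ => ex (-(l * h)) * (ex (l * τ) * trunc t g τ)) h]
  congr 1; ext τ
  rw [← mul_assoc, ← ex_add]; congr 2; ring

lemma tail_bound {g : ℝ → ℂ} (hg : Continuous g) {T t N C : ℝ} (ht : 0 ≤ t) (htT : t ≤ T)
    (hN : ∀ τ ∈ Icc 0 T, ‖g τ‖ ≤ N)
    (hC : ∀ h ∈ Ioc (0:ℝ) 1, ∫ τ in (0:ℝ)..T, ‖g (τ + h) - g τ‖ ^ 2 ≤ C * h) {R : ℝ} (hR : 2 ≤ R) :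
    ∫⁻ k in {k : ℝ | R ≤ |k|}, ENNReal.ofReal (k ^ 2 * ‖∫ τ in (0:ℝ)..t, ex (1 / 2 * k ^ 2 * τ) * g τ‖ ^ 2) ≤
      ENNReal.ofReal (640 * π * (2 * N ^ 2 + C) / R) := by
  set G : ℝ → ℂ := fun k => ∫ τ in (0:ℝ)..t, ex (1 / 2 * k ^ 2 * τ) * g τ with hG
  have hGe : G = fun k => ∫ τ, ex (1 / 2 * k ^ 2 * τ) * trunc t g τ := by
    ext k; exact trunc_ft ht _
  have hGc : Continuous G := by
    rw [hGe]; exact (continuous_ft (trunc_int hg t)).comp (by fun_prop : Continuous fun k : ℝ => 1 / 2 * k ^ 2)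
  set M := 2 * N ^ 2 + C with hM
  have hM0 : 0 ≤ M := by
    have := (integral_nonneg (fun τ => by positivity)).trans (trunc_diff hg ht htT hN one_pos (hC 1 ⟨one_pos, le_rfl⟩)).2
    linarith
  have hR0 : 0 < R := by linarith
  -- fixed h
  have hfix : ∀ h ∈ Ioc (0:ℝ) 1, ∫⁻ k : ℝ, ENNReal.ofReal (|k| * (‖ex (-(1 / 2 * k ^ 2 * h)) - 1‖ ^ 2 * ‖G k‖ ^ 2)) ≤
      ENNReal.ofReal (4 * π * M * h) := by
    intro h hh
    obtain ⟨j1, j2⟩ := trunc_diff hg ht htT hN hh.1 (hC h hh)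
    have := planch2 (((trunc_int hg t).comp_add_right h).sub (trunc_int hg t)) j1 (c := 1 / 2) (by norm_num)
    simp only [Pi.sub_apply] at this
    simp_rw [trunc_diff_ft hg, norm_mul, mul_pow] at this
    rw [hGe]
    refine this.trans (ENNReal.ofReal_le_ofReal ?_)
    calc _ ≤ 2 * π / (1 / 2) * (M * h) := by gcongr
      _ = _ := by ring
  set h0 : ℝ := 2 / R ^ 2 with hh0
  have hh0p : 0 < h0 := by positivity
  have hh01 : h0 ≤ 1 := by
    rw [hh0, div_le_one (by positivity)]; nlinarith
  set Φ : ℝ → ℝ → ℝ := fun k h => 40 * (h * √h)⁻¹ * (|k| * (‖ex (-(1 / 2 * k ^ 2 * h)) - 1‖ ^ 2 * ‖G k‖ ^ 2)) with hΦ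
  have hΦm : Measurable (Function.uncurry Φ) := by
    have c1 : Continuous (fun q : ℝ × ℝ => ex (-(1 / 2 * q.1 ^ 2 * q.2))) := continuous_ex.comp (by fun_prop)
    have c2 : Continuous (fun q : ℝ × ℝ => |q.1| * (‖ex (-(1 / 2 * q.1 ^ 2 * q.2)) - 1‖ ^ 2 * ‖G q.1‖ ^ 2)) := by
      fun_prop
    have c3 : Measurable (fun q : ℝ × ℝ => 40 * (q.2 * √q.2)⁻¹) :=
      ((by fun_prop : Continuous (fun q : ℝ × ℝ => (q.2 * √q.2))).measurable.inv).const_mul 40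
    exact c3.mul c2.measurable
  have hpt : ∀ k ∈ {k : ℝ | R ≤ |k|}, ENNReal.ofReal (k ^ 2 * ‖G k‖ ^ 2) ≤ ∫⁻ h in Ioc 0 h0, ENNReal.ofReal (Φ k h) := by
    intro k hk
    have hk : R ≤ |k| := hk
    have hk0 : 0 < |k| := by linarith
    have hkk : k ^ 2 = |k| ^ 2 := (sq_abs k).symm
    have hsub : Icc (1 / k ^ 2) (2 / k ^ 2) ⊆ Ioc 0 h0 := by
      intro h hh
      refine ⟨lt_of_lt_of_le (by rw [hkk]; positivity) hh.1, hh.2.trans ?_⟩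
      rw [hkk, hh0]; gcongr
    calc ENNReal.ofReal (k ^ 2 * ‖G k‖ ^ 2) = ∫⁻ h in Icc (1 / k ^ 2) (2 / k ^ 2), ENNReal.ofReal (k ^ 4 * ‖G k‖ ^ 2) := by
          rw [setLIntegral_const, Real.volume_Icc, ← ENNReal.ofReal_mul (by positivity)]
          congr 1
          have : k ≠ 0 := abs_pos.1 hk0
          field_simp; ring
      _ ≤ ∫⁻ h in Icc (1 / k ^ 2) (2 / k ^ 2), ENNReal.ofReal (Φ k h) := by
          refine setLIntegral_mono' measurableSet_Icc fun h hh => ENNReal.ofReal_le_ofReal ?_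
          have hhp : 0 < h := (hsub hh).1
          have b1 : 1 / 10 ≤ ‖ex (-(1 / 2 * k ^ 2 * h)) - 1‖ ^ 2 := by
            have k2 : 0 < k ^ 2 := by rw [hkk]; positivity
            have u1 := (div_le_iff₀ k2).1 hh.1
            have u2 := (le_div_iff₀ k2).1 hh.2
            apply ex_lower
            · rw [abs_neg, abs_of_nonneg (by positivity)]; nlinarith
            · rw [abs_neg, abs_of_nonneg (by positivity)]; nlinarith
          have b2 : |k| ^ 3 / 4 ≤ (h * √h)⁻¹ := by
            rw [← inv_inv (|k| ^ 3 / 4)]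
            refine inv_anti₀ (by positivity) ?_
            have : √h ≤ 2 / |k| := by
              rw [Real.sqrt_le_left (by positivity)]
              refine hh.2.trans ?_
              rw [hkk, div_pow]; gcongr; norm_num
            calc h * √h ≤ (2 / |k| ^ 2) * (2 / |k|) := by
                  refine mul_le_mul (by rw [← hkk]; exact hh.2) this (by positivity) (by positivity)
              _ = _ := by field_simp; norm_num
          calc k ^ 4 * ‖G k‖ ^ 2 = 40 * (|k| ^ 3 / 4) * (|k| * (1 / 10 * ‖G k‖ ^ 2)) := by
                rw [show k ^ 4 = |k| ^ 4 by rw [show k ^ 4 = (k ^ 2) ^ 2 by ring, hkk]; ring]; ring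
            _ ≤ Φ k h := by simp only [hΦ]; gcongr
      _ ≤ _ := lintegral_mono_set hsub
  calc _ ≤ ∫⁻ k in {k : ℝ | R ≤ |k|}, ∫⁻ h in Ioc 0 h0, ENNReal.ofReal (Φ k h) :=
        setLIntegral_mono' (measurableSet_le measurable_const measurable_norm) hpt
    _ ≤ ∫⁻ k, ∫⁻ h in Ioc 0 h0, ENNReal.ofReal (Φ k h) := setLIntegral_le_lintegral _ _
    _ = ∫⁻ h in Ioc 0 h0, ∫⁻ k, ENNReal.ofReal (Φ k h) :=
        lintegral_lintegral_swap hΦm.ennreal_ofReal.aemeasurable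
    _ ≤ ∫⁻ h in Ioc 0 h0, ENNReal.ofReal (160 * π * M * (√h)⁻¹) := by
        refine setLIntegral_mono' measurableSet_Ioc fun h hh => ?_
        have hp : 0 < h := hh.1
        have hs : 0 < √h := Real.sqrt_pos.2 hp
        calc _ = ENNReal.ofReal (40 * (h * √h)⁻¹) * ∫⁻ k : ℝ, ENNReal.ofReal (|k| * (‖ex (-(1 / 2 * k ^ 2 * h)) - 1‖ ^ 2 * ‖G k‖ ^ 2)) := by
              rw [← lintegral_const_mul' _ _ ENNReal.ofReal_ne_top]
              congr 1; ext k
              rw [← ENNReal.ofReal_mul (by positivity)]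
          _ ≤ ENNReal.ofReal (40 * (h * √h)⁻¹) * ENNReal.ofReal (4 * π * M * h) := by
              gcongr; exact hfix h ⟨hp, hh.2.trans hh01⟩
          _ = _ := by
              rw [← ENNReal.ofReal_mul (by positivity)]; congr 1; field_simp; ring
    _ = ENNReal.ofReal (160 * π * M * (2 * √h0)) := by
        rw [← ofReal_integral_eq_lintegral_ofReal]
        · rw [integral_const_mul, ← intervalIntegral.integral_of_le hh0p.le, isqrt_int le_rfl hh0p.le]; simp
        · exact ((intervalIntegrable_iff_integrableOn_Ioc_of_le hh0p.le).1 (isqrt_ii le_rfl hh0p.le)).const_mul _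
        · exact Filter.Eventually.of_forall fun h => by positivity
    _ ≤ _ := by
        refine ENNReal.ofReal_le_ofReal ?_
        have : √h0 ≤ 2 / R := by
          rw [Real.sqrt_le_left (by positivity), hh0, div_pow]; gcongr; norm_num
        calc 160 * π * M * (2 * √h0) ≤ 160 * π * M * (2 * (2 / R)) := by gcongr
          _ = _ := by ring

/-- weighted L2 membership -/
def HW (a : ℝ → ℂ) : Prop :=
  AEStronglyMeasurable a (volume : Measure ℝ) ∧ Integrable (fun k : ℝ => (1 + k ^ 2) * ‖a k‖ ^ 2)

/-- weighted square norm -/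
def nw (a : ℝ → ℂ) : ℝ := ∫ k : ℝ, (1 + k ^ 2) * ‖a k‖ ^ 2

lemma nw_nonneg (a : ℝ → ℂ) : 0 ≤ nw a := integral_nonneg fun k => by positivity

lemma HW_l1_aux {a : ℝ → ℂ} (ha : HW a) {m : ℝ} (hm : 0 < m) (h : nw a ≤ m ^ 2) :
    Integrable a ∧ ∫ k, ‖a k‖ ≤ 3 * m := by
  have hb : Integrable (fun k : ℝ => 1 / 2 * (m⁻¹ * ((1 + k ^ 2) * ‖a k‖ ^ 2) + m * (1 + k ^ 2)⁻¹)) :=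
    ((ha.2.const_mul _).add (integrable_inv_one_add_sq.const_mul _)).const_mul _
  have hle : ∀ k : ℝ, ‖a k‖ ≤ 1 / 2 * (m⁻¹ * ((1 + k ^ 2) * ‖a k‖ ^ 2) + m * (1 + k ^ 2)⁻¹) := by
    intro k
    have hk : 0 < 1 + k ^ 2 := by positivity
    have : 1 / 2 * (m⁻¹ * ((1 + k ^ 2) * ‖a k‖ ^ 2) + m * (1 + k ^ 2)⁻¹) - ‖a k‖
       = 1 / 2 * (m⁻¹ * (1 + k ^ 2)⁻¹) * ((1 + k ^ 2) * ‖a k‖ - m) ^ 2 := by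
      field_simp; ring
    have h2 : 0 ≤ 1 / 2 * (m⁻¹ * (1 + k ^ 2)⁻¹) * ((1 + k ^ 2) * ‖a k‖ - m) ^ 2 := by positivity
    linarith
  have hi : Integrable a := hb.mono' ha.1 (Filter.Eventually.of_forall hle)
  refine ⟨hi, (integral_mono hi.norm hb hle).trans ?_⟩
  rw [integral_const_mul, integral_add (ha.2.const_mul _) (integrable_inv_one_add_sq.const_mul _),
    integral_const_mul, integral_const_mul, integral_univ_inv_one_add_sq]
  change 1 / 2 * (m⁻¹ * nw a + m * π) ≤ 3 * m
  have : m⁻¹ * nw a ≤ m := by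
    rw [inv_mul_le_iff₀ hm]; nlinarith
  nlinarith [pi_lt_four]

lemma HW_int {a : ℝ → ℂ} (ha : HW a) : Integrable a :=
  (HW_l1_aux ha (m := nw a + 1) (by linarith [nw_nonneg a]) (by nlinarith [nw_nonneg a])).1

lemma ex_upper (θ : ℝ) : ‖ex θ - 1‖ ^ 2 ≤ 2 * |θ| := by
  rw [norm_ex_sub_one_sq]
  rcases le_total |θ| 2 with h | h
  · have := Real.one_sub_sq_div_two_le_cos (x := θ)
    nlinarith [abs_nonneg θ, sq_abs θ]
  · linarith [Real.neg_one_le_cos θ]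

lemma cs_int {f : ℝ → ℝ} (hf : Continuous f) {T : ℝ} (hT : 0 ≤ T) :
    (∫ t in (0:ℝ)..T, f t) ^ 2 ≤ T * ∫ t in (0:ℝ)..T, f t ^ 2 := by
  rcases hT.eq_or_lt with rfl | hT
  · simp
  set S := ∫ t in (0:ℝ)..T, f t
  have h : 0 ≤ ∫ t in (0:ℝ)..T, (T * f t - S) ^ 2 :=
    intervalIntegral.integral_nonneg hT.le fun t _ => sq_nonneg _
  have : ∫ t in (0:ℝ)..T, (T * f t - S) ^ 2 = T * (T * (∫ t in (0:ℝ)..T, f t ^ 2) - S ^ 2) := by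
    have e : ∀ t, (T * f t - S) ^ 2 = T ^ 2 * f t ^ 2 - 2 * T * S * f t + S ^ 2 := fun t => by ring
    simp_rw [e]
    rw [intervalIntegral.integral_add, intervalIntegral.integral_sub, intervalIntegral.integral_const_mul,
      intervalIntegral.integral_const_mul, intervalIntegral.integral_const]
    · simp only [smul_eq_mul]; ring
    all_goals exact Continuous.intervalIntegrable (by fun_prop) _ _
  rw [this] at h
  nlinarith [nonneg_of_mul_nonneg_right h hT]

lemma ztime_cont {b : ℝ → ℂ} (hb : Integrable b) :
    Continuous (fun t : ℝ => ∫ k : ℝ, ex (k ^ 2 * t) * b k) := by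
  refine continuous_of_dominated (bound := fun τ => ‖b τ‖) ?_ ?_ hb.norm ?_
  · intro l; exact (integrable_ex_mul hb (by fun_prop)).aestronglyMeasurable
  · intro l; refine Filter.Eventually.of_forall fun τ => ?_
    rw [norm_mul, norm_ex, one_mul]
  · refine Filter.Eventually.of_forall fun τ => ?_
    exact (continuous_ex.comp (by fun_prop)).mul continuous_const

lemma zdual {b : ℝ → ℂ} (hb : Integrable b) (hb2 : Integrable (fun k => ‖b k‖ ^ 2)) {T : ℝ} (hT : 0 ≤ T) :
    ∫ t in (0:ℝ)..T, ‖∫ k : ℝ, ex (k ^ 2 * t) * b k‖ ^ 2 ≤ (2 * T + 2 * π) * ∫ k, ‖b k‖ ^ 2 := by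
  set Z : ℝ → ℂ := fun t => ∫ k : ℝ, ex (k ^ 2 * t) * b k with hZ
  have hZc : Continuous Z := ztime_cont hb
  set Zc : ℝ → ℂ := fun t => (starRingEnd ℂ) (Z t) with hZcdef
  have hZcc : Continuous Zc := Complex.continuous_conj.comp hZc
  set d := trunc T Zc with hd
  have hdi : Integrable d := trunc_int hZcc T
  set I := ∫ t in (0:ℝ)..T, ‖Z t‖ ^ 2 with hI
  have hnd : ∀ t, ‖d t‖ ^ 2 = (Ioc 0 T).indicator (fun t => ‖Z t‖ ^ 2) t := by
    intro t
    by_cases h : t ∈ Ioc 0 T <;> simp [hd, trunc, h, hZcdef]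
  have hZ2 : Continuous (fun t => ‖Z t‖ ^ 2) := by fun_prop
  have hd2 : Integrable (fun t => ‖d t‖ ^ 2) := by
    simp_rw [hnd]
    rw [integrable_indicator_iff measurableSet_Ioc]
    exact (hZ2.integrableOn_Icc (a := 0) (b := T)).mono_set Ioc_subset_Icc_self
  have hId : ∫ t, ‖d t‖ ^ 2 = I := by
    simp_rw [hnd]
    rw [integral_indicator measurableSet_Ioc, hI, intervalIntegral.integral_of_le hT]
  have hI0 : 0 ≤ I := by rw [← hId]; exact integral_nonneg fun _ => by positivity
  set q : ℝ → ℂ := fun k => ∫ t, ex (k ^ 2 * t) * d t with hq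
  have hqc : Continuous q := (continuous_ft hdi).comp (by fun_prop : Continuous fun k : ℝ => k ^ 2)
  have p1 : ∫⁻ k : ℝ, ENNReal.ofReal (|k| * ‖q k‖ ^ 2) ≤ ENNReal.ofReal (2 * π * I) := by
    have := planch2 hdi hd2 one_pos
    simpa [hId, one_mul] using this
  have p2 : ∀ k, ‖q k‖ ^ 2 ≤ T * I := by
    intro k
    have h1 : ‖q k‖ ≤ ∫ t in (0:ℝ)..T, ‖Z t‖ := by
      simp only [hq]
      rw [← trunc_ft hT]
      refine (intervalIntegral.norm_integral_le_integral_norm hT).trans (le_of_eq ?_)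
      simp [norm_ex, hZcdef]
    exact (pow_le_pow_left₀ (norm_nonneg _) h1 2).trans (cs_int (by fun_prop) hT)
  have p3 : ∫⁻ k : ℝ, ENNReal.ofReal (‖q k‖ ^ 2) ≤ ENNReal.ofReal ((2 * T + 2 * π) * I) := by
    rw [← lintegral_add_compl _ (measurableSet_Icc (a := (-1:ℝ)) (b := 1))]
    have e1 : ∫⁻ k in Icc (-1:ℝ) 1, ENNReal.ofReal (‖q k‖ ^ 2) ≤ ENNReal.ofReal (2 * T * I) := by
      calc _ ≤ ∫⁻ k in Icc (-1:ℝ) 1, ENNReal.ofReal (T * I) :=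
            lintegral_mono fun k => ENNReal.ofReal_le_ofReal (p2 k)
        _ = _ := by
            rw [setLIntegral_const, Real.volume_Icc, ← ENNReal.ofReal_mul (by positivity)]; congr 1; ring
    have e2 : ∫⁻ k in (Icc (-1:ℝ) 1)ᶜ, ENNReal.ofReal (‖q k‖ ^ 2) ≤ ENNReal.ofReal (2 * π * I) := by
      calc _ ≤ ∫⁻ k in (Icc (-1:ℝ) 1)ᶜ, ENNReal.ofReal (|k| * ‖q k‖ ^ 2) := by
            refine setLIntegral_mono' measurableSet_Icc.compl fun k hk => ENNReal.ofReal_le_ofReal ?_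
            have : 1 ≤ |k| := by
              by_contra hc; push Not at hc
              exact hk ⟨(abs_lt.1 hc).1.le, (abs_lt.1 hc).2.le⟩
            nlinarith [sq_nonneg ‖q k‖]
        _ ≤ _ := (setLIntegral_le_lintegral _ _).trans p1
    refine (add_le_add e1 e2).trans (le_of_eq ?_)
    rw [← ENNReal.ofReal_add (by positivity) (by positivity)]; congr 1; ring
  have hqi : Integrable (fun k => ‖q k‖ ^ 2) := by
    refine ⟨(by fun_prop : Continuous fun k => ‖q k‖ ^ 2).aestronglyMeasurable, ?_⟩
    rw [hasFiniteIntegral_iff_ofReal (Filter.Eventually.of_forall fun k => by positivity)]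
    exact lt_of_le_of_lt p3 ENNReal.ofReal_lt_top
  have hq2 : ∫ k, ‖q k‖ ^ 2 ≤ (2 * T + 2 * π) * I := by
    rw [integral_eq_lintegral_of_nonneg_ae (Filter.Eventually.of_forall fun k => by positivity) hqi.aestronglyMeasurable]
    exact ENNReal.toReal_le_of_le_ofReal (by positivity) p3
  have hdual : (I : ℂ) = ∫ k, b k * q k := by
    have h1 : (I : ℂ) = ∫ t, ∫ k, ex (k ^ 2 * t) * (d t * b k) := by
      rw [← hId, ← integral_complex_ofReal]
      congr 1; ext t
      have : ∀ k, ex (k ^ 2 * t) * (d t * b k) = d t * (ex (k ^ 2 * t) * b k) := fun k => by ring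
      simp_rw [this]
      rw [integral_const_mul]
      change _ = d t * Z t
      rw [hnd]
      by_cases h : t ∈ Ioc 0 T
      · simp only [hd, trunc, indicator_of_mem h, hZcdef]
        rw [mul_comm, Complex.mul_conj, Complex.normSq_eq_norm_sq]
      · simp [hd, trunc, h]
    rw [h1, integral_integral_swap]
    · congr 1; ext k
      simp only [hq]
      rw [← integral_const_mul]
      congr 1; ext t; ring
    · have h0 := hdi.mul_prod hb
      have hc : Continuous (fun q : ℝ × ℝ => ex (q.2 ^ 2 * q.1)) := continuous_ex.comp (by fun_prop)
      exact h0.bdd_mul (c := 1) hc.aestronglyMeasurable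
        (Filter.Eventually.of_forall (fun x => (norm_ex _).le))
  set K := 2 * T + 2 * π with hK
  have hKp : 0 < K := by positivity
  have hfin : I ≤ ∫ k, (K / 2 * ‖b k‖ ^ 2 + (2 * K)⁻¹ * ‖q k‖ ^ 2) := by
    calc I ≤ ‖(I : ℂ)‖ := by rw [Complex.norm_real]; exact le_abs_self _
      _ ≤ _ := by
        rw [hdual]
        refine norm_integral_le_of_norm_le ((hb2.const_mul _).add (hqi.const_mul _)) (Filter.Eventually.of_forall fun k => ?_)
        rw [norm_mul]
        have : K / 2 * ‖b k‖ ^ 2 + (2 * K)⁻¹ * ‖q k‖ ^ 2 - ‖b k‖ * ‖q k‖ = (2 * K)⁻¹ * (K * ‖b k‖ - ‖q k‖) ^ 2 := by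
          field_simp; ring
        have h2 : 0 ≤ (2 * K)⁻¹ * (K * ‖b k‖ - ‖q k‖) ^ 2 := by positivity
        linarith
  rw [integral_add (hb2.const_mul _) (hqi.const_mul _), integral_const_mul, integral_const_mul] at hfin
  have : (2 * K)⁻¹ * ∫ k, ‖q k‖ ^ 2 ≤ I / 2 := by
    calc _ ≤ (2 * K)⁻¹ * (K * I) := by gcongr
      _ = _ := by field_simp
  linarith

lemma zmod {a : ℝ → ℂ} (ha : HW a) {T h : ℝ} (hT : 0 ≤ T) (hh : 0 < h) :
    ∫ t in (0:ℝ)..T, ‖(∫ k : ℝ, ex (k ^ 2 * (t + h)) * a k) - ∫ k : ℝ, ex (k ^ 2 * t) * a k‖ ^ 2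
      ≤ (2 * T + 2 * π) * (2 * nw a) * h := by
  have hai := HW_int ha
  set b : ℝ → ℂ := fun k => (ex (k ^ 2 * h) - 1) * a k with hb
  have hbi : Integrable b := by
    have := (integrable_ex_mul hai (p := fun k => k ^ 2 * h) (by fun_prop)).sub hai
    refine this.congr (Filter.Eventually.of_forall fun k => ?_)
    simp [hb, sub_mul]
  have hble : ∀ k, ‖b k‖ ^ 2 ≤ 2 * h * ((1 + k ^ 2) * ‖a k‖ ^ 2) := by
    intro k
    simp only [hb]
    rw [norm_mul, mul_pow]
    have := ex_upper (k ^ 2 * h)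
    rw [abs_of_nonneg (by positivity)] at this
    calc _ ≤ 2 * (k ^ 2 * h) * ‖a k‖ ^ 2 := by gcongr
      _ ≤ _ := by nlinarith [mul_nonneg hh.le (sq_nonneg ‖a k‖)]
  have hb2 : Integrable (fun k => ‖b k‖ ^ 2) := by
    refine (ha.2.const_mul (2 * h)).mono' (hbi.aestronglyMeasurable.norm.pow 2) (Filter.Eventually.of_forall fun k => ?_)
    rw [Real.norm_of_nonneg (by positivity)]; exact hble k
  have hbn : ∫ k, ‖b k‖ ^ 2 ≤ 2 * h * nw a := by
    unfold nw; rw [← integral_const_mul]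
    exact integral_mono hb2 (ha.2.const_mul _) hble
  have e : ∀ t, (∫ k : ℝ, ex (k ^ 2 * (t + h)) * a k) - ∫ k : ℝ, ex (k ^ 2 * t) * a k = ∫ k : ℝ, ex (k ^ 2 * t) * b k := by
    intro t
    rw [← integral_sub (integrable_ex_mul hai (by fun_prop)) (integrable_ex_mul hai (by fun_prop))]
    congr 1; ext k
    simp only [hb]
    rw [mul_add, ex_add]; ring
  simp_rw [e]
  refine (zdual hbi hb2 hT).trans ?_
  calc _ ≤ (2 * T + 2 * π) * (2 * h * nw a) := by gcongr
    _ = _ := by ring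

lemma fk_eq {s : ℝ} (hs : 0 < s) (x : ℝ) :
    freeKernel s x = (((√(2 * π))⁻¹ * (√s)⁻¹ : ℝ) : ℂ) * ex (x ^ 2 / (2 * s)) := by
  unfold freeKernel ex
  congr 1
  · rw [show (-(1 / 2 : ℂ)) = ((-(1 / 2) : ℝ) : ℂ) by push_cast; rfl,
      ← Complex.ofReal_cpow (by positivity), Real.mul_rpow (by positivity) hs.le,
      ← isqrt_eq (by positivity), ← isqrt_eq hs.le]
  · congr 1; push_cast; ring

lemma kap_le : (√(2 * π))⁻¹ ≤ 1 := by
  apply inv_le_one_of_one_le₀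
  rw [Real.one_le_sqrt]; linarith [pi_gt_three]

lemma norm_fk {s : ℝ} (hs : 0 < s) (x : ℝ) : ‖freeKernel s x‖ ≤ (√s)⁻¹ := by
  rw [fk_eq hs, norm_mul, norm_ex, mul_one, Complex.norm_real, Real.norm_of_nonneg (by positivity)]
  have := kap_le
  have h2 : 0 ≤ (√s)⁻¹ := by positivity
  nlinarith

/-- half integral -/
def half (f : ℝ → ℂ) (t : ℝ) : ℂ := ∫ s in (0:ℝ)..t, (((√s)⁻¹ : ℝ) : ℂ) * f (t - s)

lemma half_eq (f : ℝ → ℂ) {t : ℝ} (ht : 0 ≤ t) :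
    ∫ s in (0:ℝ)..t, freeKernel s 0 * f (t - s) = (((√(2 * π))⁻¹ : ℝ) : ℂ) * half f t := by
  unfold half
  rw [← intervalIntegral.integral_const_mul]
  refine intervalIntegral.integral_congr_ae (Filter.Eventually.of_forall fun s hs => ?_)
  rw [uIoc_of_le ht] at hs
  rw [fk_eq hs.1]; simp [ex_zero]; ring

lemma isqrtc_ii {a b : ℝ} (ha : 0 ≤ a) (hb : 0 ≤ b) :
    IntervalIntegrable (fun s : ℝ => (((√s)⁻¹ : ℝ) : ℂ)) volume a b := by
  have := isqrt_ii ha hb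
  rw [intervalIntegrable_iff] at this ⊢
  exact this.ofReal

lemma half_mod {f : ℝ → ℂ} (hf : Continuous f) {t h N : ℝ} (ht : 0 ≤ t) (hh : 0 < h)
    (hN : ∀ τ ∈ Icc 0 (t + h), ‖f τ‖ ≤ N) : ‖half f (t + h) - half f t‖ ≤ 4 * N * √h := by
  have hN0 : 0 ≤ N := (norm_nonneg _).trans (hN 0 ⟨le_rfl, by linarith⟩)
  have hth : 0 ≤ t + h := by linarith
  have i1 : ∀ {a b : ℝ}, 0 ≤ a → 0 ≤ b → ∀ r : ℝ, IntervalIntegrable (fun s : ℝ => (((√s)⁻¹ : ℝ) : ℂ) * f (r - s)) volume a b :=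
    fun ha hb r => (isqrtc_ii ha hb).mul_continuousOn (by fun_prop)
  have e1 : half f (t + h) = (∫ s in (0:ℝ)..h, (((√s)⁻¹ : ℝ) : ℂ) * f (t + h - s)) +
      ∫ s in (0:ℝ)..t, (((√(s + h))⁻¹ : ℝ) : ℂ) * f (t - s) := by
    unfold half
    rw [← intervalIntegral.integral_add_adjacent_intervals (i1 le_rfl hh.le (t + h)) (i1 hh.le hth (t + h))]
    congr 1
    have := intervalIntegral.integral_comp_add_right (a := 0) (b := t) (fun s : ℝ => (((√s)⁻¹ : ℝ) : ℂ) * f (t + h - s)) h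
    rw [zero_add] at this
    rw [← this]
    congr 1; ext s; congr 2; ring
  have hsh : IntervalIntegrable (fun s : ℝ => (√(s + h))⁻¹) volume 0 t := by
    have := (isqrt_ii hh.le hth).comp_add_right h
    simpa using this
  have hshi : ∫ s in (0:ℝ)..t, (√(s + h))⁻¹ = 2 * (√(t + h) - √h) := by
    have := intervalIntegral.integral_comp_add_right (a := 0) (b := t) (fun s : ℝ => (√s)⁻¹) h
    rw [this, zero_add, isqrt_int hh.le hth]
  have hshc : IntervalIntegrable (fun s : ℝ => (((√(s + h))⁻¹ : ℝ) : ℂ) * f (t - s)) volume 0 t := by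
    refine IntervalIntegrable.mul_continuousOn ?_ (by fun_prop)
    rw [intervalIntegrable_iff] at hsh ⊢
    exact hsh.ofReal
  rw [e1]
  unfold half
  rw [add_sub_assoc, ← intervalIntegral.integral_sub hshc (i1 le_rfl ht t)]
  refine (norm_add_le _ _).trans ?_
  have b1 : ‖∫ s in (0:ℝ)..h, (((√s)⁻¹ : ℝ) : ℂ) * f (t + h - s)‖ ≤ 2 * N * √h := by
    calc _ ≤ ∫ s in (0:ℝ)..h, N * (√s)⁻¹ := by
          refine intervalIntegral.norm_integral_le_of_norm_le hh.le ?_ ((isqrt_ii le_rfl hh.le).const_mul _)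
          refine Filter.Eventually.of_forall fun s hs => ?_
          rw [norm_mul, Complex.norm_real, Real.norm_of_nonneg (by positivity), mul_comm]
          gcongr; exact hN _ ⟨by linarith [hs.2], by linarith [hs.1]⟩
      _ = _ := by rw [intervalIntegral.integral_const_mul, isqrt_int le_rfl hh.le]; simp; ring
  have b2 : ‖∫ s in (0:ℝ)..t, ((((√(s + h))⁻¹ : ℝ) : ℂ) * f (t - s) - (((√s)⁻¹ : ℝ) : ℂ) * f (t - s))‖ ≤ 2 * N * √h := by
    calc _ ≤ ∫ s in (0:ℝ)..t, N * ((√s)⁻¹ - (√(s + h))⁻¹) := by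
          refine intervalIntegral.norm_integral_le_of_norm_le ht ?_ (((isqrt_ii le_rfl ht).sub hsh).const_mul _)
          refine Filter.Eventually.of_forall fun s hs => ?_
          rw [← sub_mul, norm_mul, ← Complex.ofReal_sub, Complex.norm_real, Real.norm_eq_abs, abs_sub_comm, mul_comm]
          have hs1 : 0 < s := hs.1
          have : (√(s + h))⁻¹ ≤ (√s)⁻¹ := by
            apply inv_anti₀ (Real.sqrt_pos.2 hs1); exact Real.sqrt_le_sqrt (by linarith)
          rw [abs_of_nonneg (by linarith)]
          have : 0 ≤ (√s)⁻¹ - (√(s + h))⁻¹ := by linarith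
          gcongr; exact hN _ ⟨by linarith [hs.2], by linarith [hs.1]⟩
      _ = N * (2 * √t - 2 * (√(t + h) - √h)) := by
          rw [intervalIntegral.integral_const_mul, intervalIntegral.integral_sub (isqrt_ii le_rfl ht) hsh, isqrt_int le_rfl ht, hshi]; simp
      _ ≤ N * (2 * √h) := by
          have : √t ≤ √(t + h) := Real.sqrt_le_sqrt (by linarith)
          gcongr; linarith
      _ = _ := by ring
  linarith

lemma laplace_bound {t γ : ℝ} (ht : 0 ≤ t) (hγ : 0 < γ) :
    IntervalIntegrable (fun s => (√s)⁻¹ * rexp (-(γ * s))) volume 0 t ∧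
    ∫ s in (0:ℝ)..t, (√s)⁻¹ * rexp (-(γ * s)) ≤ √(π / γ) := by
  have h := Real.integral_rpow_mul_exp_neg_mul_Ioi (a := 1 / 2) (r := γ) (by norm_num) hγ
  have e : ∀ s ∈ Ioi (0:ℝ), s ^ ((1:ℝ) / 2 - 1) * rexp (-(γ * s)) = (√s)⁻¹ * rexp (-(γ * s)) := by
    intro s hs
    rw [isqrt_eq (le_of_lt hs)]; norm_num
  rw [setIntegral_congr_fun measurableSet_Ioi e] at h
  have hv : (1 / γ) ^ ((1:ℝ) / 2) * Gamma (1 / 2) = √(π / γ) := by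
    rw [Real.Gamma_one_half_eq, ← Real.sqrt_eq_rpow, ← Real.sqrt_mul (by positivity)]; congr 1; field_simp
  rw [hv] at h
  have hi : IntegrableOn (fun s => (√s)⁻¹ * rexp (-(γ * s))) (Ioi 0) := by
    by_contra hc
    rw [integral_undef hc] at h
    have : 0 < √(π / γ) := Real.sqrt_pos.2 (by positivity)
    linarith
  refine ⟨(intervalIntegrable_iff_integrableOn_Ioc_of_le ht).2 (hi.mono_set Ioc_subset_Ioi_self), ?_⟩
  rw [intervalIntegral.integral_of_le ht, ← h]
  refine setIntegral_mono_set hi (Filter.Eventually.of_forall fun s => by positivity)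
    (Filter.Eventually.of_forall Ioc_subset_Ioi_self)

lemma gron {w p : ℝ → ℂ} (hw : Continuous w) (hp : Continuous p) {L T ε : ℝ} (hL : 0 < L) (hε : 0 < ε)
    (h1 : ∀ t ∈ Icc 0 T, ‖w t‖ ≤ ε + ∫ s in (0:ℝ)..t, (√s)⁻¹ * ‖p (t - s)‖)
    (h2 : ∀ t ∈ Icc 0 T, ‖w t‖ ≤ 1 → ‖p t‖ ≤ L * ‖w t‖)
    (h3 : 3 * ε * rexp (4 * π * L ^ 2 * T) ≤ 1) :
    ∀ t ∈ Icc 0 T, ‖w t‖ ≤ 3 * ε * rexp (4 * π * L ^ 2 * T) := by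
  set γ := 4 * π * L ^ 2 with hγ
  have hγ0 : 0 < γ := by positivity
  have hmain : ∀ t ∈ Icc 0 T, rexp (-(γ * t)) * ‖w t‖ < 3 * ε := by
    by_contra hc
    push Not at hc
    obtain ⟨t1, ht1, hv1⟩ := hc
    have hcl : IsCompact (Icc 0 T ∩ {t | 3 * ε ≤ rexp (-(γ * t)) * ‖w t‖}) :=
      isCompact_Icc.inter_right (isClosed_le continuous_const (by fun_prop))
    obtain ⟨t0, ⟨ht0, hv0⟩, hmin⟩ := hcl.exists_isLeast ⟨t1, ht1, hv1⟩
    have hv0 : 3 * ε ≤ rexp (-(γ * t0)) * ‖w t0‖ := hv0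
    have hbelow : ∀ τ, 0 ≤ τ → τ < t0 → ‖w τ‖ ≤ 3 * ε * rexp (γ * τ) := by
      intro τ h0 hlt
      by_contra hc
      push Not at hc
      have : τ ∈ Icc 0 T ∩ {t | 3 * ε ≤ rexp (-(γ * t)) * ‖w t‖} := by
        refine ⟨⟨h0, hlt.le.trans ht0.2⟩, ?_⟩
        change 3 * ε ≤ rexp (-(γ * τ)) * ‖w τ‖
        calc 3 * ε = rexp (-(γ * τ)) * (3 * ε * rexp (γ * τ)) := by
              have : rexp (-(γ * τ)) * rexp (γ * τ) = 1 := by rw [← Real.exp_add]; simp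
              linear_combination (-3 * ε) * this
          _ ≤ _ := by gcongr
      exact absurd (hmin this) (not_le.2 hlt)
    have hpb : ∀ τ, 0 ≤ τ → τ < t0 → ‖p τ‖ ≤ L * (3 * ε * rexp (γ * τ)) := by
      intro τ h0 hlt
      have hwb := hbelow τ h0 hlt
      have h1' : ‖w τ‖ ≤ 1 := hwb.trans ((by gcongr; exact hlt.le.trans ht0.2 : 3 * ε * rexp (γ * τ) ≤ 3 * ε * rexp (γ * T)).trans h3)
      exact (h2 τ ⟨h0, hlt.le.trans ht0.2⟩ h1').trans (by gcongr)
    obtain ⟨li, lb⟩ := laplace_bound ht0.1 hγ0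
    have hsq : √(π / γ) = 1 / (2 * L) := by
      rw [hγ, show π / (4 * π * L ^ 2) = (1 / (2 * L)) ^ 2 by field_simp; norm_num]
      exact Real.sqrt_sq (by positivity)
    have hint : ∫ s in (0:ℝ)..t0, (√s)⁻¹ * ‖p (t0 - s)‖ ≤ 3 / 2 * ε * rexp (γ * t0) := by
      calc _ ≤ ∫ s in (0:ℝ)..t0, (L * (3 * ε) * rexp (γ * t0)) * ((√s)⁻¹ * rexp (-(γ * s))) := by
            refine intervalIntegral.integral_mono_on_of_le_Ioo ht0.1 ((isqrt_ii le_rfl ht0.1).mul_continuousOn (by fun_prop)) (li.const_mul _) ?_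
            intro s hs
            have := hpb (t0 - s) (by linarith [hs.2]) (by linarith [hs.1])
            calc _ ≤ (√s)⁻¹ * (L * (3 * ε * rexp (γ * (t0 - s)))) := by gcongr
              _ = _ := by rw [mul_sub, sub_eq_add_neg, Real.exp_add]; ring
        _ ≤ (L * (3 * ε) * rexp (γ * t0)) * (1 / (2 * L)) := by
            rw [intervalIntegral.integral_const_mul, ← hsq]; gcongr
        _ = _ := by field_simp
    have hw0 := h1 t0 ht0
    have he : 1 ≤ rexp (γ * t0) := Real.one_le_exp (by have := ht0.1; positivity)
    have hv2 : 3 * ε * rexp (γ * t0) ≤ ‖w t0‖ := by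
      calc _ ≤ (rexp (-(γ * t0)) * ‖w t0‖) * rexp (γ * t0) := by gcongr
        _ = ‖w t0‖ := by rw [mul_comm, ← mul_assoc, ← Real.exp_add]; simp
    nlinarith
  intro t ht
  calc ‖w t‖ = (rexp (-(γ * t)) * ‖w t‖) * rexp (γ * t) := by
        rw [mul_comm, ← mul_assoc, ← Real.exp_add]; simp
    _ ≤ 3 * ε * rexp (γ * t) := mul_le_mul_of_nonneg_right (hmain t ht).le (Real.exp_pos _).le
    _ ≤ _ := by gcongr; exact ht.2

lemma exists_test {g : ℝ → ℝ} (hg : ContDiff ℝ (↑(⊤ : ℕ∞)) g) (hc : HasCompactSupport g) :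
    ∃ q : ℝ → ℂ, Integrable q ∧ ∀ k : ℝ, ((g k : ℝ) : ℂ) = ∫ x, ex (k * x) * q x := by
  set G : ℝ → ℂ := fun x => ((g (2 * π * x) : ℝ) : ℂ) with hG
  have hGs : ContDiff ℝ (↑(⊤ : ℕ∞)) G := Complex.ofRealCLM.contDiff (n := (⊤ : ℕ∞)) |>.comp
    (hg.comp (contDiff_const.mul contDiff_id : ContDiff ℝ (⊤ : ℕ∞) (fun x : ℝ => 2 * π * x)))
  have hGc : HasCompactSupport G := by
    have h1 := hc.comp_homeomorph (Homeomorph.mulLeft₀ (2 * π) (by positivity : (2 * π) ≠ 0))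
    exact h1.comp_left (g := fun x : ℝ => (x : ℂ)) (by simp)
  set S : SchwartzMap ℝ ℂ := hGc.toSchwartzMap hGs with hS
  refine ⟨⇑(FourierTransform.fourier S : SchwartzMap ℝ ℂ), SchwartzMap.integrable _, fun k => ?_⟩
  have h1 : FourierTransformInv.fourierInv (FourierTransform.fourier S : SchwartzMap ℝ ℂ) = S := FourierTransform.fourierInv_fourier_eq S
  have h2 : (FourierTransformInv.fourierInv (FourierTransform.fourier S : SchwartzMap ℝ ℂ) : SchwartzMap ℝ ℂ) (k / (2 * π)) = G (k / (2 * π)) := by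
    rw [h1]; rfl
  rw [SchwartzMap.fourierInv_coe, Real.fourierInv_eq'] at h2
  have h3 : G (k / (2 * π)) = ((g k : ℝ) : ℂ) := by
    simp only [hG]; congr 2; field_simp
  rw [← h3, ← h2]
  congr 1; ext x
  rw [smul_eq_mul]; congr 1
  unfold ex
  rw [mul_comm]; congr 3
  simp; field_simp

/-- unimodular constant -/
def om : ℂ := (-Complex.I) ^ (1 / 2 : ℂ)

lemma om_sq : om ^ 2 = -Complex.I := by
  unfold om
  rw [← Complex.cpow_nat_mul]; norm_num

lemma norm_om : ‖om‖ = 1 := by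
  have h : ‖om‖ ^ 2 = 1 := by rw [← norm_pow, om_sq]; simp
  have := norm_nonneg om
  nlinarith

lemma om_ne : om ≠ 0 := by
  intro h; have := norm_om; rw [h] at this; simp at this

lemma gauss_pair {q g : ℝ → ℂ} (hq : Integrable q) (hgq : ∀ k : ℝ, g k = ∫ x, ex (k * x) * q x)
    {b : ℂ} (hb : 0 < b.re) :
    ∫ k : ℝ, Complex.exp (-b * k ^ 2) * g k = (π / b) ^ (1 / 2 : ℂ) * ∫ x : ℝ, Complex.exp (-(x : ℂ) ^ 2 / (4 * b)) * q x := by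
  have h1 : ∀ k : ℝ, Complex.exp (-b * k ^ 2) * g k = ∫ x, ex (k * x) * (Complex.exp (-b * k ^ 2) * q x) := by
    intro k
    rw [hgq, ← integral_const_mul]; congr 1; ext x; ring
  simp_rw [h1]
  rw [integral_integral_swap, ← integral_const_mul]
  · congr 1; ext x
    have h2 := fourierIntegral_gaussian hb (x : ℂ)
    rw [← mul_assoc, ← h2, ← integral_mul_const]
    congr 1; ext k
    unfold ex; rw [← mul_assoc]; congr 3; push_cast; ring
  · have h0 := (integrable_cexp_neg_mul_sq hb).mul_prod hq
    have hc : Continuous (fun p : ℝ × ℝ => ex (p.1 * p.2)) := continuous_ex.comp (by fun_prop)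
    exact h0.bdd_mul (c := 1) hc.aestronglyMeasurable
      (Filter.Eventually.of_forall (fun x => (norm_ex _).le))

lemma fresnel {q g : ℝ → ℂ} (hq : Integrable q) (hg : Integrable g) (hgq : ∀ k : ℝ, g k = ∫ x, ex (k * x) * q x)
    {s : ℝ} (hs : 0 < s) :
    ∫ k : ℝ, ex (-(1 / 2) * k ^ 2 * s) * g k = 2 * π * om * ∫ x : ℝ, freeKernel s x * q x := by
  set b : ℝ → ℂ := fun ε => (ε : ℂ) + Complex.I * (s / 2) with hb
  have hbre : ∀ ε, (b ε).re = ε := fun ε => by simp [hb]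
  have hbc : Continuous b := by fun_prop
  have hb0 : b 0 = Complex.I * (s / 2) := by simp [hb]
  have hbne : b 0 ≠ 0 := by rw [hb0]; simp [hs.ne']
  have L1 : Filter.Tendsto (fun ε => ∫ k : ℝ, Complex.exp (-b ε * k ^ 2) * g k) (nhdsWithin 0 (Ioi 0))
      (nhds (∫ k : ℝ, Complex.exp (-b 0 * k ^ 2) * g k)) := by
    refine tendsto_integral_filter_of_dominated_convergence (fun k => ‖g k‖) ?_ ?_ hg.norm ?_
    · exact Filter.Eventually.of_forall fun ε => (by fun_prop : Continuous fun k : ℝ => Complex.exp (-b ε * k ^ 2)).aestronglyMeasurable.mul hg.aestronglyMeasurable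
    · filter_upwards [self_mem_nhdsWithin] with ε hε
      refine Filter.Eventually.of_forall fun k => ?_
      rw [norm_mul, Complex.norm_exp]
      have : (-b ε * (k : ℂ) ^ 2).re ≤ 0 := by
        rw [← Complex.ofReal_pow, Complex.re_mul_ofReal, Complex.neg_re, hbre]
        have : (0:ℝ) < ε := hε
        nlinarith [sq_nonneg k]
      have := Real.exp_le_one_iff.2 this
      nlinarith [norm_nonneg (g k)]
    · refine Filter.Eventually.of_forall fun k => ?_
      have : Continuous (fun ε => Complex.exp (-b ε * k ^ 2) * g k) := by fun_prop
      exact (this.tendsto 0).mono_left nhdsWithin_le_nhds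
  have L2 : Filter.Tendsto (fun ε => ∫ x : ℝ, Complex.exp (-(x : ℂ) ^ 2 / (4 * b ε)) * q x) (nhdsWithin 0 (Ioi 0))
      (nhds (∫ x : ℝ, Complex.exp (-(x : ℂ) ^ 2 / (4 * b 0)) * q x)) := by
    refine tendsto_integral_filter_of_dominated_convergence (fun k => ‖q k‖) ?_ ?_ hq.norm ?_
    · exact Filter.Eventually.of_forall fun ε => (by fun_prop : Continuous fun x : ℝ => Complex.exp (-(x : ℂ) ^ 2 / (4 * b ε))).aestronglyMeasurable.mul hq.aestronglyMeasurable
    · filter_upwards [self_mem_nhdsWithin] with ε hε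
      refine Filter.Eventually.of_forall fun x => ?_
      rw [norm_mul, Complex.norm_exp]
      have : (-(x : ℂ) ^ 2 / (4 * b ε)).re ≤ 0 := by
        have e : -(x : ℂ) ^ 2 / (4 * b ε) = ((-(x ^ 2) / 4 : ℝ) : ℂ) * (b ε)⁻¹ := by
          push_cast; rw [div_eq_mul_inv, mul_inv]; ring
        rw [e, Complex.re_ofReal_mul, Complex.inv_re, hbre]
        have h1 : (0:ℝ) < ε := hε
        have h2 : 0 ≤ ε / Complex.normSq (b ε) := div_nonneg h1.le (Complex.normSq_nonneg _)
        nlinarith [mul_nonneg (sq_nonneg x) h2]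
      have := Real.exp_le_one_iff.2 this
      nlinarith [norm_nonneg (q x)]
    · refine Filter.Eventually.of_forall fun x => ?_
      have : ContinuousAt (fun ε => Complex.exp (-(x : ℂ) ^ 2 / (4 * b ε)) * q x) 0 := by
        have : ContinuousAt (fun ε => -(x : ℂ) ^ 2 / (4 * b ε)) 0 :=
          continuousAt_const.div (continuousAt_const.mul hbc.continuousAt) (mul_ne_zero (by norm_num) hbne)
        exact (this.cexp).mul continuousAt_const
      exact this.tendsto.mono_left nhdsWithin_le_nhds
  have hpb : (π : ℂ) / b 0 = ((2 * π / s : ℝ) : ℂ) * (-Complex.I) := by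
    rw [hb0]; push_cast
    have : (s : ℂ) ≠ 0 := by exact_mod_cast hs.ne'
    field_simp; simp
  have L3 : Filter.Tendsto (fun ε => ((π : ℂ) / b ε) ^ (1 / 2 : ℂ)) (nhdsWithin 0 (Ioi 0))
      (nhds (((π : ℂ) / b 0) ^ (1 / 2 : ℂ))) := by
    have : ContinuousAt (fun ε => ((π : ℂ) / b ε) ^ (1 / 2 : ℂ)) 0 := by
      refine ContinuousAt.cpow (continuousAt_const.div hbc.continuousAt hbne) continuousAt_const ?_
      rw [hpb, Complex.mem_slitPlane_iff]; right
      rw [Complex.im_ofReal_mul]; simp [hs.ne', pi_ne_zero]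
    exact this.tendsto.mono_left nhdsWithin_le_nhds
  have L4 := L3.mul L2
  have hE : (fun ε => ((π : ℂ) / b ε) ^ (1 / 2 : ℂ) * ∫ x : ℝ, Complex.exp (-(x : ℂ) ^ 2 / (4 * b ε)) * q x)
      =ᶠ[nhdsWithin 0 (Ioi 0)] (fun ε => ∫ k : ℝ, Complex.exp (-b ε * k ^ 2) * g k) := by
    filter_upwards [self_mem_nhdsWithin] with ε hε
    exact (gauss_pair hq hgq (by rw [hbre]; exact hε)).symm
  have hfin := tendsto_nhds_unique (L4.congr' hE) L1
  have hl : ∫ k : ℝ, Complex.exp (-b 0 * k ^ 2) * g k = ∫ k : ℝ, ex (-(1 / 2) * k ^ 2 * s) * g k := by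
    congr 1; ext k; unfold ex; rw [hb0]; congr 2; push_cast; ring
  rw [← hl, ← hfin]
  have hr : ∀ x : ℝ, freeKernel s x * q x = (((√(2 * π))⁻¹ * (√s)⁻¹ : ℝ) : ℂ) * (Complex.exp (-(x : ℂ) ^ 2 / (4 * b 0)) * q x) := by
    intro x
    rw [fk_eq hs, mul_assoc]; congr 2
    unfold ex; rw [hb0]; congr 1
    have : (s : ℂ) ≠ 0 := by exact_mod_cast hs.ne'
    push_cast; field_simp;
    rw [Complex.I_sq]; ring
  simp_rw [hr]
  rw [integral_const_mul, ← mul_assoc]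
  congr 1
  have hpos : (0:ℝ) < 2 * π / s := by positivity
  have h1 : (((2 * π / s : ℝ) : ℂ) * (-Complex.I)) ^ (1 / 2 : ℂ) = ((2 * π / s : ℝ) : ℂ) ^ (1 / 2 : ℂ) * om := by
    have hI : (-Complex.I) ≠ 0 := by simp
    have hp : ((2 * π / s : ℝ) : ℂ) ≠ 0 := by exact_mod_cast hpos.ne'
    unfold om
    rw [Complex.cpow_def_of_ne_zero (mul_ne_zero hp hI), Complex.cpow_def_of_ne_zero hp,
      Complex.cpow_def_of_ne_zero hI, Complex.log_ofReal_mul hpos hI, add_mul, Complex.exp_add,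
      Complex.ofReal_log hpos.le]
  have h2 : ((2 * π / s : ℝ) : ℂ) ^ (1 / 2 : ℂ) = ((√(2 * π / s) : ℝ) : ℂ) := by
    rw [Real.sqrt_eq_rpow, Complex.ofReal_cpow hpos.le]; norm_num
  have h3 : √(2 * π / s) = 2 * π * ((√(2 * π))⁻¹ * (√s)⁻¹) := by
    rw [Real.sqrt_div (by positivity)]
    have h4 : √(2 * π) * √(2 * π) = 2 * π := Real.mul_self_sqrt (by positivity)
    have h5 : √(2 * π) ≠ 0 := by positivity
    have h6 : √s ≠ 0 := by positivity
    field_simp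
    nlinarith
  rw [hpb, h1, h2, h3]; push_cast; ring

lemma ident {H f : ℝ → ℂ} (hH : Integrable H) (hf : Continuous f) {t : ℝ} (ht : 0 ≤ t)
    (h : ∀ x : ℝ, (2 * π : ℂ)⁻¹ * ∫ k, ex (k * x) * H k = ∫ s in (0:ℝ)..t, freeKernel s x * f (t - s)) :
    ∀ᵐ k : ℝ, H k = om⁻¹ * ∫ s in (0:ℝ)..t, ex (-(1 / 2) * k ^ 2 * s) * f (t - s) := by
  set μ : Measure ℝ := volume.restrict (Ioc 0 t) with hμ
  set ft : ℝ → ℂ := fun s => f (t - s) with hft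
  have hfti : Integrable ft μ := by
    have : Continuous ft := by fun_prop
    exact (this.integrableOn_Icc (a := 0) (b := t)).mono_set Ioc_subset_Icc_self
  set G : ℝ → ℂ := fun k => om⁻¹ * ∫ s, ex (-(1 / 2) * k ^ 2 * s) * ft s ∂μ with hG
  have hGc : Continuous G := continuous_const.mul
    ((continuous_ft hfti).comp (by fun_prop : Continuous fun k : ℝ => -(1 / 2) * k ^ 2))
  suffices hz : ∀ᵐ k : ℝ, H k - G k = 0 by
    filter_upwards [hz] with k hk
    rw [intervalIntegral.integral_of_le ht]
    exact sub_eq_zero.1 hk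
  refine ae_eq_zero_of_integral_contDiff_smul_eq_zero (hH.locallyIntegrable.sub hGc.locallyIntegrable) ?_
  intro g hg hgc
  obtain ⟨q, hq, hgq⟩ := exists_test hg hgc
  have hgC : Integrable (fun k => ((g k : ℝ) : ℂ)) := (hg.continuous.integrable_of_hasCompactSupport hgc).ofReal
  have hgb : ∃ Cg, ∀ k, ‖g k‖ ≤ Cg := hgc.exists_bound_of_continuous hg.continuous
  obtain ⟨Cg, hCg⟩ := hgb
  have iH : Integrable (fun k => g k • H k) :=
    hH.bdd_smul Cg hg.continuous.aestronglyMeasurable (Filter.Eventually.of_forall hCg)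
  have iG : Integrable (fun k => g k • G k) :=
    (hg.continuous.smul hGc).integrable_of_hasCompactSupport hgc.smul_right
  simp_rw [smul_sub]
  rw [integral_sub iH iG, sub_eq_zero]
  have A1 : ∫ k, g k • H k = ∫ x, q x * ∫ k, ex (k * x) * H k := by
    have e1 : ∀ k, g k • H k = ∫ x, ex (k * x) * (H k * q x) := by
      intro k
      rw [Complex.real_smul, hgq, ← integral_mul_const]; congr 1; ext x; ring
    simp_rw [e1]
    rw [integral_integral_swap]
    · congr 1; ext x
      rw [← integral_const_mul]; congr 1; ext k; ring
    · have hc : Continuous (fun p : ℝ × ℝ => ex (p.1 * p.2)) := continuous_ex.comp (by fun_prop)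
      exact (hH.mul_prod hq).bdd_mul (c := 1) hc.aestronglyMeasurable
        (Filter.Eventually.of_forall (fun x => (norm_ex _).le))
  have A2 : ∀ x, ∫ k, ex (k * x) * H k = 2 * π * ∫ s, freeKernel s x * ft s ∂μ := by
    intro x
    have := h x
    rw [intervalIntegral.integral_of_le ht] at this
    rw [← this, ← mul_assoc, mul_inv_cancel₀ (by simp [pi_ne_zero]), one_mul]
  have hkft : Integrable (fun s => (((√(2 * π))⁻¹ * (√s)⁻¹ : ℝ) : ℂ) * ft s) μ := by
    have h1 : IntervalIntegrable (fun s => (((√s)⁻¹ : ℝ) : ℂ) * ft s) volume 0 t :=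
      (isqrtc_ii le_rfl ht).mul_continuousOn (by fun_prop)
    have h2 := ((intervalIntegrable_iff_integrableOn_Ioc_of_le ht).1 h1).const_mul (((√(2 * π))⁻¹ : ℝ) : ℂ)
    refine Integrable.congr h2 (Filter.Eventually.of_forall fun s => ?_)
    push_cast; ring
  have A3 : ∫ x, q x * (2 * π * ∫ s, freeKernel s x * ft s ∂μ) = ∫ s, ft s * (2 * π * ∫ x, freeKernel s x * q x) ∂μ := by
    have e1 : ∀ x, q x * (2 * π * ∫ s, freeKernel s x * ft s ∂μ) =
        2 * π * ∫ s, ex (x ^ 2 / (2 * s)) * (q x * ((((√(2 * π))⁻¹ * (√s)⁻¹ : ℝ) : ℂ) * ft s)) ∂μ := by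
      intro x
      rw [mul_left_comm, ← integral_const_mul]; congr 1
      refine setIntegral_congr_fun measurableSet_Ioc fun s hs => ?_
      beta_reduce
      rw [fk_eq hs.1]; ring
    have e2 : ∫ s, ft s * (2 * π * ∫ x, freeKernel s x * q x) ∂μ =
        2 * π * ∫ s, (∫ x, ex (x ^ 2 / (2 * s)) * (q x * ((((√(2 * π))⁻¹ * (√s)⁻¹ : ℝ) : ℂ) * ft s))) ∂μ := by
      rw [← integral_const_mul]
      refine setIntegral_congr_fun measurableSet_Ioc fun s hs => ?_
      beta_reduce
      rw [mul_left_comm, ← integral_const_mul]; congr 2; ext x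
      rw [fk_eq hs.1]; ring
    simp_rw [e1]
    rw [e2, integral_const_mul]; congr 1
    refine integral_integral_swap ?_
    have hm : Measurable (fun p : ℝ × ℝ => ex (p.1 ^ 2 / (2 * p.2))) := continuous_ex.measurable.comp (by fun_prop)
    exact (hq.mul_prod hkft).bdd_mul (c := 1) hm.aestronglyMeasurable
        (Filter.Eventually.of_forall (fun x => (norm_ex _).le))
  have A4 : ∫ s, ft s * (2 * π * ∫ x, freeKernel s x * q x) ∂μ =
      ∫ s, (∫ k, ex (-(1 / 2) * k ^ 2 * s) * (om⁻¹ * ft s * ((g k : ℝ) : ℂ))) ∂μ := by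
    refine setIntegral_congr_fun measurableSet_Ioc fun s hs => ?_
    have := fresnel hq hgC hgq hs.1
    beta_reduce
    have e : ∀ k : ℝ, ex (-(1 / 2) * k ^ 2 * s) * (om⁻¹ * ft s * ((g k : ℝ) : ℂ)) =
      om⁻¹ * ft s * (ex (-(1 / 2) * k ^ 2 * s) * ((g k : ℝ) : ℂ)) := fun k => by ring
    simp_rw [e]
    rw [integral_const_mul, this]
    have := om_ne
    field_simp
  rw [A1]; simp_rw [A2]; rw [A3, A4, integral_integral_swap]
  · congr 1; ext k
    rw [Complex.real_smul]; simp only [hG]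
    rw [← integral_const_mul, ← integral_const_mul]; congr 1; ext s; ring
  · have hc : Continuous (fun p : ℝ × ℝ => ex (-(1 / 2) * p.2 ^ 2 * p.1)) := continuous_ex.comp (by fun_prop)
    exact ((hfti.const_mul om⁻¹).mul_prod hgC).bdd_mul (c := 1) hc.aestronglyMeasurable
        (Filter.Eventually.of_forall (fun x => (norm_ex _).le))

lemma nonlin_C1 {U : ℂ → ℝ} (hU : ContDiff ℝ 2 U) : ContDiff ℝ 1 (nonlin U) := by
  have h1 : ContDiff ℝ 1 (fderiv ℝ U) := hU.fderiv_right (by norm_num)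
  have h2 : ∀ v : ℂ, ContDiff ℝ 1 (fun z => ((fderiv ℝ U z v : ℝ) : ℂ)) := fun v =>
    Complex.ofRealCLM.contDiff.comp (h1.clm_apply contDiff_const)
  unfold nonlin grad
  exact ((h2 1).add ((h2 Complex.I).mul contDiff_const)).neg

lemma nonlin_lip {U : ℂ → ℝ} (hU : ContDiff ℝ 2 U) (r : ℝ) : ∃ L N : ℝ, 0 < L ∧ 0 ≤ N ∧
    (∀ a b : ℂ, ‖a‖ ≤ r → ‖b‖ ≤ r → ‖nonlin U a - nonlin U b‖ ≤ L * ‖a - b‖) ∧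
    ∀ a : ℂ, ‖a‖ ≤ r → ‖nonlin U a‖ ≤ N := by
  have h := nonlin_C1 hU
  have hK : IsCompact (Metric.closedBall (0:ℂ) r) := isCompact_closedBall _ _
  obtain ⟨L, hL⟩ := hK.exists_bound_of_continuousOn (h.continuous_fderiv (by norm_num)).continuousOn
  obtain ⟨N, hN⟩ := hK.exists_bound_of_continuousOn h.continuous.continuousOn
  refine ⟨max L 1, max N 0, by positivity, by positivity, fun a b ha hb => ?_, fun a ha => ?_⟩
  · refine (convex_closedBall (0:ℂ) r).norm_image_sub_le_of_norm_fderiv_le (𝕜 := ℝ) (f := nonlin U)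
      (fun x _ => (h.differentiable (by norm_num)) x) (fun x hx => (hL x hx).trans (le_max_left _ _)) ?_ ?_
    · simpa using hb
    · simpa using ha
  · exact (hN a (by simpa using ha)).trans (le_max_left _ _)

/-- the linear part at the origin -/
def zf (a : ℝ → ℂ) (t : ℝ) : ℂ := (2 * π : ℂ)⁻¹ * ∫ k, ex (k ^ 2 * t) * a k

lemma inv2pi_le : ‖(2 * π : ℂ)⁻¹‖ ≤ 1 := by
  rw [norm_inv]
  have : ‖(2 * π : ℂ)‖ = 2 * π := by
    rw [norm_mul, Complex.norm_real, Real.norm_of_nonneg pi_pos.le]; simp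
  rw [this]
  exact inv_le_one_of_one_le₀ (by nlinarith [Real.pi_gt_three])

lemma sol_eq {F : ℂ → ℂ} {φ : H1} {ψ : ℝ → ℝ → ℂ} (hd : IsDuhamelSolution F φ ψ Set.univ)
    {t : ℝ} (ht : 0 ≤ t) :
    ψ 0 t = zf φ.hat t - (((√(2 * π))⁻¹ : ℝ) : ℂ) * half (fun τ => F (ψ 0 τ)) t := by
  have h := hd 0 t (mem_univ _)
  rw [h, ← half_eq _ ht]
  congr 1
  unfold W zf ex
  push_cast
  congr 2; ext k; congr 3; simp

lemma sol_y {ψ : ℝ → ℝ → ℂ} (hc : CbOn ψ Set.univ) : Continuous (fun t => ψ 0 t) ∧ ∃ M : ℝ, 0 ≤ M ∧ ∀ t, ‖ψ 0 t‖ ≤ M := by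
  obtain ⟨h1, M, hM⟩ := hc
  rw [univ_prod_univ, continuousOn_univ] at h1
  refine ⟨h1.comp (by fun_prop : Continuous fun t : ℝ => ((0:ℝ), t)), M, ?_, fun t => hM 0 t (mem_univ _)⟩
  exact (norm_nonneg _).trans (hM 0 0 (mem_univ _))

lemma ex_int {a : ℝ → ℂ} (ha : Integrable a) (x t : ℝ) : Integrable (fun k => ex (k * x + k ^ 2 * t) * a k) :=
  integrable_ex_mul ha (by fun_prop)

lemma sol_hat {F : ℂ → ℂ} (hF : Continuous F) {φ : H1} {ψ : ℝ → ℝ → ℂ} {Ψ : ℝ → H1}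
    (hc : CbOn ψ Set.univ) (hd : IsDuhamelSolution F φ ψ Set.univ)
    (hΨ : ∀ t x : ℝ, (Ψ t).toFun x = ψ x t) {t : ℝ} (ht : 0 ≤ t) :
    ∀ᵐ k : ℝ, (Ψ t).hat k = ex (k ^ 2 * t) * φ.hat k -
      om⁻¹ * (ex (-(1 / 2) * k ^ 2 * t) * ∫ τ in (0:ℝ)..t, ex (1 / 2 * k ^ 2 * τ) * F (ψ 0 τ)) := by
  have i1 : Integrable φ.hat := HW_int ⟨φ.meas, φ.finite⟩
  have i2 : Integrable (Ψ t).hat := HW_int ⟨(Ψ t).meas, (Ψ t).finite⟩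
  have hcf : Continuous (fun τ => F (ψ 0 τ)) := hF.comp (sol_y hc).1
  have i3 : Integrable (fun k => ex (k ^ 2 * t) * φ.hat k) := integrable_ex_mul i1 (by fun_prop)
  have key := ident (H := fun k => ex (k ^ 2 * t) * φ.hat k - (Ψ t).hat k) (i3.sub i2) hcf ht (by
    intro x
    have h1 := hd x t (mem_univ _)
    rw [← hΨ] at h1
    have h2 : W t φ x = (2 * π : ℂ)⁻¹ * ∫ k, ex (k * x) * (ex (k ^ 2 * t) * φ.hat k) := by
      unfold W; push_cast; congr 2; ext k
      rw [← mul_assoc, ← ex_add]; unfold ex; push_cast; rfl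
    have h3 : (Ψ t).toFun x = (2 * π : ℂ)⁻¹ * ∫ k, ex (k * x) * (Ψ t).hat k := by
      unfold H1.toFun ex; push_cast; rfl
    have h4 : ∫ s in (0 : ℝ)..t, freeKernel s x * F (ψ 0 (t - s)) = W t φ x - (Ψ t).toFun x := by
      rw [h1]; ring
    rw [h4, h2, h3, ← mul_sub]
    congr 1
    rw [← integral_sub (integrable_ex_mul i3 (by fun_prop)) (integrable_ex_mul i2 (by fun_prop))]
    congr 1; ext k; ring)
  filter_upwards [key] with k hk
  rw [sub_eq_iff_eq_add] at hk
  have h5 : ∫ s in (0:ℝ)..t, ex (-(1 / 2) * k ^ 2 * s) * F (ψ 0 (t - s)) =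
      ex (-(1 / 2) * k ^ 2 * t) * ∫ τ in (0:ℝ)..t, ex (1 / 2 * k ^ 2 * τ) * F (ψ 0 τ) := by
    have h6 := intervalIntegral.integral_comp_sub_left (a := 0) (b := t)
      (fun τ => ex (-(1 / 2) * k ^ 2 * (t - τ)) * F (ψ 0 τ)) t
    simp only [sub_sub_cancel, sub_zero, sub_self] at h6
    rw [h6, ← intervalIntegral.integral_const_mul]
    congr 1; ext τ
    rw [← mul_assoc, ← ex_add]; congr 2; ring
  rw [h5] at hk
  rw [hk]; ring

lemma omega_y {a y f : ℝ → ℂ} (ha : HW a) (hy : Continuous y) (hf : Continuous f) {T N : ℝ} (hT : 0 ≤ T)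
    (hN : ∀ τ ∈ Icc (0:ℝ) (T + 1), ‖f τ‖ ≤ N)
    (he : ∀ t, 0 ≤ t → y t = zf a t - (((√(2 * π))⁻¹ : ℝ) : ℂ) * half f t) :
    ∀ h ∈ Ioc (0:ℝ) 1, ∫ τ in (0:ℝ)..T, ‖y (τ + h) - y τ‖ ^ 2 ≤
      (2 * ((2 * T + 2 * π) * (2 * nw a)) + 32 * N ^ 2 * T) * h := by
  intro h hh
  have hz := ztime_cont (HW_int ha)
  set z : ℝ → ℂ := fun t => ∫ k, ex (k ^ 2 * t) * a k with hzd
  have hzm := zmod ha hT hh.1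
  have hb : ∀ τ ∈ Icc (0:ℝ) T, ‖y (τ + h) - y τ‖ ^ 2 ≤ 2 * ‖z (τ + h) - z τ‖ ^ 2 + 32 * N ^ 2 * h := by
    intro τ hτ
    have hm := half_mod hf hτ.1 hh.1 (N := N) (fun s hs => hN s ⟨hs.1, by linarith [hs.2, hτ.2, hh.2]⟩)
    have e : y (τ + h) - y τ = (2 * π : ℂ)⁻¹ * (z (τ + h) - z τ) -
        (((√(2 * π))⁻¹ : ℝ) : ℂ) * (half f (τ + h) - half f τ) := by
      rw [he _ hτ.1, he _ (by linarith [hτ.1, hh.1])]; simp only [zf, hzd]; ring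
    have h1 : ‖(2 * π : ℂ)⁻¹ * (z (τ + h) - z τ)‖ ≤ ‖z (τ + h) - z τ‖ := by
      rw [norm_mul]; exact mul_le_of_le_one_left (norm_nonneg _) inv2pi_le
    have h2 : ‖(((√(2 * π))⁻¹ : ℝ) : ℂ) * (half f (τ + h) - half f τ)‖ ≤ 4 * N * √h := by
      rw [norm_mul, Complex.norm_real, Real.norm_of_nonneg (by positivity)]
      exact (mul_le_of_le_one_left (norm_nonneg _) kap_le).trans hm
    have h3 : ‖y (τ + h) - y τ‖ ≤ ‖z (τ + h) - z τ‖ + 4 * N * √h := by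
      rw [e]; exact (norm_sub_le _ _).trans (add_le_add h1 h2)
    have h4 : ‖y (τ + h) - y τ‖ ^ 2 ≤ (‖z (τ + h) - z τ‖ + 4 * N * √h) ^ 2 :=
      pow_le_pow_left₀ (norm_nonneg _) h3 2
    have h5 : (4 * N * √h) ^ 2 = 16 * N ^ 2 * h := by
      rw [mul_pow, Real.sq_sqrt hh.1.le]; ring
    nlinarith [sq_nonneg (‖z (τ + h) - z τ‖ - 4 * N * √h)]
  have c1 : Continuous (fun τ => ‖y (τ + h) - y τ‖ ^ 2) := by fun_prop
  have c2 : Continuous (fun τ => 2 * ‖z (τ + h) - z τ‖ ^ 2) := by fun_prop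
  have h6 := intervalIntegral.integral_mono_on (μ := volume) hT (c1.intervalIntegrable _ _)
    ((c2.add continuous_const).intervalIntegrable _ _) hb
  simp only [Pi.add_apply] at h6
  rw [intervalIntegral.integral_add (c2.intervalIntegrable _ _) (by simp),
    intervalIntegral.integral_const_mul, intervalIntegral.integral_const] at h6
  simp only [smul_eq_mul, sub_zero] at h6
  nlinarith

lemma key_est {p : ℝ → ℂ} (hp : Continuous p) {t T P C R : ℝ} (ht : 0 ≤ t) (htT : t ≤ T)
    (hP : ∀ τ ∈ Icc (0:ℝ) T, ‖p τ‖ ≤ P)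
    (hC : ∀ h ∈ Ioc (0:ℝ) 1, ∫ τ in (0:ℝ)..T, ‖p (τ + h) - p τ‖ ^ 2 ≤ C * h) (hR : 2 ≤ R) :
    ∫⁻ k : ℝ, ENNReal.ofReal ((1 + k ^ 2) * ‖∫ τ in (0:ℝ)..t, ex (1 / 2 * k ^ 2 * τ) * p τ‖ ^ 2) ≤
      ENNReal.ofReal (2 * R * ((1 + R ^ 2) * (T * P) ^ 2) + 2 * (640 * π * (2 * P ^ 2 + C) / R)) := by
  have hT : 0 ≤ T := ht.trans htT
  have hP0 : 0 ≤ P := (norm_nonneg _).trans (hP 0 ⟨le_rfl, hT⟩)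
  have hC0 : 0 ≤ C := by
    have h1 := hC 1 ⟨one_pos, le_rfl⟩
    have h2 : 0 ≤ ∫ τ in (0:ℝ)..T, ‖p (τ + 1) - p τ‖ ^ 2 :=
      intervalIntegral.integral_nonneg hT (fun _ _ => by positivity)
    linarith
  have htb := tail_bound hp ht htT hP hC hR
  set G : ℝ → ℂ := fun k => ∫ τ in (0:ℝ)..t, ex (1 / 2 * k ^ 2 * τ) * p τ with hG
  have hGb : ∀ k, ‖G k‖ ≤ T * P := by
    intro k
    have := intervalIntegral.norm_integral_le_of_norm_le_const (a := 0) (b := t) (C := P)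
      (f := fun τ => ex (1 / 2 * k ^ 2 * τ) * p τ) (by
        intro τ hτ
        rw [uIoc_of_le ht] at hτ
        rw [norm_mul, norm_ex, one_mul]; exact hP τ ⟨hτ.1.le, hτ.2.trans htT⟩)
    rw [sub_zero, abs_of_nonneg ht] at this
    nlinarith
  set S : Set ℝ := {k : ℝ | R ≤ |k|} with hS
  have hSm : MeasurableSet S := measurableSet_le measurable_const continuous_abs.measurable
  rw [← lintegral_add_compl _ hSm, add_comm, ENNReal.ofReal_add (by positivity) (by positivity)]
  refine add_le_add ?_ ?_
  · have hsub : Sᶜ ⊆ Icc (-R) R := by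
      intro k hk
      simp only [hS, mem_compl_iff, mem_ofPred_eq, not_le] at hk
      exact ⟨by linarith [(abs_lt.1 hk).1], (abs_lt.1 hk).2.le⟩
    refine (lintegral_mono_set hsub).trans ?_
    calc ∫⁻ k in Icc (-R) R, ENNReal.ofReal ((1 + k ^ 2) * ‖G k‖ ^ 2)
        ≤ ∫⁻ k in Icc (-R) R, ENNReal.ofReal ((1 + R ^ 2) * (T * P) ^ 2) := by
          refine setLIntegral_mono measurable_const fun k hk => ENNReal.ofReal_le_ofReal ?_
          have h1 : k ^ 2 ≤ R ^ 2 := sq_le_sq' hk.1 hk.2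
          have h2 : ‖G k‖ ^ 2 ≤ (T * P) ^ 2 := pow_le_pow_left₀ (norm_nonneg _) (hGb k) 2
          gcongr
      _ = ENNReal.ofReal (2 * R * ((1 + R ^ 2) * (T * P) ^ 2)) := by
          rw [setLIntegral_const, Real.volume_Icc, mul_comm, ← ENNReal.ofReal_mul (by linarith)]
          congr 1; ring
  · calc ∫⁻ k in S, ENNReal.ofReal ((1 + k ^ 2) * ‖G k‖ ^ 2)
        ≤ ∫⁻ k in S, 2 * ENNReal.ofReal (k ^ 2 * ‖G k‖ ^ 2) := by
          refine setLIntegral_mono' hSm fun k hk => ?_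
          have h0 : (2:ENNReal) = ENNReal.ofReal 2 := by simp
          rw [h0, ← ENNReal.ofReal_mul (by norm_num)]
          refine ENNReal.ofReal_le_ofReal ?_
          have hk' : R ≤ |k| := hk
          have h1 : 1 ≤ k ^ 2 := by rw [← sq_abs]; nlinarith
          nlinarith [sq_nonneg ‖G k‖]
      _ = 2 * ∫⁻ k in S, ENNReal.ofReal (k ^ 2 * ‖G k‖ ^ 2) := lintegral_const_mul' _ _ (by simp)
      _ ≤ 2 * ENNReal.ofReal (640 * π * (2 * P ^ 2 + C) / R) := by gcongr
      _ = _ := by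
          have h0 : (2:ENNReal) = ENNReal.ofReal 2 := by simp
          rw [h0, ← ENNReal.ofReal_mul (by norm_num)]

lemma HW_sub {a b : ℝ → ℂ} (ha : HW a) (hb : HW b) : HW (fun k => a k - b k) := by
  refine ⟨ha.1.sub hb.1, ?_⟩
  refine Integrable.mono' ((ha.2.const_mul 2).add (hb.2.const_mul 2)) ?_ (Filter.Eventually.of_forall fun k => ?_)
  · exact (by fun_prop : Continuous fun k : ℝ => 1 + k ^ 2).aestronglyMeasurable.mul ((ha.1.sub hb.1).norm.pow 2)
  · rw [Real.norm_of_nonneg (by positivity)]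
    simp only [Pi.add_apply]
    have h1 : ‖a k - b k‖ ^ 2 ≤ (‖a k‖ + ‖b k‖) ^ 2 := pow_le_pow_left₀ (norm_nonneg _) (norm_sub_le _ _) 2
    have h2 : ‖a k - b k‖ ^ 2 ≤ 2 * ‖a k‖ ^ 2 + 2 * ‖b k‖ ^ 2 := by
      nlinarith [sq_nonneg (‖a k‖ - ‖b k‖)]
    nlinarith [sq_nonneg k]

lemma nw_le {a b : ℝ → ℂ} (ha : HW a) (hb : HW b) : nw a ≤ 2 * nw b + 2 * nw (fun k => a k - b k) := by
  unfold nw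
  rw [← integral_const_mul, ← integral_const_mul,
    ← integral_add (hb.2.const_mul 2) ((HW_sub ha hb).2.const_mul 2)]
  refine integral_mono ha.2 ((hb.2.const_mul 2).add ((HW_sub ha hb).2.const_mul 2)) fun k => ?_
  simp only []
  have h0 : ‖a k‖ ≤ ‖b k‖ + ‖a k - b k‖ := by
    calc ‖a k‖ = ‖b k + (a k - b k)‖ := by congr 1; ring
      _ ≤ _ := norm_add_le _ _
  have h1 : ‖a k‖ ^ 2 ≤ (‖b k‖ + ‖a k - b k‖) ^ 2 := pow_le_pow_left₀ (norm_nonneg _) h0 2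
  have h2 : ‖a k‖ ^ 2 ≤ 2 * ‖b k‖ ^ 2 + 2 * ‖a k - b k‖ ^ 2 := by
    nlinarith [sq_nonneg (‖b k‖ - ‖a k - b k‖)]
  nlinarith [sq_nonneg k]

lemma H1.hw (φ : H1) : HW φ.hat := ⟨φ.meas, φ.finite⟩

lemma dist_nw {φ φ' : H1} {η : ℝ} (h : H1.dist φ' φ < η) : nw (fun k => φ'.hat k - φ.hat k) ≤ (3 * η) ^ 2 := by
  have h0 : 0 ≤ (2 * π)⁻¹ * nw (fun k => φ'.hat k - φ.hat k) := mul_nonneg (by positivity) (nw_nonneg _)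
  have hη : 0 < η := (Real.sqrt_nonneg _).trans_lt h
  have h1 : (2 * π)⁻¹ * nw (fun k => φ'.hat k - φ.hat k) < η ^ 2 := (Real.sqrt_lt' hη).1 h
  rw [inv_mul_lt_iff₀ (by positivity)] at h1
  nlinarith [Real.pi_lt_d2, sq_nonneg η]

lemma dist_of_nw {φ φ' : H1} {δ : ℝ} (hδ : 0 < δ) (h : nw (fun k => φ'.hat k - φ.hat k) ≤ 2 * δ ^ 2) : H1.dist φ' φ < δ := by
  refine (Real.sqrt_lt' hδ).2 ?_
  rw [inv_mul_lt_iff₀ (by positivity)]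
  have : (0:ℝ) < δ ^ 2 := by positivity
  have h' : (∫ k : ℝ, (1 + k ^ 2) * ‖φ'.hat k - φ.hat k‖ ^ 2) ≤ 2 * δ ^ 2 := h
  nlinarith [Real.pi_gt_three]

lemma nw_split {a d G : ℝ → ℂ} (ha : HW a) (hd : HW d) {X : ℝ} (hX : 0 ≤ X)
    (h : ∀ᵐ k : ℝ, ‖a k‖ ≤ ‖d k‖ + ‖G k‖)
    (hG : ∫⁻ k : ℝ, ENNReal.ofReal ((1 + k ^ 2) * ‖G k‖ ^ 2) ≤ ENNReal.ofReal X) :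
    nw a ≤ 2 * nw d + 2 * X := by
  unfold nw
  rw [integral_eq_lintegral_of_nonneg_ae (Filter.Eventually.of_forall fun k => by positivity) ha.2.aestronglyMeasurable]
  have hn := nw_nonneg d
  refine ENNReal.toReal_le_of_le_ofReal (by unfold nw at hn; positivity) ?_
  have h2 : (2:ENNReal) = ENNReal.ofReal 2 := by simp
  calc ∫⁻ k : ℝ, ENNReal.ofReal ((1 + k ^ 2) * ‖a k‖ ^ 2)
      ≤ ∫⁻ k : ℝ, (ENNReal.ofReal (2 * ((1 + k ^ 2) * ‖d k‖ ^ 2)) + 2 * ENNReal.ofReal ((1 + k ^ 2) * ‖G k‖ ^ 2)) := by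
        refine lintegral_mono_ae ?_
        filter_upwards [h] with k hk
        rw [h2, ← ENNReal.ofReal_mul (by norm_num), ← ENNReal.ofReal_add (by positivity) (by positivity)]
        refine ENNReal.ofReal_le_ofReal ?_
        have h1 : ‖a k‖ ^ 2 ≤ (‖d k‖ + ‖G k‖) ^ 2 := pow_le_pow_left₀ (norm_nonneg _) hk 2
        have h2 : ‖a k‖ ^ 2 ≤ 2 * ‖d k‖ ^ 2 + 2 * ‖G k‖ ^ 2 := by
          nlinarith [sq_nonneg (‖d k‖ - ‖G k‖)]
        nlinarith [sq_nonneg k]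
    _ = ENNReal.ofReal (2 * ∫ k, (1 + k ^ 2) * ‖d k‖ ^ 2) + 2 * ∫⁻ k : ℝ, ENNReal.ofReal ((1 + k ^ 2) * ‖G k‖ ^ 2) := by
        have hi : Integrable (fun k => 2 * ((1 + k ^ 2) * ‖d k‖ ^ 2)) := hd.2.const_mul 2
        rw [lintegral_add_left' hi.aestronglyMeasurable.aemeasurable.ennreal_ofReal, lintegral_const_mul' _ _ (by simp),
          ← ofReal_integral_eq_lintegral_ofReal hi (Filter.Eventually.of_forall fun k => by positivity),
          integral_const_mul]
    _ ≤ ENNReal.ofReal (2 * ∫ k, (1 + k ^ 2) * ‖d k‖ ^ 2) + 2 * ENNReal.ofReal X := by gcongr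
    _ = _ := by
        unfold nw at hn
        rw [h2, ← ENNReal.ofReal_mul (by norm_num), ← ENNReal.ofReal_add (by positivity) (by positivity)]

lemma w_bound {F : ℂ → ℂ} (hF : Continuous F) {φ φ' : H1} {ψ ψ' : ℝ → ℝ → ℂ}
    (hc : CbOn ψ Set.univ) (hd : IsDuhamelSolution F φ ψ Set.univ)
    (hc' : CbOn ψ' Set.univ) (hd' : IsDuhamelSolution F φ' ψ' Set.univ)
    {η : ℝ} (hη : 0 < η) (hdist : H1.dist φ' φ < η) {t : ℝ} (ht : 0 ≤ t) :
    ‖ψ' 0 t - ψ 0 t‖ ≤ 9 * η + ∫ s in (0:ℝ)..t, (√s)⁻¹ * ‖F (ψ' 0 (t - s)) - F (ψ 0 (t - s))‖ := by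
  have hnw := dist_nw hdist
  obtain ⟨i1, i2⟩ := HW_l1_aux (HW_sub φ'.hw φ.hw) (by positivity : 0 < 3 * η) hnw
  have hcf : Continuous (fun τ => F (ψ 0 τ)) := hF.comp (sol_y hc).1
  have hcf' : Continuous (fun τ => F (ψ' 0 τ)) := hF.comp (sol_y hc').1
  have j : ∀ f : ℝ → ℂ, Continuous f → IntervalIntegrable (fun s => (((√s)⁻¹ : ℝ) : ℂ) * f (t - s)) volume 0 t := fun f hf =>
    (isqrtc_ii le_rfl ht).mul_continuousOn (by fun_prop)
  have e1 : half (fun τ => F (ψ' 0 τ)) t - half (fun τ => F (ψ 0 τ)) t =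
      ∫ s in (0:ℝ)..t, (((√s)⁻¹ : ℝ) : ℂ) * (F (ψ' 0 (t - s)) - F (ψ 0 (t - s))) := by
    unfold half
    rw [← intervalIntegral.integral_sub (j _ hcf') (j _ hcf)]
    congr 1; ext s; ring
  have e2 : zf φ'.hat t - zf φ.hat t = (2 * π : ℂ)⁻¹ * ∫ k, ex (k ^ 2 * t) * (φ'.hat k - φ.hat k) := by
    unfold zf
    rw [← mul_sub, ← integral_sub (integrable_ex_mul (HW_int φ'.hw) (by fun_prop)) (integrable_ex_mul (HW_int φ.hw) (by fun_prop))]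
    congr 2; ext k; ring
  have e3 : ψ' 0 t - ψ 0 t = (2 * π : ℂ)⁻¹ * (∫ k, ex (k ^ 2 * t) * (φ'.hat k - φ.hat k)) -
      (((√(2 * π))⁻¹ : ℝ) : ℂ) * ∫ s in (0:ℝ)..t, (((√s)⁻¹ : ℝ) : ℂ) * (F (ψ' 0 (t - s)) - F (ψ 0 (t - s))) := by
    rw [← e1, ← e2, sol_eq hd ht, sol_eq hd' ht]; ring
  rw [e3]
  refine (norm_sub_le _ _).trans (add_le_add ?_ ?_)
  · rw [norm_mul]
    refine (mul_le_of_le_one_left (norm_nonneg _) inv2pi_le).trans ?_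
    refine (norm_integral_le_integral_norm _).trans ?_
    simp only [norm_mul, norm_ex, one_mul]
    linarith
  · rw [norm_mul, Complex.norm_real, Real.norm_of_nonneg (by positivity)]
    refine (mul_le_of_le_one_left (norm_nonneg _) kap_le).trans ?_
    refine (intervalIntegral.norm_integral_le_integral_norm ht).trans (le_of_eq ?_)
    congr 1; ext s
    rw [norm_mul, Complex.norm_real, Real.norm_of_nonneg (by positivity)]

lemma omega_f {F : ℂ → ℂ} (hF : Continuous F) {φ : H1} {ψ : ℝ → ℝ → ℂ}
    (hc : CbOn ψ Set.univ) (hd : IsDuhamelSolution F φ ψ Set.univ) {T r L N m : ℝ} (hT : 0 ≤ T)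
    (hr : ∀ τ ∈ Icc (0:ℝ) (T + 1), ‖ψ 0 τ‖ ≤ r)
    (hL : ∀ a b : ℂ, ‖a‖ ≤ r → ‖b‖ ≤ r → ‖F a - F b‖ ≤ L * ‖a - b‖)
    (hN : ∀ a : ℂ, ‖a‖ ≤ r → ‖F a‖ ≤ N) (hm : nw φ.hat ≤ m) :
    ∀ h ∈ Ioc (0:ℝ) 1, ∫ τ in (0:ℝ)..T, ‖F (ψ 0 (τ + h)) - F (ψ 0 τ)‖ ^ 2 ≤
      L ^ 2 * (2 * ((2 * T + 2 * π) * (2 * m)) + 32 * N ^ 2 * T) * h := by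
  intro h hh
  have hy := (sol_y hc).1
  have hcf : Continuous (fun τ => F (ψ 0 τ)) := hF.comp hy
  have h1 := omega_y φ.hw hy hcf hT (N := N) (fun τ hτ => hN _ (hr τ hτ)) (fun t ht => sol_eq hd ht) h hh
  have c1 : Continuous (fun τ => ‖F (ψ 0 (τ + h)) - F (ψ 0 τ)‖ ^ 2) := by
    have : Continuous (fun τ => F (ψ 0 (τ + h))) := hcf.comp (by fun_prop : Continuous fun τ : ℝ => τ + h)
    fun_prop
  have c2 : Continuous (fun τ => L ^ 2 * ‖ψ 0 (τ + h) - ψ 0 τ‖ ^ 2) := by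
    have : Continuous (fun τ => ψ 0 (τ + h)) := hy.comp (by fun_prop : Continuous fun τ : ℝ => τ + h)
    fun_prop
  have h2 := intervalIntegral.integral_mono_on (μ := volume) hT (c1.intervalIntegrable _ _) (c2.intervalIntegrable _ _) (by
    intro τ hτ
    rw [← mul_pow]
    exact pow_le_pow_left₀ (norm_nonneg _) (hL _ _ (hr _ ⟨by linarith [hτ.1, hh.1], by linarith [hτ.2, hh.2]⟩)
      (hr _ ⟨hτ.1, by linarith [hτ.2]⟩)) 2)
  rw [intervalIntegral.integral_const_mul] at h2
  have h3 : (2 * ((2 * T + 2 * π) * (2 * nw φ.hat)) + 32 * N ^ 2 * T) * h ≤ (2 * ((2 * T + 2 * π) * (2 * m)) + 32 * N ^ 2 * T) * h := by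
    have := hh.1.le
    have := pi_pos
    gcongr
  refine h2.trans ((mul_le_mul_of_nonneg_left (h1.trans h3) (sq_nonneg L)).trans (le_of_eq (by ring)))

lemma omega_p {f g : ℝ → ℂ} (hf : Continuous f) (hg : Continuous g) {T C : ℝ} (hT : 0 ≤ T)
    (h1 : ∀ h ∈ Ioc (0:ℝ) 1, ∫ τ in (0:ℝ)..T, ‖f (τ + h) - f τ‖ ^ 2 ≤ C * h)
    (h2 : ∀ h ∈ Ioc (0:ℝ) 1, ∫ τ in (0:ℝ)..T, ‖g (τ + h) - g τ‖ ^ 2 ≤ C * h) :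
    ∀ h ∈ Ioc (0:ℝ) 1, ∫ τ in (0:ℝ)..T, ‖(f (τ + h) - g (τ + h)) - (f τ - g τ)‖ ^ 2 ≤ 4 * C * h := by
  intro h hh
  have c1 : Continuous (fun τ => ‖(f (τ + h) - g (τ + h)) - (f τ - g τ)‖ ^ 2) := by fun_prop
  have c2 : Continuous (fun τ => 2 * ‖f (τ + h) - f τ‖ ^ 2) := by fun_prop
  have c3 : Continuous (fun τ => 2 * ‖g (τ + h) - g τ‖ ^ 2) := by fun_prop
  have h3 := intervalIntegral.integral_mono_on (μ := volume) hT (c1.intervalIntegrable _ _)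
    ((c2.add c3).intervalIntegrable _ _) (by
    intro τ _
    have h4 : ‖(f (τ + h) - g (τ + h)) - (f τ - g τ)‖ ≤ ‖f (τ + h) - f τ‖ + ‖g (τ + h) - g τ‖ := by
      have : (f (τ + h) - g (τ + h)) - (f τ - g τ) = (f (τ + h) - f τ) - (g (τ + h) - g τ) := by ring
      rw [this]; exact norm_sub_le _ _
    have h5 := pow_le_pow_left₀ (norm_nonneg _) h4 2
    simp only [Pi.add_apply]
    nlinarith [sq_nonneg (‖f (τ + h) - f τ‖ - ‖g (τ + h) - g τ‖)])
  simp only [Pi.add_apply] at h3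
  rw [intervalIntegral.integral_add (c2.intervalIntegrable _ _) (c3.intervalIntegrable _ _),
    intervalIntegral.integral_const_mul, intervalIntegral.integral_const_mul] at h3
  linarith [h1 h hh, h2 h hh]

theorem main_aux {U : ℂ → ℝ} (hU : ContDiff ℝ 2 U) (T : ℝ) (hT : 0 < T)
    (φ : H1) (ψ : ℝ → ℝ → ℂ) (Ψ : ℝ → H1)
    (hc : CbOn ψ Set.univ) (hd : IsDuhamelSolution (nonlin U) φ ψ Set.univ)
    (hΨ : ∀ t x : ℝ, (Ψ t).toFun x = ψ x t) (δ : ℝ) (hδ : 0 < δ) : ∃ η > (0 : ℝ),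
        ∀ (φ' : H1) (ψ' : ℝ → ℝ → ℂ) (Ψ' : ℝ → H1),
          CbOn ψ' Set.univ → IsDuhamelSolution (nonlin U) φ' ψ' Set.univ →
          (∀ t x : ℝ, (Ψ' t).toFun x = ψ' x t) →
          H1.dist φ' φ < η →
          ∀ t ∈ Set.Icc (0 : ℝ) T, H1.dist (Ψ' t) (Ψ t) < δ := by
  have hF : Continuous (nonlin U) := (nonlin_C1 hU).continuous
  obtain ⟨hy, M, hM0, hM⟩ := sol_y hc
  obtain ⟨L, N, hL0, hN0, hL, hN⟩ := nonlin_lip hU (M + 1)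
  set F := nonlin U with hFd
  set K : ℝ := 27 * rexp (4 * π * L ^ 2 * (T + 1)) with hK
  have hK0 : 0 < K := by positivity
  set m : ℝ := 2 * nw φ.hat + 18 with hm
  have hm0 : 0 ≤ m := by linarith [nw_nonneg φ.hat]
  set C : ℝ := L ^ 2 * (2 * ((2 * T + 2 * π) * (2 * m)) + 32 * N ^ 2 * T) with hC
  have hC0 : 0 ≤ C := by positivity
  set R : ℝ := max 2 (2560 * π * (2 * L ^ 2 + 4 * C) / δ ^ 2) with hR
  have hR2 : 2 ≤ R := le_max_left _ _
  have hR3 : 2560 * π * (2 * L ^ 2 + 4 * C) / R ≤ δ ^ 2 := by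
    have h1 : 2560 * π * (2 * L ^ 2 + 4 * C) / δ ^ 2 ≤ R := le_max_right _ _
    rw [div_le_iff₀ (by positivity)] at h1
    rw [div_le_iff₀ (by linarith)]; linarith
  set Q : ℝ := 18 + 4 * R * (1 + R ^ 2) * (T * (L * K)) ^ 2 with hQ
  have hQ0 : 0 < Q := by positivity
  refine ⟨min 1 (min K⁻¹ (δ ^ 2 / Q)), by positivity, ?_⟩
  intro φ' ψ' Ψ' hc' hd' hΨ' hdist t ht
  obtain ⟨hη0, hη1, hη2, hη3⟩ : 0 < min 1 (min K⁻¹ (δ ^ 2 / Q)) ∧ min 1 (min K⁻¹ (δ ^ 2 / Q)) ≤ 1 ∧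
      min 1 (min K⁻¹ (δ ^ 2 / Q)) ≤ K⁻¹ ∧ min 1 (min K⁻¹ (δ ^ 2 / Q)) ≤ δ ^ 2 / Q :=
    ⟨by positivity, min_le_left _ _, (min_le_right _ _).trans (min_le_left _ _), (min_le_right _ _).trans (min_le_right _ _)⟩
  generalize min 1 (min K⁻¹ (δ ^ 2 / Q)) = η at *
  have hKη : K * η ≤ 1 := by
    calc K * η ≤ K * K⁻¹ := by gcongr
      _ = 1 := mul_inv_cancel₀ hK0.ne'
  have hQη : Q * η ^ 2 ≤ δ ^ 2 := by
    rw [le_div_iff₀ hQ0] at hη3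
    nlinarith [mul_nonneg hQ0.le hη0.le]
  have hnw := dist_nw hdist
  have hy' := (sol_y hc').1
  have hcf : Continuous (fun τ => F (ψ 0 τ)) := hF.comp hy
  have hcf' : Continuous (fun τ => F (ψ' 0 τ)) := hF.comp hy'
  have hKe : 3 * (9 * η) * rexp (4 * π * L ^ 2 * (T + 1)) = K * η := by rw [hK]; ring
  have hg := gron (w := fun τ => ψ' 0 τ - ψ 0 τ) (p := fun τ => F (ψ' 0 τ) - F (ψ 0 τ)) (hy'.sub hy)
    (hcf'.sub hcf) (L := L) (T := T + 1) (ε := 9 * η) hL0 (by positivity)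
    (fun t ht => w_bound hF hc hd hc' hd' hη0 hdist ht.1)
    (fun t ht hw => by
      refine hL _ _ ?_ ((hM t).trans (by linarith))
      have : ‖ψ' 0 t‖ ≤ ‖ψ 0 t‖ + ‖ψ' 0 t - ψ 0 t‖ := by
        calc ‖ψ' 0 t‖ = ‖ψ 0 t + (ψ' 0 t - ψ 0 t)‖ := by congr 1; ring
          _ ≤ _ := norm_add_le _ _
      have := hM t
      linarith) (by rw [hKe]; exact hKη)
  rw [hKe] at hg
  have hr' : ∀ τ ∈ Icc (0:ℝ) (T + 1), ‖ψ' 0 τ‖ ≤ M + 1 := by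
    intro τ hτ
    have h0 : ‖ψ' 0 τ - ψ 0 τ‖ ≤ K * η := hg τ hτ
    have : ‖ψ' 0 τ‖ ≤ ‖ψ 0 τ‖ + ‖ψ' 0 τ - ψ 0 τ‖ := by
      calc ‖ψ' 0 τ‖ = ‖ψ 0 τ + (ψ' 0 τ - ψ 0 τ)‖ := by congr 1; ring
        _ ≤ _ := norm_add_le _ _
    linarith [hM τ]
  have hr : ∀ τ ∈ Icc (0:ℝ) (T + 1), ‖ψ 0 τ‖ ≤ M + 1 := fun τ _ => (hM τ).trans (by linarith)
  have hP : ∀ τ ∈ Icc (0:ℝ) T, ‖F (ψ' 0 τ) - F (ψ 0 τ)‖ ≤ L * (K * η) := by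
    intro τ hτ
    have hτ' : τ ∈ Icc (0:ℝ) (T + 1) := ⟨hτ.1, by linarith [hτ.2]⟩
    exact (hL _ _ (hr' τ hτ') (hr τ hτ')).trans (mul_le_mul_of_nonneg_left (hg τ hτ') hL0.le)
  have hnw' : nw φ'.hat ≤ m := by
    have := nw_le φ'.hw φ.hw
    nlinarith
  have o1 := omega_f hF hc hd hT.le hr hL hN (m := m) (by linarith [nw_nonneg φ.hat])
  have o2 := omega_f hF hc' hd' hT.le hr' hL hN hnw'
  have o3 := omega_p hcf' hcf hT.le o2 o1
  rw [← hC] at o3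
  have hkey := key_est (p := fun τ => F (ψ' 0 τ) - F (ψ 0 τ)) (hcf'.sub hcf) ht.1 ht.2 hP o3 hR2
  refine dist_of_nw hδ ?_
  have hsplit := nw_split (G := fun k => ∫ τ in (0:ℝ)..t, ex (1 / 2 * k ^ 2 * τ) * (F (ψ' 0 τ) - F (ψ 0 τ))) (HW_sub (Ψ' t).hw (Ψ t).hw) (HW_sub φ'.hw φ.hw) (by positivity : 0 ≤ 2 * R * ((1 + R ^ 2) * (T * (L * (K * η))) ^ 2) + 2 * (640 * π * (2 * (L * (K * η)) ^ 2 + 4 * C) / R)) (by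
    filter_upwards [sol_hat hF hc hd hΨ ht.1, sol_hat hF hc' hd' hΨ' ht.1] with k h1 h2
    have e : ∫ τ in (0:ℝ)..t, ex (1 / 2 * k ^ 2 * τ) * (F (ψ' 0 τ) - F (ψ 0 τ)) =
        (∫ τ in (0:ℝ)..t, ex (1 / 2 * k ^ 2 * τ) * F (ψ' 0 τ)) - ∫ τ in (0:ℝ)..t, ex (1 / 2 * k ^ 2 * τ) * F (ψ 0 τ) := by
      have hce : Continuous (fun τ : ℝ => ex (1 / 2 * k ^ 2 * τ)) := continuous_ex.comp (by fun_prop)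
      have c1 : Continuous (fun τ : ℝ => ex (1 / 2 * k ^ 2 * τ) * F (ψ' 0 τ)) := hce.mul hcf'
      have c2 : Continuous (fun τ : ℝ => ex (1 / 2 * k ^ 2 * τ) * F (ψ 0 τ)) := hce.mul hcf
      rw [← intervalIntegral.integral_sub (c1.intervalIntegrable _ _) (c2.intervalIntegrable _ _)]
      congr 1; ext τ; ring
    have e2 : (Ψ' t).hat k - (Ψ t).hat k = ex (k ^ 2 * t) * (φ'.hat k - φ.hat k) -
        om⁻¹ * (ex (-(1 / 2) * k ^ 2 * t) * ∫ τ in (0:ℝ)..t, ex (1 / 2 * k ^ 2 * τ) * (F (ψ' 0 τ) - F (ψ 0 τ))) := by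
      rw [h1, h2, e]; ring
    rw [e2]
    refine (norm_sub_le _ _).trans (le_of_eq ?_)
    rw [norm_mul, norm_mul, norm_mul, norm_ex, norm_ex, norm_inv, norm_om, inv_one, one_mul, one_mul, one_mul]) hkey
  refine hsplit.trans ?_
  have hPL : (L * (K * η)) ^ 2 ≤ L ^ 2 := by
    have : 0 ≤ K * η := by positivity
    rw [mul_pow]
    have : (K * η) ^ 2 ≤ 1 := by nlinarith
    nlinarith [sq_nonneg L]
  have hlast : 640 * π * (2 * (L * (K * η)) ^ 2 + 4 * C) / R ≤ δ ^ 2 / 4 := by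
    have : 640 * π * (2 * (L * (K * η)) ^ 2 + 4 * C) / R ≤ 640 * π * (2 * L ^ 2 + 4 * C) / R := by gcongr
    have e : 2560 * π * (2 * L ^ 2 + 4 * C) / R = 4 * (640 * π * (2 * L ^ 2 + 4 * C) / R) := by ring
    linarith
  have hq : Q * η ^ 2 = 2 * (3 * η) ^ 2 + 2 * (2 * R * ((1 + R ^ 2) * (T * (L * (K * η))) ^ 2)) := by
    rw [hQ]; ring
  linarith

/-- **Continuity of the solution map.**
For every `T > 0` the map `𝒰 : φ ↦ ψ`, taking the initial data `φ ∈ H¹(ℝ)` to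
the solution `ψ` of the Duhamel equation, is continuous from `H¹(ℝ)` to
`L^∞([0,T], H¹(ℝ))`. -/
theorem solution_map_continuous
    (U : ℂ → ℝ) (u : ℝ → ℝ) (A B : ℝ)
    (hU : ContDiff ℝ 2 U)
    (hUinv : ∀ z : ℂ, U z = u (‖z‖ ^ 2))
    (hB : 0 < B)
    (hAB : ∀ z : ℂ, A - B * ‖z‖ ^ 2 ≤ U z)
    (T : ℝ) (hT : 0 < T) :
    ∀ (φ : H1) (ψ : ℝ → ℝ → ℂ) (Ψ : ℝ → H1),
      CbOn ψ Set.univ → IsDuhamelSolution (nonlin U) φ ψ Set.univ →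
      (∀ t x : ℝ, (Ψ t).toFun x = ψ x t) → H1.ContOn Ψ Set.univ →
      ∀ δ > (0 : ℝ), ∃ η > (0 : ℝ),
        ∀ (φ' : H1) (ψ' : ℝ → ℝ → ℂ) (Ψ' : ℝ → H1),
          CbOn ψ' Set.univ → IsDuhamelSolution (nonlin U) φ' ψ' Set.univ →
          (∀ t x : ℝ, (Ψ' t).toFun x = ψ' x t) → H1.ContOn Ψ' Set.univ →
          H1.dist φ' φ < η →
          ∀ t ∈ Set.Icc (0 : ℝ) T, H1.dist (Ψ' t) (Ψ t) < δ := by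
  intro φ ψ Ψ hc hd hΨ _ δ hδ
  obtain ⟨η, hη, h⟩ := main_aux hU T hT φ ψ Ψ hc hd hΨ δ hδ
  exact ⟨η, hη, fun φ' ψ' Ψ' hc' hd' hΨ' _ hdist => h φ' ψ' Ψ' hc' hd' hΨ' hdist⟩

end SNLS
end
end

section
/- Local well-posedness of the regularized equation: Assume U ∈ C²(ℂ;ℝ), U(ψ) = u(|ψ|²), and U_k := sup_{z∈ℂ}|∇^kU(z)| < ∞ for k = 0,1,2 with U₂ > 0. For ε ∈ (0,1) set τ_ε = 1/(4U₂‖ρ_ε‖_{H¹}). Then for every φ ∈ H¹(ℝ) there exists a unique ψ_ε ∈ C([0,τ_ε], H¹(ℝ)) satisfying the regularized Duhamel equation ψ_ε(t) = W_tφ − ∫_0^t W_s[ρ_ε · F(⟨ρ_ε, ψ_ε(t−s)⟩)] ds for all t ∈ [0,τ_ε]. -/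
/-!  Common framework for the Schrödinger equation coupled to a nonlinear
oscillator (point nonlinearity), following Komech–Komech.

The Sobolev space `H¹(ℝ)` is described through the Fourier side: an element
of `H¹(ℝ)` is (identified with) a measurable function `hat : ℝ → ℂ`
(its Fourier transform, nonunitary convention `φ̂(k) = ∫ e^{-ikx} φ(x) dx`)
such that `(1+k²)^{1/2} φ̂ ∈ L²(ℝ)`.  Since `φ̂ ∈ L¹`, the continuous
representative `φ(x) = (2π)⁻¹ ∫ e^{ikx} φ̂(k) dk` is defined pointwise, so
`φ(0)` makes sense.  Plancherel gives `‖φ‖²_{L²} = (2π)⁻¹∫|φ̂|²` and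
`‖φ'‖²_{L²} = (2π)⁻¹∫ k²|φ̂|²`. -/

noncomputable section

open MeasureTheory Real Set

namespace SNLS

open Filter Topology

lemma norm_e (r : ℝ) : ‖Complex.exp (Complex.I * (r : ℂ))‖ = 1 := by
  rw [mul_comm]; exact Complex.norm_exp_ofReal_mul_I r

/-- Volterra operator in exponentially weighted form. -/
def volt (lam : ℝ) (a K : ℝ → ℂ) (F : ℂ → ℂ) (y : ℝ → ℂ) (t : ℝ) : ℂ :=
  (Real.exp (-lam * t) : ℂ) *
    (a t - ∫ s in (0 : ℝ)..t, K s * F ((Real.exp (lam * (t - s)) : ℂ) * y (t - s)))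

lemma volt_cont (lam : ℝ) {a K : ℝ → ℂ} {F : ℂ → ℂ} {y : ℝ → ℂ}
    (ha : Continuous a) (hK : Continuous K) (hF : Continuous F) (hy : Continuous y) :
    Continuous (volt lam a K F y) := by
  unfold volt
  refine Continuous.mul (by fun_prop) (ha.sub ?_)
  apply intervalIntegral.continuous_parametric_intervalIntegral_of_continuous _ continuous_id
  simp only [Function.uncurry_def]
  fun_prop

lemma volt_diff {lam : ℝ} {a K : ℝ → ℂ} {F : ℂ → ℂ} {y y' : ℝ → ℂ} {M L D : ℝ}
    (hlam : lam = 2 * (M * L) + 1)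
    (hK : Continuous K) (hF : Continuous F) (hy : Continuous y) (hy' : Continuous y')
    (hM0 : 0 ≤ M) (hL0 : 0 ≤ L) (hD : 0 ≤ D)
    (hM : ∀ s, ‖K s‖ ≤ M) (hL : ∀ z w, ‖F z - F w‖ ≤ L * ‖z - w‖)
    (t : ℝ) (ht : 0 ≤ t) (h : ∀ s ∈ Icc 0 t, ‖y s - y' s‖ ≤ D) :
    ‖volt lam a K F y t - volt lam a K F y' t‖ ≤ (1 / 2) * D := by
  have hML : 0 ≤ M * L := mul_nonneg hM0 hL0
  have hlam0 : 0 < lam := by rw [hlam]; positivity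
  have hi : ∀ w : ℝ → ℂ, Continuous w → IntervalIntegrable
      (fun s => K s * F ((Real.exp (lam * (t - s)) : ℂ) * w (t - s))) volume 0 t := by
    intro w hw
    apply Continuous.intervalIntegrable
    fun_prop
  have e1 : volt lam a K F y t - volt lam a K F y' t =
      ∫ s in (0 : ℝ)..t, (Real.exp (-lam * t) : ℂ) *
        (K s * (F ((Real.exp (lam * (t - s)) : ℂ) * y' (t - s)) -
          F ((Real.exp (lam * (t - s)) : ℂ) * y (t - s)))) := by
    rw [intervalIntegral.integral_const_mul]
    simp only [mul_sub (K _)]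
    rw [intervalIntegral.integral_sub (hi y' hy') (hi y hy)]
    unfold volt
    ring
  rw [e1]
  have e2 : ∫ s in (0 : ℝ)..t, M * L * D * Real.exp (-lam * s) =
      M * L * D * ((1 - Real.exp (-lam * t)) / lam) := by
    rw [intervalIntegral.integral_const_mul, intervalIntegral.integral_comp_mul_left (fun x => Real.exp x) (neg_ne_zero.mpr hlam0.ne')]
    rw [integral_exp]
    simp
    field_simp
    ring_nf
  have e3 := intervalIntegral.norm_integral_le_of_norm_le ht
    (f := fun s => (Real.exp (-lam * t) : ℂ) *
        (K s * (F ((Real.exp (lam * (t - s)) : ℂ) * y' (t - s)) -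
          F ((Real.exp (lam * (t - s)) : ℂ) * y (t - s)))))
    (g := fun s => M * L * D * Real.exp (-lam * s)) (μ := volume)
    (by
      refine Filter.Eventually.of_forall fun s hs => ?_
      have h1 : ‖y' (t - s) - y (t - s)‖ ≤ D := by
        rw [norm_sub_rev]
        exact h _ ⟨by linarith [hs.2], by linarith [hs.1]⟩
      have h2 := hL ((Real.exp (lam * (t - s)) : ℂ) * y' (t - s))
        ((Real.exp (lam * (t - s)) : ℂ) * y (t - s))
      rw [← mul_sub, norm_mul, Complex.norm_real, Real.norm_of_nonneg (Real.exp_pos _).le] at h2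
      rw [norm_mul, norm_mul, Complex.norm_real,
        Real.norm_of_nonneg (Real.exp_pos _).le]
      have h3 : Real.exp (-lam * s) = Real.exp (-lam * t) * Real.exp (lam * (t - s)) := by
        rw [← Real.exp_add]; congr 1; ring
      rw [h3]
      calc _ ≤ Real.exp (-lam * t) * (M * (L * (Real.exp (lam * (t - s)) * D))) := by
            gcongr
            · exact hM s
            · exact h2.trans (by gcongr)
        _ = _ := by ring)
    (by apply Continuous.intervalIntegrable; fun_prop)
  refine e3.trans ?_
  rw [e2]
  have h4 : (1 - Real.exp (-lam * t)) / lam ≤ 1 / lam := by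
    gcongr; linarith [Real.exp_pos (-lam * t)]
  have h5 : M * L * (1 / lam) ≤ 1 / 2 := by
    rw [mul_one_div, div_le_div_iff₀ hlam0 two_pos, hlam]; linarith
  calc _ ≤ M * L * D * (1 / lam) := by gcongr
    _ = M * L * (1 / lam) * D := by ring
    _ ≤ _ := by gcongr

lemma volterra {a K : ℝ → ℂ} {F : ℂ → ℂ} {M L τ : ℝ}
    (ha : Continuous a) (hK : Continuous K) (hF : Continuous F)
    (hM0 : 0 ≤ M) (hL0 : 0 ≤ L) (hτ : 0 ≤ τ)
    (hM : ∀ s, ‖K s‖ ≤ M) (hL : ∀ z w, ‖F z - F w‖ ≤ L * ‖z - w‖) :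
    ∃ z : ℝ → ℂ, Continuous z ∧
      (∀ t ∈ Icc 0 τ, z t = a t - ∫ s in (0 : ℝ)..t, K s * F (z (t - s))) ∧
      ∀ z' : ℝ → ℂ, Continuous z' →
        (∀ t ∈ Icc 0 τ, z' t = a t - ∫ s in (0 : ℝ)..t, K s * F (z' (t - s))) →
        ∀ t ∈ Icc 0 τ, z' t = z t := by
  set lam : ℝ := 2 * (M * L) + 1 with hlam
  let T : C(Icc 0 τ, ℂ) → C(Icc 0 τ, ℂ) := fun y =>
    ⟨fun t => volt lam a K F (IccExtend hτ y) t,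
      (volt_cont lam ha hK hF (y.continuous.Icc_extend' )).comp continuous_subtype_val⟩
  have hT : ContractingWith (1 / 2) T := by
    refine ⟨by norm_num, LipschitzWith.of_dist_le_mul fun y y' => ?_⟩
    rw [ContinuousMap.dist_le (by positivity)]
    intro t
    rw [dist_eq_norm]
    have := volt_diff (a := a) (y := IccExtend hτ y) (y' := IccExtend hτ y') (D := dist y y')
      hlam hK hF (y.continuous.Icc_extend') (y'.continuous.Icc_extend') hM0 hL0 dist_nonneg hM hL
      t t.2.1 (fun s _ => by
        rw [← dist_eq_norm]
        exact ContinuousMap.dist_apply_le_dist _)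
    simpa [T] using this
  have : Nonempty C(Icc 0 τ, ℂ) := ⟨0⟩
  set y := hT.fixedPoint
  have hy : T y = y := hT.fixedPoint_isFixedPt
  have hexp : ∀ t : ℝ, (Real.exp (lam * t) : ℂ) * (Real.exp (-lam * t) : ℂ) = 1 := by
    intro t
    rw [← Complex.ofReal_mul, ← Real.exp_add]; simp
  refine ⟨fun t => (Real.exp (lam * t) : ℂ) * IccExtend hτ y t, ?_, ?_, ?_⟩
  · have := y.continuous.Icc_extend' (h := hτ)
    fun_prop
  · intro t ht
    have h1 : IccExtend hτ y t = volt lam a K F (IccExtend hτ y) t := by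
      rw [IccExtend_of_mem _ _ ht]
      conv_lhs => rw [← hy]
      rfl
    simp only
    rw [h1]
    unfold volt
    rw [← mul_assoc, hexp, one_mul]
  · intro z' hz' hz t ht
    let y' : C(Icc 0 τ, ℂ) := ⟨fun t => (Real.exp (-lam * t) : ℂ) * z' t, by fun_prop⟩
    have hy' : T y' = y' := by
      ext ⟨t, ht⟩
      change volt lam a K F (IccExtend hτ y') t = (Real.exp (-lam * t) : ℂ) * z' t
      unfold volt
      congr 1
      rw [hz t ht]
      congr 1
      apply intervalIntegral.integral_congr
      intro s hs
      rw [uIcc_of_le ht.1] at hs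
      have hm : t - s ∈ Icc 0 τ := ⟨by linarith [hs.2], by linarith [hs.1, ht.2]⟩
      simp only
      rw [IccExtend_of_mem _ _ hm]
      congr 2
      change (Real.exp (lam * (t - s)) : ℂ) * ((Real.exp (-lam * (t - s)) : ℂ) * z' (t - s)) = _
      rw [← mul_assoc, hexp, one_mul]
    have h2 : y' = y := hT.fixedPoint_unique hy'
    have h3 : IccExtend hτ y t = (Real.exp (-lam * t) : ℂ) * z' t := by
      rw [← h2, IccExtend_of_mem _ _ ht]; rfl
    simp only
    rw [h3, ← mul_assoc, hexp, one_mul]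

lemma hatG {g : ℝ → ℝ} (hg : ContDiff ℝ (⊤ : ℕ∞) g) (hc : HasCompactSupport g) :
    Continuous (fourierHatR g) ∧ ∃ C, 0 ≤ C ∧ ∀ k, (1 + k ^ 2) * ‖fourierHatR g k‖ ≤ C := by
  let S : SchwartzMap ℝ ℂ := HasCompactSupport.toSchwartzMap (f := fun x => (g x : ℂ))
    (hc.comp_left (g := fun r : ℝ => (r : ℂ)) (by simp)) (Complex.ofRealCLM.contDiff.comp hg)
  let T : SchwartzMap ℝ ℂ := FourierTransform.fourier S
  have h : ∀ k, fourierHatR g k = T ((2 * π)⁻¹ * k) := by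
    intro k
    change _ = (FourierTransform.fourier S : SchwartzMap ℝ ℂ) _
    rw [SchwartzMap.fourier_coe, Real.fourier_real_eq_integral_exp_smul]
    unfold fourierHatR
    congr 1
    ext x
    rw [smul_eq_mul]
    congr 2
    push_cast
    have : (π : ℂ) ≠ 0 := by exact_mod_cast Real.pi_ne_zero
    field_simp
  have h' : fourierHatR g = fun k => T ((2 * π)⁻¹ * k) := funext h
  refine ⟨by rw [h']; exact T.continuous.comp (by fun_prop), ?_⟩
  obtain ⟨C0, hC0⟩ := T.decay 0 0
  obtain ⟨C2, hC2⟩ := T.decay 2 0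
  refine ⟨C0 + (2 * π) ^ 2 * C2, by have := hC0.1; have := hC2.1; positivity, fun k => ?_⟩
  rw [h]
  have h0 := hC0.2 ((2 * π)⁻¹ * k)
  have h2 := hC2.2 ((2 * π)⁻¹ * k)
  simp only [norm_iteratedFDeriv_zero, pow_zero, one_mul] at h0 h2
  rw [add_mul, one_mul]
  refine add_le_add h0 ?_
  have : k ^ 2 = (2 * π) ^ 2 * ‖(2 * π)⁻¹ * k‖ ^ 2 := by
    rw [Real.norm_eq_abs, sq_abs]
    have := Real.pi_ne_zero
    field_simp
  rw [this, mul_assoc]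
  gcongr

lemma hat_integrable (φ : H1) : Integrable φ.hat := by
  refine (φ.finite.add integrable_inv_one_add_sq).mono' φ.meas (Eventually.of_forall fun k => ?_)
  simp only [Pi.add_apply]
  have hp : (0 : ℝ) < 1 + k ^ 2 := by positivity
  have h1 : ((1 + k ^ 2) * ‖φ.hat k‖) ^ 2 - (1 + k ^ 2) * ‖φ.hat k‖ + 1 ≥ 0 := by
    nlinarith [sq_nonneg ((1 + k ^ 2) * ‖φ.hat k‖ - 1/2)]
  have : (1 + k ^ 2) * ‖φ.hat k‖ ^ 2 + (1 + k ^ 2)⁻¹ - ‖φ.hat k‖ =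
    (((1 + k ^ 2) * ‖φ.hat k‖) ^ 2 - (1 + k ^ 2) * ‖φ.hat k‖ + 1) / (1 + k ^ 2) := by
    field_simp
    ring
  have := div_nonneg h1 hp.le
  linarith

lemma pair_eq {g : ℝ → ℝ} (hg : Continuous g) (hc : HasCompactSupport g) (φ : H1) :
    pair g φ.toFun = (2 * π)⁻¹ * ∫ k, φ.hat k * fourierHatR g (-k) := by
  have hgi : Integrable (fun x => (g x : ℂ)) := (hg.integrable_of_hasCompactSupport hc).ofReal
  have hφ := hat_integrable φ
  unfold pair H1.toFun
  have e1 : ∀ x : ℝ, (g x : ℂ) * ((2 * π)⁻¹ * ∫ k : ℝ, Complex.exp (Complex.I * ((k * x : ℝ) : ℂ)) * φ.hat k)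
      = (2 * π)⁻¹ * ∫ k : ℝ, (g x : ℂ) * (Complex.exp (Complex.I * ((k * x : ℝ) : ℂ)) * φ.hat k) := by
    intro x
    rw [integral_const_mul]; ring
  simp_rw [e1]
  rw [integral_const_mul, integral_integral_swap]
  · congr 2
    ext k
    unfold fourierHatR
    rw [← integral_const_mul]
    congr 1
    ext x
    have : -(Complex.I * ((-k * x : ℝ) : ℂ)) = Complex.I * ((k * x : ℝ) : ℂ) := by
      push_cast; ring
    rw [this]; ring
  · have h := hgi.mul_prod hφ
    refine h.norm.mono' ?_ (Eventually.of_forall fun p => ?_)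
    · simp only [Function.uncurry_def]
      refine AEStronglyMeasurable.mul (by fun_prop) (AEStronglyMeasurable.mul (by fun_prop) ?_)
      exact hφ.1.comp_snd
    · simp only [Function.uncurry_def]
      rw [norm_mul, norm_mul, norm_e, one_mul, norm_mul]

/-- Fourier transform of the Duhamel right-hand side. -/
def hatF (φ : H1) (G f : ℝ → ℂ) (t k : ℝ) : ℂ :=
  Complex.exp (Complex.I * ((k ^ 2 * t : ℝ) : ℂ)) * φ.hat k -
    ∫ s in (0 : ℝ)..t, Complex.exp (Complex.I * ((k ^ 2 * s : ℝ) : ℂ)) * G k * f (t - s)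

section
variable {φ : H1} {G f : ℝ → ℂ} {C M : ℝ}

lemma duh_bound (hM : ∀ s, ‖f s‖ ≤ M) (t k : ℝ) :
    ‖∫ s in (0 : ℝ)..t, Complex.exp (Complex.I * ((k ^ 2 * s : ℝ) : ℂ)) * G k * f (t - s)‖
      ≤ ‖G k‖ * M * |t| := by
  have := intervalIntegral.norm_integral_le_of_norm_le_const (a := 0) (b := t) (C := ‖G k‖ * M)
    (f := fun s => Complex.exp (Complex.I * ((k ^ 2 * s : ℝ) : ℂ)) * G k * f (t - s))
    (fun s _ => by
      rw [norm_mul, norm_mul, norm_e, one_mul]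
      gcongr
      exact hM _)
  simpa using this

lemma hatF_cont_t (hf : Continuous f) (k : ℝ) : Continuous (fun t => hatF φ G f t k) := by
  unfold hatF
  refine Continuous.sub (by fun_prop) ?_
  apply intervalIntegral.continuous_parametric_intervalIntegral_of_continuous _ continuous_id
  simp only [Function.uncurry_def]
  fun_prop

lemma duh_cont_k (hG : Continuous G) (hf : Continuous f) (t : ℝ) :
    Continuous (fun k => ∫ s in (0 : ℝ)..t,
      Complex.exp (Complex.I * ((k ^ 2 * s : ℝ) : ℂ)) * G k * f (t - s)) := by
  apply intervalIntegral.continuous_parametric_intervalIntegral_of_continuous'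
  simp only [Function.uncurry_def]
  fun_prop

lemma hatF_meas (hG : Continuous G) (hf : Continuous f) (t : ℝ) :
    AEStronglyMeasurable (hatF φ G f t) volume := by
  unfold hatF
  refine AEStronglyMeasurable.sub (AEStronglyMeasurable.mul ?_ φ.meas) ?_
  · exact Continuous.aestronglyMeasurable (by fun_prop)
  · exact (duh_cont_k hG hf t).aestronglyMeasurable

/-- dominating function -/
def bnd (φ : H1) (B : ℝ) (k : ℝ) : ℝ :=
  2 * ((1 + k ^ 2) * ‖φ.hat k‖ ^ 2) + 2 * (B * (1 + k ^ 2)⁻¹)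

lemma bnd_int (φ : H1) (B : ℝ) : Integrable (bnd φ B) :=
  (φ.finite.const_mul 2).add ((integrable_inv_one_add_sq.const_mul B).const_mul 2)

lemma hatF_bound (hC : ∀ k, (1 + k ^ 2) * ‖G k‖ ≤ C) (hM : ∀ s, ‖f s‖ ≤ M)
    {t R : ℝ} (ht : |t| ≤ R) (k : ℝ) :
    (1 + k ^ 2) * ‖hatF φ G f t k‖ ^ 2 ≤ bnd φ ((C * M * R) ^ 2) k := by
  have hp : (0 : ℝ) < 1 + k ^ 2 := by positivity
  have hM0 : 0 ≤ M := (norm_nonneg _).trans (hM 0)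
  have hG : ‖G k‖ ≤ C * (1 + k ^ 2)⁻¹ := by
    rw [← div_eq_mul_inv, le_div_iff₀ hp, mul_comm]; exact hC k
  have h1 : ‖hatF φ G f t k‖ ≤ ‖φ.hat k‖ + C * (1 + k ^ 2)⁻¹ * M * R := by
    unfold hatF
    refine (norm_sub_le _ _).trans ?_
    rw [norm_mul, norm_e, one_mul]
    gcongr
    refine (duh_bound hM t k).trans ?_
    have : 0 ≤ C * (1 + k ^ 2)⁻¹ := (norm_nonneg _).trans hG
    gcongr
  have h2 : ‖hatF φ G f t k‖ ^ 2 ≤ 2 * ‖φ.hat k‖ ^ 2 + 2 * (C * (1 + k ^ 2)⁻¹ * M * R) ^ 2 := by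
    refine (pow_le_pow_left₀ (norm_nonneg _) h1 2).trans ?_
    nlinarith [sq_nonneg (‖φ.hat k‖ - C * (1 + k ^ 2)⁻¹ * M * R)]
  refine (mul_le_mul_of_nonneg_left h2 hp.le).trans (le_of_eq ?_)
  unfold bnd
  field_simp

/-- Duhamel right-hand side as an element of `H1`. -/
def mkPsi (φ : H1) (G f : ℝ → ℂ) (C M : ℝ) (hG : Continuous G) (hf : Continuous f)
    (hC : ∀ k, (1 + k ^ 2) * ‖G k‖ ≤ C) (hM : ∀ s, ‖f s‖ ≤ M) (t : ℝ) : H1 where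
  hat := hatF φ G f t
  meas := hatF_meas hG hf t
  finite := by
    refine (bnd_int φ ((C * M * |t|) ^ 2)).mono' ?_ (Eventually.of_forall fun k => ?_)
    · exact AEStronglyMeasurable.mul (Continuous.aestronglyMeasurable (by fun_prop))
        ((hatF_meas hG hf t).norm.pow 2)
    · rw [Real.norm_of_nonneg (by positivity)]
      exact hatF_bound hC hM le_rfl k

lemma mkPsi_cont (hG : Continuous G) (hf : Continuous f)
    (hC : ∀ k, (1 + k ^ 2) * ‖G k‖ ≤ C) (hM : ∀ s, ‖f s‖ ≤ M) (S : Set ℝ) :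
    H1.ContOn (mkPsi φ G f C M hG hf hC hM) S := by
  intro t₀ _ δ hδ
  have hcont : ContinuousAt (fun t => ∫ k : ℝ, (1 + k ^ 2) *
      ‖hatF φ G f t k - hatF φ G f t₀ k‖ ^ 2) t₀ := by
    refine continuousAt_of_dominated (bound := fun k => 4 * bnd φ ((C * M * (|t₀| + 1)) ^ 2) k)
      (Eventually.of_forall fun t => ?_) ?_ ((bnd_int _ _).const_mul 4)
      (Eventually.of_forall fun k => ?_)
    · exact AEStronglyMeasurable.mul (Continuous.aestronglyMeasurable (by fun_prop))
        (((hatF_meas hG hf t).sub (hatF_meas hG hf t₀)).norm.pow 2)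
    · filter_upwards [Metric.ball_mem_nhds t₀ one_pos] with t ht
      have ht' : |t| ≤ |t₀| + 1 := by
        rw [Metric.mem_ball, Real.dist_eq] at ht
        have := abs_sub_abs_le_abs_sub t t₀
        linarith
      refine Eventually.of_forall fun k => ?_
      rw [Real.norm_of_nonneg (by positivity)]
      have h1 := hatF_bound (φ := φ) hC hM ht' k
      have h2 := hatF_bound (φ := φ) hC hM (by linarith : |t₀| ≤ |t₀| + 1) k
      have h3 : ‖hatF φ G f t k - hatF φ G f t₀ k‖ ^ 2 ≤
          2 * ‖hatF φ G f t k‖ ^ 2 + 2 * ‖hatF φ G f t₀ k‖ ^ 2 := by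
        refine (pow_le_pow_left₀ (norm_nonneg _) (norm_sub_le _ _) 2).trans ?_
        nlinarith [sq_nonneg (‖hatF φ G f t k‖ - ‖hatF φ G f t₀ k‖)]
      have hp : (0 : ℝ) ≤ 1 + k ^ 2 := by positivity
      have := mul_le_mul_of_nonneg_left h3 hp
      linarith
    · have := hatF_cont_t (φ := φ) (G := G) hf k
      exact Continuous.continuousAt (by fun_prop)
  have hd : ContinuousAt (fun t => H1.dist (mkPsi φ G f C M hG hf hC hM t)
      (mkPsi φ G f C M hG hf hC hM t₀)) t₀ :=
    (continuousAt_const.mul hcont).sqrt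
  have h0 : H1.dist (mkPsi φ G f C M hG hf hC hM t₀) (mkPsi φ G f C M hG hf hC hM t₀) = 0 := by
    simp [H1.dist]
  obtain ⟨η, hη, h⟩ := Metric.continuousAt_iff.1 hd δ hδ
  refine ⟨η, hη, fun t _ ht => ?_⟩
  have := h (x := t) (by rwa [Real.dist_eq])
  rw [h0, Real.dist_eq, sub_zero] at this
  exact (le_abs_self _).trans_lt this

lemma G_bdd (hC : ∀ k, (1 + k ^ 2) * ‖G k‖ ≤ C) (k : ℝ) : ‖G k‖ ≤ C := by
  nlinarith [hC k, mul_nonneg (sq_nonneg k) (norm_nonneg (G k))]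

lemma G_int (hG : Continuous G) (hC : ∀ k, (1 + k ^ 2) * ‖G k‖ ≤ C) : Integrable G := by
  refine (integrable_inv_one_add_sq.const_mul C).mono' hG.aestronglyMeasurable
    (Eventually.of_forall fun k => ?_)
  have hp : (0 : ℝ) < 1 + k ^ 2 := by positivity
  rw [← div_eq_mul_inv, le_div_iff₀ hp, mul_comm]; exact hC k

/-- Free part and kernel of the scalar equation: `(2π)⁻¹ ∫ e^{ik²t} h(k) G(-k) dk`. -/
def ker (h G : ℝ → ℂ) (t : ℝ) : ℂ :=
  (2 * (π : ℂ))⁻¹ * ∫ k : ℝ, Complex.exp (Complex.I * ((k ^ 2 * t : ℝ) : ℂ)) * (h k * G (-k))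

lemma hG_int {h : ℝ → ℂ} (hh : Integrable h) (hG : Continuous G)
    (hC : ∀ k, (1 + k ^ 2) * ‖G k‖ ≤ C) : Integrable (fun k => h k * G (-k)) := by
  refine hh.mul_bdd (c := C) (Continuous.aestronglyMeasurable (by fun_prop))
    (Eventually.of_forall fun k => G_bdd hC _)

lemma ehG_int {h : ℝ → ℂ} (hh : Integrable h) (hG : Continuous G)
    (hC : ∀ k, (1 + k ^ 2) * ‖G k‖ ≤ C) (t : ℝ) : Integrable (fun k : ℝ =>
      Complex.exp (Complex.I * ((k ^ 2 * t : ℝ) : ℂ)) * (h k * G (-k))) := by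
  refine (hG_int hh hG hC).bdd_mul (c := 1) (Continuous.aestronglyMeasurable (by fun_prop))
    (Eventually.of_forall fun k => (norm_e _).le)

lemma ker_cont {h : ℝ → ℂ} (hh : Integrable h) (hG : Continuous G)
    (hC : ∀ k, (1 + k ^ 2) * ‖G k‖ ≤ C) : Continuous (ker h G) := by
  unfold ker
  refine continuous_const.mul ?_
  refine continuous_of_dominated (bound := fun k => ‖h k * G (-k)‖)
    (fun t => (ehG_int hh hG hC t).1) (fun t => Eventually.of_forall fun k => ?_)
    (hG_int hh hG hC).norm (Eventually.of_forall fun k => by fun_prop)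
  rw [norm_mul, norm_e, one_mul]

lemma ker_bdd (h G : ℝ → ℂ) : ∃ B, 0 ≤ B ∧ ∀ t, ‖ker h G t‖ ≤ B := by
  refine ⟨‖((2 * π)⁻¹ : ℂ)‖ * ∫ k, ‖h k * G (-k)‖, by positivity, fun t => ?_⟩
  unfold ker
  rw [norm_mul]
  gcongr
  · refine (norm_integral_le_integral_norm _).trans (le_of_eq ?_)
    congr 1
    ext k
    rw [norm_mul, norm_e, one_mul]

lemma ker_duhamel (hG : Continuous G) (hf : Continuous f)
    (hC : ∀ k, (1 + k ^ 2) * ‖G k‖ ≤ C) (hM : ∀ s, ‖f s‖ ≤ M) (t : ℝ) (ht : 0 ≤ t) :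
    (2 * (π : ℂ))⁻¹ * ∫ k : ℝ, hatF φ G f t k * G (-k) =
      ker φ.hat G t - ∫ s in (0 : ℝ)..t, ker G G s * f (t - s) := by
  have hM0 : 0 ≤ M := (norm_nonneg _).trans (hM 0)
  have hGi := G_int hG hC
  have hGG := hG_int hGi hG hC
  have i2 : Integrable (fun k => (∫ s in (0 : ℝ)..t,
      Complex.exp (Complex.I * ((k ^ 2 * s : ℝ) : ℂ)) * G k * f (t - s)) * G (-k)) := by
    refine (hGG.norm.const_mul (M * |t|)).mono' ?_ (Eventually.of_forall fun k => ?_)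
    · exact ((duh_cont_k hG hf t).mul (by fun_prop)).aestronglyMeasurable
    · rw [norm_mul, norm_mul]
      calc _ ≤ ‖G k‖ * M * |t| * ‖G (-k)‖ := by gcongr; exact duh_bound hM t k
        _ = _ := by ring
  have e1 : ∫ k : ℝ, hatF φ G f t k * G (-k) =
      (∫ k : ℝ, Complex.exp (Complex.I * ((k ^ 2 * t : ℝ) : ℂ)) * (φ.hat k * G (-k))) -
      ∫ k : ℝ, (∫ s in (0 : ℝ)..t,
      Complex.exp (Complex.I * ((k ^ 2 * s : ℝ) : ℂ)) * G k * f (t - s)) * G (-k) := by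
    rw [← integral_sub (ehG_int (hat_integrable φ) hG hC t) i2]
    congr 1
    ext k
    unfold hatF
    ring
  rw [e1, mul_sub]
  unfold ker
  congr 1
  simp_rw [mul_assoc ((2 * π : ℂ)⁻¹), intervalIntegral.integral_of_le ht]
  have e2 : ∀ s, (2 * (π : ℂ))⁻¹ * ((∫ k : ℝ, Complex.exp (Complex.I * ((k ^ 2 * s : ℝ) : ℂ)) *
      (G k * G (-k))) * f (t - s)) = (2 * (π : ℂ))⁻¹ * ∫ k : ℝ,
      Complex.exp (Complex.I * ((k ^ 2 * s : ℝ) : ℂ)) * (G k * G (-k)) * f (t - s) := by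
    intro s
    rw [integral_mul_const]
  simp_rw [e2]
  rw [integral_const_mul]
  congr 1
  simp_rw [← integral_mul_const]
  rw [integral_integral_swap]
  · congr 1
    ext s
    congr 1
    ext k
    ring
  · have hm : Integrable (fun _ : ℝ => M) (volume.restrict (Ioc 0 t)) := integrable_const _
    refine (hGG.norm.mul_prod hm).mono' ?_ (Eventually.of_forall fun p => ?_)
    · refine Continuous.aestronglyMeasurable ?_
      simp only [Function.uncurry_def]
      fun_prop
    · simp only [Function.uncurry_def]
      have := norm_e (p.1 ^ 2 * p.2)
      rw [norm_mul, norm_mul, norm_mul, this, one_mul, norm_mul]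
      calc _ ≤ ‖G p.1‖ * M * ‖G (-p.1)‖ := by gcongr; exact hM _
        _ = _ := by ring

lemma pairing_cont {Ψ : ℝ → H1} {S : Set ℝ} (hΨ : H1.ContOn Ψ S) (hG : Continuous G)
    (hC : ∀ k, (1 + k ^ 2) * ‖G k‖ ≤ C) :
    ContinuousOn (fun t => (2 * (π : ℂ))⁻¹ * ∫ k, (Ψ t).hat k * G (-k)) S := by
  refine continuousOn_const.mul ?_
  rw [Metric.continuousOn_iff]
  intro t₀ ht₀ δ hδ
  set I0 : ℝ := ∫ k : ℝ, (1 + k ^ 2)⁻¹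
  have hI0 : 0 ≤ I0 := integral_nonneg fun k => by positivity
  set B : ℝ := 2 * π + C ^ 2 * I0 + 1 with hB
  have hB0 : 0 < B := by have := Real.pi_pos; positivity
  set η := δ / B
  have hη : 0 < η := by positivity
  obtain ⟨r, hr, h⟩ := hΨ t₀ ht₀ η hη
  refine ⟨r, hr, fun t ht htr => ?_⟩
  have hd := h t ht (by rwa [Real.dist_eq] at htr)
  set Δ : ℝ → ℂ := fun k => (Ψ t).hat k - (Ψ t₀).hat k
  have hΔm : AEStronglyMeasurable Δ volume := (Ψ t).meas.sub (Ψ t₀).meas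
  have hΔ : Integrable (fun k : ℝ => (1 + k ^ 2) * ‖Δ k‖ ^ 2) := by
    refine (((Ψ t).finite.const_mul 2).add ((Ψ t₀).finite.const_mul 2)).mono' ?_
      (Eventually.of_forall fun k => ?_)
    · exact AEStronglyMeasurable.mul (Continuous.aestronglyMeasurable (by fun_prop))
        (hΔm.norm.pow 2)
    · rw [Real.norm_of_nonneg (by positivity)]
      have h3 : ‖Δ k‖ ^ 2 ≤ 2 * ‖(Ψ t).hat k‖ ^ 2 + 2 * ‖(Ψ t₀).hat k‖ ^ 2 := by
        refine (pow_le_pow_left₀ (norm_nonneg _) (norm_sub_le _ _) 2).trans ?_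
        nlinarith [sq_nonneg (‖(Ψ t).hat k‖ - ‖(Ψ t₀).hat k‖)]
      have hp : (0 : ℝ) ≤ 1 + k ^ 2 := by positivity
      have := mul_le_mul_of_nonneg_left h3 hp
      simp only [Pi.add_apply]
      linarith
  set J : ℝ := ∫ k : ℝ, (1 + k ^ 2) * ‖Δ k‖ ^ 2
  have hJ0 : 0 ≤ J := integral_nonneg fun k => by positivity
  have hJ : J ≤ 2 * π * η ^ 2 := by
    have h1 : Real.sqrt ((2 * π)⁻¹ * J) < η := hd
    rw [Real.sqrt_lt' hη] at h1
    have : J = 2 * π * ((2 * π)⁻¹ * J) := by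
      have := Real.pi_ne_zero
      field_simp
    rw [this]
    have := Real.pi_pos
    gcongr
  rw [dist_eq_norm, ← integral_sub (hG_int (hat_integrable _) hG hC)
    (hG_int (hat_integrable _) hG hC)]
  have h5 : ‖∫ k, ((Ψ t).hat k * G (-k) - (Ψ t₀).hat k * G (-k))‖ ≤
      ∫ k : ℝ, ((1 / (2 * η)) * ((1 + k ^ 2) * ‖Δ k‖ ^ 2) + (η * C ^ 2 / 2) * (1 + k ^ 2)⁻¹) := by
    refine norm_integral_le_of_norm_le
      ((hΔ.const_mul _).add (integrable_inv_one_add_sq.const_mul _))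
      (Eventually.of_forall fun k => ?_)
    rw [← sub_mul, norm_mul]
    change ‖Δ k‖ * _ ≤ _
    have hp : (0 : ℝ) < 1 + k ^ 2 := by positivity
    have hb := G_bdd hC (-k)
    have h0 : 0 ≤ ((1 + k ^ 2) * ‖Δ k‖ - η * C) ^ 2 / (2 * η * (1 + k ^ 2)) := by positivity
    have h6 : (1 / (2 * η)) * ((1 + k ^ 2) * ‖Δ k‖ ^ 2) + (η * C ^ 2 / 2) * (1 + k ^ 2)⁻¹
        - ‖Δ k‖ * C = ((1 + k ^ 2) * ‖Δ k‖ - η * C) ^ 2 / (2 * η * (1 + k ^ 2)) := by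
      field_simp
      ring
    have h7 : ‖Δ k‖ * ‖G (-k)‖ ≤ ‖Δ k‖ * C := by gcongr
    linarith
  rw [integral_add (hΔ.const_mul _) (integrable_inv_one_add_sq.const_mul _),
    integral_const_mul, integral_const_mul] at h5
  refine h5.trans_lt ?_
  change (1 / (2 * η)) * J + (η * C ^ 2 / 2) * I0 < δ
  have h8 : (1 / (2 * η)) * J ≤ (1 / (2 * η)) * (2 * π * η ^ 2) := by gcongr
  have h9 : (1 / (2 * η)) * (2 * π * η ^ 2) = π * η := by field_simp
  have h10 : δ = η * B := by simp only [η]; field_simp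
  rw [h10, hB]
  have : 0 ≤ η * (C ^ 2 * I0) := by positivity
  nlinarith [Real.pi_pos, mul_pos Real.pi_pos hη]

end

lemma main_general {F : ℂ → ℂ} {g : ℝ → ℝ} {L M τ : ℝ} (hg : ContDiff ℝ (⊤ : ℕ∞) g)
    (hc : HasCompactSupport g) (hF : Continuous F) (hL0 : 0 ≤ L)
    (hL : ∀ z w, ‖F z - F w‖ ≤ L * ‖z - w‖) (hM : ∀ z, ‖F z‖ ≤ M) (hτ : 0 ≤ τ) (φ : H1) :
    ∃ Ψ : ℝ → H1, H1.ContOn Ψ (Icc 0 τ) ∧ IsRegularizedSolution F g φ Ψ (Icc 0 τ) ∧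
      ∀ Ψ' : ℝ → H1, H1.ContOn Ψ' (Icc 0 τ) → IsRegularizedSolution F g φ Ψ' (Icc 0 τ) →
        ∀ t ∈ Icc 0 τ, ∀ x : ℝ, (Ψ' t).toFun x = (Ψ t).toFun x := by
  obtain ⟨hG, C, hC0, hC⟩ := hatG hg hc
  set G := fourierHatR g with hGdef
  have hpair : ∀ h : H1, pair g h.toFun = (2 * (π : ℂ))⁻¹ * ∫ k, h.hat k * G (-k) := by
    intro h
    rw [pair_eq hg.continuous hc]
    push_cast
    rfl
  have ha := ker_cont (hat_integrable φ) hG hC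
  have hK := ker_cont (G_int hG hC) hG hC
  obtain ⟨B, hB0, hB⟩ := ker_bdd G G
  obtain ⟨z, hz, hzeq, huniq⟩ := volterra ha hK hF hB0 hL0 hτ hB hL
  refine ⟨mkPsi φ G (fun s => F (z s)) C M hG (hF.comp hz) hC (fun s => hM _),
    mkPsi_cont _ _ _ _ _, ?_, ?_⟩
  · intro t ht k
    change hatF φ G (fun s => F (z s)) t k = _
    unfold hatF
    congr 1
    apply intervalIntegral.integral_congr
    intro s hs
    rw [uIcc_of_le ht.1] at hs
    have hm : t - s ∈ Icc 0 τ := ⟨by linarith [hs.2], by linarith [hs.1, ht.2]⟩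
    simp only
    rw [hpair]
    change _ = _ * F (_ * ∫ k, hatF φ G (fun s => F (z s)) (t - s) k * G (-k))
    have := ker_duhamel (φ := φ) hG (hF.comp hz) hC (fun s => hM _) (t - s) hm.1
    have h2 := hzeq _ hm
    simp only [Function.comp_def] at this
    rw [this, ← h2]
  · intro Ψ' hΨ' hsol t ht x
    set w : ℝ → ℂ := fun t => pair g (Ψ' t).toFun with hw
    have hwc : ContinuousOn w (Icc 0 τ) := by
      simp only [hw, hpair]
      exact pairing_cont hΨ' hG hC
    set z' : ℝ → ℂ := IccExtend hτ ((Icc 0 τ).domRestrict w) with hz'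
    have hz'c : Continuous z' := hwc.domRestrict.Icc_extend'
    have hz'w : ∀ s ∈ Icc 0 τ, z' s = w s := fun s hs => by
      rw [hz', IccExtend_of_mem _ _ hs]; rfl
    have hhat : ∀ t ∈ Icc 0 τ, (Ψ' t).hat = hatF φ G (fun s => F (z' s)) t := by
      intro t ht
      ext k
      rw [hsol t ht k]
      unfold hatF
      congr 1
      apply intervalIntegral.integral_congr
      intro s hs
      rw [uIcc_of_le ht.1] at hs
      have hm : t - s ∈ Icc 0 τ := ⟨by linarith [hs.2], by linarith [hs.1, ht.2]⟩
      simp only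
      rw [hz'w _ hm]
    have heq : ∀ t ∈ Icc 0 τ, z' t = z t := by
      apply huniq z' hz'c
      intro t ht
      rw [hz'w t ht]
      simp only [hw, hpair]
      rw [hhat t ht]
      have := ker_duhamel (φ := φ) hG (hF.comp hz'c) hC (fun s => hM _) t ht.1
      simp only [Function.comp_def] at this
      rw [this]
    have hfin : (Ψ' t).hat = hatF φ G (fun s => F (z s)) t := by
      rw [hhat t ht]
      ext k
      unfold hatF
      congr 1
      apply intervalIntegral.integral_congr
      intro s hs
      rw [uIcc_of_le ht.1] at hs
      have hm : t - s ∈ Icc 0 τ := ⟨by linarith [hs.2], by linarith [hs.1, ht.2]⟩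
      simp only
      rw [heq _ hm]
    unfold H1.toFun
    rw [hfin]
    rfl

end SNLS
namespace SNLS

/-- **Local well-posedness of the regularized equation.**
For `ε ∈ (0,1)` and `τ_ε = 1/(4U₂‖ρ_ε‖_{H¹})`, for every `φ ∈ H¹(ℝ)` there is a
unique `ψ_ε ∈ C([0,τ_ε], H¹(ℝ))` satisfying the regularized Duhamel equation
`ψ_ε(t) = W_tφ − ∫_0^t W_s[ρ_ε · F(⟨ρ_ε, ψ_ε(t−s)⟩)] ds` on `[0,τ_ε]`. -/
theorem regularized_local_wellposedness
    (U : ℂ → ℝ) (u : ℝ → ℝ) (U₀ U₁ U₂ : ℝ)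
    (hU : ContDiff ℝ 2 U)
    (hUinv : ∀ z : ℂ, U z = u (‖z‖ ^ 2))
    (hU0 : ∀ z : ℂ, |U z| ≤ U₀)
    (hU1 : ∀ z : ℂ, ‖grad U z‖ ≤ U₁)
    (hU2 : ∀ z : ℂ, ‖fderiv ℝ (grad U) z‖ ≤ U₂)
    (hU2pos : 0 < U₂)
    (m : Mollifier) (ε : ℝ) (hε : ε ∈ Set.Ioo (0 : ℝ) 1)
    (φ : H1) :
    ∃ Ψ : ℝ → H1,
      H1.ContOn Ψ (Set.Icc 0 (1 / (4 * U₂ * h1NormFun (rho m ε)))) ∧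
      IsRegularizedSolution (nonlin U) (rho m ε) φ Ψ
        (Set.Icc 0 (1 / (4 * U₂ * h1NormFun (rho m ε)))) ∧
      ∀ Ψ' : ℝ → H1,
        H1.ContOn Ψ' (Set.Icc 0 (1 / (4 * U₂ * h1NormFun (rho m ε)))) →
        IsRegularizedSolution (nonlin U) (rho m ε) φ Ψ'
          (Set.Icc 0 (1 / (4 * U₂ * h1NormFun (rho m ε)))) →
        ∀ t ∈ Set.Icc (0 : ℝ) (1 / (4 * U₂ * h1NormFun (rho m ε))),
          ∀ x : ℝ, (Ψ' t).toFun x = (Ψ t).toFun x := by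
  have hgd : Differentiable ℝ (grad U) := by
    have h1 : ContDiff ℝ 1 (fderiv ℝ U) := hU.fderiv_right (by norm_num)
    have h2 : Differentiable ℝ (fderiv ℝ U) := h1.differentiable (by norm_num)
    have h3 : ∀ v : ℂ, Differentiable ℝ (fun z => ((fderiv ℝ U z v : ℝ) : ℂ)) := fun v =>
      Complex.ofRealCLM.differentiable.comp (h2.clm_apply (differentiable_const v))
    unfold grad
    exact (h3 1).add ((h3 Complex.I).mul_const _)
  have hL : ∀ z w, ‖nonlin U z - nonlin U w‖ ≤ U₂ * ‖z - w‖ := by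
    intro z w
    have := Convex.norm_image_sub_le_of_norm_fderiv_le (𝕜 := ℝ) (f := grad U) (C := U₂)
      (s := Set.univ) (x := z) (y := w) (fun x _ => hgd x) (fun x _ => hU2 x) convex_univ
      (Set.mem_univ _) (Set.mem_univ _)
    unfold nonlin
    rw [neg_sub_neg, norm_sub_rev z w]
    exact this
  have hF : Continuous (nonlin U) := by
    unfold nonlin
    exact hgd.continuous.neg
  have hε0 : ε ≠ 0 := hε.1.ne'
  have hg : ContDiff ℝ (⊤ : ℕ∞) (rho m ε) := by
    unfold rho
    exact contDiff_const.mul (m.smooth.comp (contDiff_id.div_const ε))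
  have hc : HasCompactSupport (rho m ε) := by
    refine HasCompactSupport.intro (isCompact_Icc (a := -ε) (b := ε)) fun x hx => ?_
    unfold rho
    rw [m.supp, mul_zero]
    intro h
    apply hx
    have h1 := h.1
    have h2 := h.2
    rw [le_div_iff₀ hε.1] at h1
    rw [div_le_iff₀ hε.1] at h2
    exact ⟨by linarith, by linarith⟩
  refine main_general hg hc hF hU2pos.le hL (M := U₁) (fun z => ?_) ?_ φ
  · unfold nonlin
    rw [norm_neg]
    exact hU1 z
  · have : 0 ≤ h1NormFun (rho m ε) := Real.sqrt_nonneg _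
    positivity

end SNLS
end
end

section
/- Weak continuity in H¹: Assume U ∈ C²(ℂ;ℝ), U(ψ) = u(|ψ|²), U(z) ≥ A − B|z|² (A ∈ ℝ, B > 0), and let ψ ∈ L^∞(ℝ, H¹(ℝ)) ∩ C_b(ℝ×ℝ;ℂ) be the solution of the Duhamel equation with data φ ∈ H¹(ℝ), with conserved charge and energy. Then t ↦ ψ(t) is weakly continuous in H¹: for every g ∈ H¹(ℝ) and every t₀ ∈ ℝ, ⟨g, ψ(t)⟩_{H¹} → ⟨g, ψ(t₀)⟩_{H¹} as t → t₀. -/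
/-!  Common framework for the Schrödinger equation coupled to a nonlinear
oscillator (point nonlinearity), following Komech–Komech.

The Sobolev space `H¹(ℝ)` is described through the Fourier side: an element
of `H¹(ℝ)` is (identified with) a measurable function `hat : ℝ → ℂ`
(its Fourier transform, nonunitary convention `φ̂(k) = ∫ e^{-ikx} φ(x) dx`)
such that `(1+k²)^{1/2} φ̂ ∈ L²(ℝ)`.  Since `φ̂ ∈ L¹`, the continuous
representative `φ(x) = (2π)⁻¹ ∫ e^{ikx} φ̂(k) dk` is defined pointwise, so
`φ(0)` makes sense.  Plancherel gives `‖φ‖²_{L²} = (2π)⁻¹∫|φ̂|²` and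
`‖φ'‖²_{L²} = (2π)⁻¹∫ k²|φ̂|²`. -/

noncomputable section

open MeasureTheory Real Set

namespace SNLS

open scoped ContDiff FourierTransform SchwartzMap InnerProductSpace

theorem ae_zero_of_fourier_zero (h : ℝ → ℂ) (hh : Integrable h volume)
    (hz : ∀ w, 𝓕 h w = 0) : ∀ᵐ x, h x = 0 := by
  apply ae_eq_zero_of_integral_contDiff_smul_eq_zero hh.locallyIntegrable
  intro g gs gc
  have hg₁ : HasCompactSupport (Complex.ofRealCLM ∘ g) := gc.comp_left rfl
  have hg₂ : ContDiff ℝ ∞ (Complex.ofRealCLM ∘ g) := by fun_prop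
  let G : 𝓢(ℝ, ℂ) := hg₁.toSchwartzMap hg₂
  let K : 𝓢(ℝ, ℂ) := 𝓕⁻ G
  have hK : 𝓕 K = G := FourierTransform.fourier_fourierInv_eq G
  have key := VectorFourier.integral_fourierIntegral_smul_eq_flip (L := innerₗ ℝ)
    (f := h) (g := (K : ℝ → ℂ)) (μ := volume) (ν := volume)
    Real.continuous_fourierChar continuous_inner hh K.integrable
  have h1 : ∀ w, VectorFourier.fourierIntegral 𝐞 volume (innerₗ ℝ) h w = 0 := hz
  have h2 : ∀ x, VectorFourier.fourierIntegral 𝐞 volume (innerₗ ℝ).flip (K : ℝ → ℂ) x = G x := by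
    intro x
    rw [flip_innerₗ, ← hK, SchwartzMap.fourier_coe]
    rfl
  simp only [h1, h2, zero_smul, integral_zero] at key
  rw [key]
  apply integral_congr_ae
  filter_upwards with x
  simp [G, mul_comm]

def wt (k : ℝ) : ℝ := Real.sqrt (1 + k ^ 2)

theorem wt_pos (k : ℝ) : 0 < wt k := Real.sqrt_pos.2 (by positivity)

theorem wt_sq (k : ℝ) : wt k ^ 2 = 1 + k ^ 2 := Real.sq_sqrt (by positivity)

theorem wt_cont : Continuous wt := by unfold wt; fun_prop

theorem memJ (φ : H1) : MemLp (fun k => (wt k : ℂ) * φ.hat k) 2 volume := by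
  rw [memLp_two_iff_integrable_sq_norm]
  · convert φ.finite using 2 with k
    rw [norm_mul, mul_pow, Complex.norm_real, Real.norm_eq_abs, sq_abs, wt_sq]
  · exact (Complex.continuous_ofReal.comp wt_cont).aestronglyMeasurable.mul φ.meas

def efun (x k : ℝ) : ℂ := Complex.exp (-(Complex.I * ((k * x : ℝ) : ℂ))) * ((wt k)⁻¹ : ℝ)

theorem norm_efun (x k : ℝ) : ‖efun x k‖ = (wt k)⁻¹ := by
  have : -(Complex.I * ((k * x : ℝ) : ℂ)) = ((-(k * x) : ℝ) : ℂ) * Complex.I := by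
    push_cast; ring
  rw [efun, norm_mul, this, Complex.norm_exp_ofReal_mul_I, Complex.norm_real, Real.norm_eq_abs,
    abs_of_pos (inv_pos.2 (wt_pos k)), one_mul]

theorem conj_efun (x k : ℝ) : starRingEnd ℂ (efun x k) =
    Complex.exp (Complex.I * ((k * x : ℝ) : ℂ)) * ((wt k)⁻¹ : ℝ) := by
  rw [efun, map_mul, ← Complex.exp_conj, Complex.conj_ofReal]
  congr 2
  simp

theorem efun_cont (x : ℝ) : Continuous (efun x) := by
  have : Continuous fun k => (wt k)⁻¹ := wt_cont.inv₀ fun k => (wt_pos k).ne'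
  unfold efun
  fun_prop

theorem memE (x : ℝ) : MemLp (efun x) 2 volume := by
  rw [memLp_two_iff_integrable_sq_norm (efun_cont x).aestronglyMeasurable]
  have h : (fun k => ‖efun x k‖ ^ 2) = fun k : ℝ => (1 + k ^ 2)⁻¹ := by
    funext k
    rw [norm_efun, inv_pow, wt_sq]
  rw [h]
  exact integrable_inv_one_add_sq

abbrev L2 := Lp ℂ 2 (volume : Measure ℝ)

def J (φ : H1) : L2 := (memJ φ).toLp _

def E (x : ℝ) : L2 := (memE x).toLp _

theorem inner_J (f g : H1) : H1.inner f g = (2 * π)⁻¹ * ⟪J f, J g⟫_ℂ := by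
  rw [H1.inner, L2.inner_def]
  congr 1
  · apply integral_congr_ae
    filter_upwards [(memJ f).coeFn_toLp, (memJ g).coeFn_toLp] with k h1 h2
    rw [J, J, h1, h2, RCLike.inner_apply, map_mul, Complex.conj_ofReal, ← wt_sq]
    push_cast
    ring

theorem inner_E (x : ℝ) (f : H1) : f.toFun x = (2 * π)⁻¹ * ⟪E x, J f⟫_ℂ := by
  rw [H1.toFun, L2.inner_def]
  congr 1
  · apply integral_congr_ae
    filter_upwards [(memE x).coeFn_toLp, (memJ f).coeFn_toLp] with k h1 h2
    have : (wt k : ℂ) ≠ 0 := by exact_mod_cast (wt_pos k).ne'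
    rw [J, E, h1, h2, RCLike.inner_apply, conj_efun]
    push_cast
    field_simp

theorem norm_J (f : H1) : ‖J f‖ ^ 2 = 2 * π * f.normSq := by
  have h := inner_self_eq_norm_sq_to_K (𝕜 := ℂ) (J f)
  rw [L2.inner_def] at h
  have h2 : ∫ k, ⟪J f k, J f k⟫_ℂ = ((∫ k : ℝ, (1 + k ^ 2) * ‖f.hat k‖ ^ 2 : ℝ) : ℂ) := by
    rw [← integral_complex_ofReal]
    apply integral_congr_ae
    filter_upwards [(memJ f).coeFn_toLp] with k h1
    rw [J, h1, inner_self_eq_norm_sq_to_K, norm_mul, Complex.norm_real, Real.norm_eq_abs,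
      abs_of_pos (wt_pos k), ← wt_sq]
    push_cast
    exact mul_pow _ _ _
  rw [h2] at h
  have h3 : (∫ k : ℝ, (1 + k ^ 2) * ‖f.hat k‖ ^ 2) = ‖J f‖ ^ 2 := by
    apply Complex.ofReal_injective
    rw [h]
    push_cast
    rfl
  rw [← h3, H1.normSq]
  field_simp

theorem dense_E : (Submodule.span ℂ (range E)).topologicalClosure = ⊤ := by
  rw [Submodule.topologicalClosure_eq_top_iff, Submodule.eq_bot_iff]
  intro h hh
  have h0 : ∀ x, ⟪E x, h⟫_ℂ = 0 := fun x =>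
    (Submodule.mem_orthogonal _ _).1 hh _ (Submodule.subset_span ⟨x, rfl⟩)
  let q : ℝ → ℂ := fun k => starRingEnd ℂ (efun 0 k) * h k
  have hq : Integrable q := MemLp.integrable_mul (memE 0).star (Lp.memLp h)
  have hz := ae_zero_of_fourier_zero q hq (by
    intro w
    rw [← h0 (-2 * π * w), L2.inner_def, Real.fourier_real_eq_integral_exp_smul]
    apply integral_congr_ae
    filter_upwards [(memE (-2 * π * w)).coeFn_toLp] with k h1
    simp only [q]
    rw [E, h1, RCLike.inner_apply, conj_efun, conj_efun, smul_eq_mul]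
    have e1 : Complex.I * ((k * 0 : ℝ) : ℂ) = 0 := by simp
    have e2 : ((-2 * π * k * w : ℝ) : ℂ) * Complex.I
        = Complex.I * ((k * (-2 * π * w) : ℝ) : ℂ) := by push_cast; ring
    rw [e1, e2, Complex.exp_zero]
    ring)
  rw [Lp.eq_zero_iff_ae_eq_zero]
  filter_upwards [hz] with k hk
  have : (wt k : ℂ) ≠ 0 := by exact_mod_cast (wt_pos k).ne'
  simpa [q, conj_efun, this] using hk

theorem weak_of_dense (f : ℝ → L2) (t₀ C : ℝ) (hC : ∀ t, ‖f t‖ ≤ C)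
    (hE : ∀ x, Filter.Tendsto (fun t => ⟪E x, f t⟫_ℂ) (nhds t₀) (nhds ⟪E x, f t₀⟫_ℂ)) (g : L2) :
    Filter.Tendsto (fun t => ⟪g, f t⟫_ℂ) (nhds t₀) (nhds ⟪g, f t₀⟫_ℂ) := by
  have hspan : ∀ v ∈ Submodule.span ℂ (range E),
      Filter.Tendsto (fun t => ⟪v, f t⟫_ℂ) (nhds t₀) (nhds ⟪v, f t₀⟫_ℂ) := by
    intro v hv
    induction hv using Submodule.span_induction with
    | mem v hv => obtain ⟨x, rfl⟩ := hv; exact hE x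
    | zero => simp
    | add a b _ _ ha hb => simpa only [inner_add_left] using ha.add hb
    | smul c a _ ha => simpa only [inner_smul_left] using ha.const_mul _
  have hg : g ∈ closure (Submodule.span ℂ (range E) : Set L2) := by
    have : g ∈ (Submodule.span ℂ (range E)).topologicalClosure := by rw [dense_E]; trivial
    exact this
  have hC0 : 0 ≤ C := (norm_nonneg _).trans (hC 0)
  rw [Metric.tendsto_nhds]
  intro ε hε
  obtain ⟨v, hv, hvd⟩ := Metric.mem_closure_iff.1 hg (ε / (4 * (C + 1))) (by positivity)
  filter_upwards [Metric.tendsto_nhds.1 (hspan v hv) (ε / 2) (by positivity)] with t ht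
  have b : ∀ s, ‖⟪g - v, f s⟫_ℂ‖ ≤ ε / 4 := by
    intro s
    refine (norm_inner_le_norm _ _).trans ?_
    rw [dist_eq_norm] at hvd
    calc ‖g - v‖ * ‖f s‖ ≤ ε / (4 * (C + 1)) * (C + 1) := by
          gcongr
          linarith [hC s]
      _ = ε / 4 := by field_simp
  rw [dist_eq_norm] at ht ⊢
  have : ⟪g, f t⟫_ℂ - ⟪g, f t₀⟫_ℂ
      = ⟪g - v, f t⟫_ℂ - ⟪g - v, f t₀⟫_ℂ + (⟪v, f t⟫_ℂ - ⟪v, f t₀⟫_ℂ) := by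
    simp only [inner_sub_left]; ring
  rw [this]
  have := norm_add_le (⟪g - v, f t⟫_ℂ - ⟪g - v, f t₀⟫_ℂ) (⟪v, f t⟫_ℂ - ⟪v, f t₀⟫_ℂ)
  have := norm_sub_le ⟪g - v, f t⟫_ℂ ⟪g - v, f t₀⟫_ℂ
  linarith [b t, b t₀]

end SNLS

namespace SNLS

open scoped InnerProductSpace

/-- **Weak continuity in `H¹`.**
Let `ψ ∈ L^∞(ℝ, H¹(ℝ)) ∩ C_b(ℝ×ℝ;ℂ)` be the solution of the Duhamel equation
with data `φ`, with conserved charge and energy.  Then `t ↦ ψ(t)` is weakly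
continuous in `H¹`: for every `g ∈ H¹(ℝ)` and `t₀ ∈ ℝ`,
`⟨g, ψ(t)⟩_{H¹} → ⟨g, ψ(t₀)⟩_{H¹}` as `t → t₀`. -/
theorem weak_continuity_H1
    (U : ℂ → ℝ) (u : ℝ → ℝ) (A B : ℝ)
    (hU : ContDiff ℝ 2 U)
    (hUinv : ∀ z : ℂ, U z = u (‖z‖ ^ 2))
    (hB : 0 < B)
    (hAB : ∀ z : ℂ, A - B * ‖z‖ ^ 2 ≤ U z)
    (φ : H1) (ψ : ℝ → ℝ → ℂ) (Ψ : ℝ → H1)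
    (hcb : CbOn ψ Set.univ)
    (hsol : IsDuhamelSolution (nonlin U) φ ψ Set.univ)
    (hrep : ∀ t x : ℝ, (Ψ t).toFun x = ψ x t)
    (hbdd : ∃ M : ℝ, ∀ t : ℝ, H1.norm (Ψ t) ≤ M)
    (hQ : ∀ t : ℝ, charge (Ψ t) = charge φ)
    (hH : ∀ t : ℝ, energy U (Ψ t) = energy U φ) :
    ∀ (g : H1) (t₀ : ℝ),
      Filter.Tendsto (fun t : ℝ => H1.inner g (Ψ t)) (nhds t₀)
        (nhds (H1.inner g (Ψ t₀))) := by
  intro g t₀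
  obtain ⟨M, hM⟩ := hbdd
  have hpi : (0:ℝ) < 2 * π := by positivity
  have hpc : (((2 * π)⁻¹ : ℝ) : ℂ) ≠ 0 := by exact_mod_cast (inv_pos.2 hpi).ne'
  have hc : Continuous (fun p : ℝ × ℝ => ψ p.1 p.2) := by
    rw [← continuousOn_univ, ← Set.univ_prod_univ]; exact hcb.1
  have hnb : ∀ t, ‖J (Ψ t)‖ ≤ Real.sqrt (2 * π * M ^ 2) := by
    intro t
    apply Real.le_sqrt_of_sq_le
    rw [norm_J]
    gcongr
    have h0 : 0 ≤ (Ψ t).normSq := by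
      have := norm_J (Ψ t)
      by_contra hneg
      nlinarith [sq_nonneg ‖J (Ψ t)‖]
    have h1 : H1.norm (Ψ t) ^ 2 = (Ψ t).normSq := Real.sq_sqrt h0
    rw [← h1]
    exact pow_le_pow_left₀ (Real.sqrt_nonneg _) (hM t) 2
  have key := weak_of_dense (fun t => J (Ψ t)) t₀ _ hnb (by
    intro x
    have e : ∀ t, ⟪E x, J (Ψ t)⟫_ℂ = (2 * π) * ψ x t := by
      intro t
      rw [← hrep, inner_E]
      have : (π : ℂ) ≠ 0 := by exact_mod_cast Real.pi_ne_zero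
      push_cast
      field_simp
    simp only [e]
    have : Continuous fun t => (2 * π : ℂ) * ψ x t :=
      continuous_const.mul (hc.comp (by fun_prop : Continuous fun t : ℝ => (x, t)))
    exact this.tendsto t₀) (J g)
  simp only [inner_J]
  exact key.const_mul _

end SNLS
end
end
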